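/- For every m ≥ 2, the dihedral Artin group DA_m = ⟨a, b ∣ prod(a, b; m) = prod(b, a; m)⟩, where prod(a, b; m) denotes the alternating product aba⋯ of length m, admits a finite generating set and a normal form η which is regular and quasigeodesic, such that the solution language, with respect to η, of every finite system of equations in DA_m is EDT0L. -/

import Mathlib

namespace Paper

/-- Apply a letterwise substitution (i.e. the endomorphism of the free monoid `C*`
determined by its action on letters) to a word over `C`. -/
def subApply {C : Type*} (f : C → List C) (w : List C) : List C := (w.map f).flatten

/-- An EDT0L system: a finite extended alphabet `C`, an identification of some letters of
`C` with terminal letters of the alphabet `α` (injectively, modelling `Σ ⊆ C`), a start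
word over `C`, and a rational control: a regular language over a finite set of letterwise
substitutions (endomorphisms of `C*`), a word of endomorphisms acting by composition. -/
structure EDT0LSystem (α : Type*) where
  C : Type
  finC : Fintype C
  term : C → Option α
  term_inj : ∀ c c' a, term c = some a → term c' = some a → c = c'
  start : List C
  ι : Type
  finι : Fintype ι
  tab : ι → C → List C
  control : Language ι
  control_reg : control.IsRegular

/-- The endomorphism of `C*` given by a word of basic endomorphisms, applied to `w`
(the word `φ₁φ₂⋯φₖ` acts as `φ₁∘φ₂∘⋯∘φₖ`, functions written on the right). -/
def EDT0LSystem.apply {α : Type*} (S : EDT0LSystem α) (φs : List S.ι) (w : List S.C) :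
    List S.C :=
  φs.foldl (fun v i => subApply (S.tab i) v) w

/-- The language accepted by an EDT0L system: `{ωφ : φ ∈ R} ∩ Σ*`. -/
def EDT0LSystem.accepts {α : Type*} (S : EDT0LSystem α) : Language α :=
  { w | ∃ φs ∈ S.control, (S.apply φs S.start).map S.term = w.map Option.some }

/-- A language is EDT0L if it is accepted by some EDT0L system. -/
def IsEDT0L {α : Type*} (L : Language α) : Prop := ∃ S : EDT0LSystem α, S.accepts = L

/-- Evaluate a word over the alphabet `Σ ∪ Σ⁻¹` (a letter is a generator index together
with a sign) in a group. -/
def evalWord {G : Type*} [Group G] {ι : Type*} (gen : ι → G) (w : List (ι × Bool)) : G :=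
  (w.map fun l => if l.2 then gen l.1 else (gen l.1)⁻¹).prod

/-- The word length of `g` with respect to the generating set `gen`. -/
noncomputable def wordLength {G : Type*} [Group G] {ι : Type*} (gen : ι → G) (g : G) : ℕ :=
  sInf {n | ∃ w : List (ι × Bool), evalWord gen w = g ∧ w.length = n}

/-- A normal form is quasigeodesic if `|η(g)| ≤ λ·|g| + λ` for some `λ > 0`. -/
def IsQuasigeodesicNF {G : Type*} [Group G] {ι : Type*} (gen : ι → G)
    (η : G → List (ι × Bool)) : Prop :=
  ∃ lam : ℝ, 0 < lam ∧ ∀ g : G, ((η g).length : ℝ) ≤ lam * (wordLength gen g) + lam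

/-- A normal form is regular if its image is a regular language. -/
def IsRegularNF {G : Type*} [Group G] {ι : Type*} (η : G → List (ι × Bool)) : Prop :=
  Language.IsRegular (Set.range η : Language (ι × Bool))

/-- A subset of a group is rational if it is the image of a regular language under the
evaluation map from the free monoid on a finite monoid generating set. -/
def IsRationalSubset {G : Type*} [Group G] (A : Set G) : Prop :=
  ∃ (ι : Type) (_ : Fintype ι) (gen : ι → G) (L : Language ι),
    Submonoid.closure (Set.range gen) = ⊤ ∧ L.IsRegular ∧
      A = (fun w : List ι => (w.map gen).prod) '' L

/-- A subset of a group is recognisable if its full preimage under the evaluation map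
from the free monoid on a finite monoid generating set is a regular language. -/
def IsRecognisableSubset {G : Type*} [Group G] (A : Set G) : Prop :=
  ∃ (ι : Type) (_ : Fintype ι) (gen : ι → G),
    Submonoid.closure (Set.range gen) = ⊤ ∧
      Language.IsRegular ({w : List ι | (w.map gen).prod ∈ A} : Language ι)

/-- The word `w₁ # w₂ # ⋯ # wₘ` over `β ⊕ {#}`. -/
def hashWord {β : Type*} {m : ℕ} (ws : Fin m → List β) : List (β ⊕ Unit) :=
  List.intercalate [Sum.inr ()] (List.ofFn fun i => (ws i).map Sum.inl)

/-- `g : Fin m → G` is a solution of the system `E ⊆ G ∗ F_X` of equations. -/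
def SolvesSystem {G : Type*} [Group G] {m : ℕ}
    (E : Set (Monoid.Coprod G (FreeGroup (Fin m)))) (g : Fin m → G) : Prop :=
  ∀ e ∈ E, Monoid.Coprod.lift (MonoidHom.id G) (FreeGroup.lift g) e = 1

/-- The solution language of a system of equations with constraints, w.r.t. a normal form. -/
def solutionLanguageC {G : Type*} [Group G] {ι : Type*} (η : G → List (ι × Bool)) {m : ℕ}
    (E : Set (Monoid.Coprod G (FreeGroup (Fin m)))) (Rc : Fin m → Set G) :
    Language ((ι × Bool) ⊕ Unit) :=
  { w | ∃ g : Fin m → G, SolvesSystem E g ∧ (∀ i, g i ∈ Rc i) ∧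
      w = hashWord fun i => η (g i) }

/-- The solution language of a system of equations, w.r.t. a normal form. -/
def solutionLanguage {G : Type*} [Group G] {ι : Type*} (η : G → List (ι × Bool)) {m : ℕ}
    (E : Set (Monoid.Coprod G (FreeGroup (Fin m)))) : Language ((ι × Bool) ⊕ Unit) :=
  solutionLanguageC η E fun _ => Set.univ

/-- Evaluate a twisted word (a word over `H ∪ (F_X × Ω)`) at the assignment `g` of the
variables: each letter `(u, ψ)` becomes `ψ(uφ)` where `φ` is the homomorphism `F_X → H`
determined by `g`, and the word is multiplied out in `H`. -/
def twistedEval {H : Type*} [Group H] {m : ℕ} (Ω : Subgroup (MulAut H)) (g : Fin m → H)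
    (w : List (H ⊕ (FreeGroup (Fin m) × Ω))) : H :=
  (w.map (Sum.elim id fun p => (p.2 : MulAut H) (FreeGroup.lift g p.1))).prod

/-- The solution language of a system of `Ω`-twisted equations with constraints. -/
def twistedSolutionLanguage {H : Type*} [Group H] {ι : Type*} (Ω : Subgroup (MulAut H))
    (η : H → List (ι × Bool)) {m : ℕ}
    (E : Set (List (H ⊕ (FreeGroup (Fin m) × Ω)))) (Rc : Fin m → Set H) :
    Language ((ι × Bool) ⊕ Unit) :=
  { w | ∃ g : Fin m → H, (∀ e ∈ E, twistedEval Ω g e = 1) ∧ (∀ i, g i ∈ Rc i) ∧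
      w = hashWord fun i => η (g i) }


/-- The alternating product `xyx⋯` of length `m` in the free group on two generators. -/
def altProd (x y : FreeGroup (Fin 2)) : ℕ → FreeGroup (Fin 2)
  | 0 => 1
  | n + 1 => x * altProd y x n

/-- The defining relation set of the dihedral Artin group `DA_m`:
`prod(a,b;m) = prod(b,a;m)`. -/
def dihedralArtinRels (m : ℕ) : Set (FreeGroup (Fin 2)) :=
  {altProd (FreeGroup.of 0) (FreeGroup.of 1) m *
    (altProd (FreeGroup.of 1) (FreeGroup.of 0) m)⁻¹}

/-- The dihedral Artin group `DA_m = ⟨a, b ∣ aba⋯ = bab⋯⟩` (alternating products of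
length `m`). -/
abbrev DihedralArtin (m : ℕ) : Type := PresentedGroup (dihedralArtinRels m)

set_option linter.unusedSectionVars false

section

/-! ### Alphabets with involution -/

/-- An alphabet with a fixed-point-free involution. -/
class Invol (α : Type) where
  bar : α → α
  bar_bar : ∀ a, bar (bar a) = a
  bar_ne : ∀ a, bar a ≠ a

attribute [simp] Invol.bar_bar Invol.bar_ne

open Invol (bar bar_bar bar_ne)

lemma flatMap_congr_mem {α β : Type} {w : List α} {f g : α → List β} (h : ∀ a ∈ w, f a = g a) :
    w.flatMap f = w.flatMap g := by
  induction w with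
  | nil => rfl
  | cons a w ih => simp_all

@[simp] lemma flatMap_pure' {α : Type} (w : List α) : w.flatMap (fun a => [a]) = w := by
  induction w <;> simp_all

section Words

variable {α β γ : Type} [Invol α] [Invol β] [Invol γ]

/-- The involution induced on words: reverse the word and bar every letter. -/
def lbar (w : List α) : List α := (w.map bar).reverse

@[simp] lemma lbar_nil : lbar ([] : List α) = [] := rfl

@[simp] lemma lbar_singleton (a : α) : lbar [a] = [bar a] := rfl

@[simp] lemma lbar_append (u w : List α) : lbar (u ++ w) = lbar w ++ lbar u := by
  simp [lbar]

@[simp] lemma lbar_cons (a : α) (w : List α) : lbar (a :: w) = lbar w ++ [bar a] := by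
  simp [lbar]

@[simp] lemma lbar_lbar (w : List α) : lbar (lbar w) = w := by
  simp [lbar, List.map_reverse, Function.comp_def]

@[simp] lemma length_lbar (w : List α) : (lbar w).length = w.length := by simp [lbar]

@[simp] lemma lbar_eq_nil {w : List α} : lbar w = [] ↔ w = [] := by simp [lbar]

lemma mem_lbar {a : α} {w : List α} : a ∈ lbar w ↔ bar a ∈ w := by
  simp only [lbar, List.mem_reverse, List.mem_map]
  constructor
  · rintro ⟨b, hb, rfl⟩; simpa using hb
  · intro h; exact ⟨_, h, by simp⟩

/-- A letterwise substitution commutes with the involutions. -/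
def InvHom (f : α → List β) : Prop := ∀ a, f (bar a) = lbar (f a)

lemma InvHom.lbar_flatMap {f : α → List β} (hf : InvHom f) (w : List α) :
    lbar (w.flatMap f) = (lbar w).flatMap f := by
  induction w with
  | nil => rfl
  | cons a w ih => simp [ih, hf a]

lemma InvHom.comp {f : α → List β} {g : β → List γ} (hf : InvHom f) (hg : InvHom g) :
    InvHom fun a => (f a).flatMap g := by
  intro a; simp only [hf a, hg.lbar_flatMap]

lemma invHom_singleton : InvHom fun a : α => [a] := fun _ => rfl

end Words

/-- Symbols of an equation: constants from `C` and variables from `X` with a sign. -/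
inductive Sym (C X : Type)
  | c : C → Sym C X
  | v : X → Bool → Sym C X

/-- The extended alphabet: `A` together with `M` pairs of mutually inverse fresh letters. -/
abbrev Ext (A : Type) (M : ℕ) : Type := A ⊕ (Fin M × Bool)

instance {C X : Type} [Invol C] : Invol (Sym C X) where
  bar
    | .c a => .c (bar a)
    | .v x b => .v x !b
  bar_bar s := by cases s <;> simp
  bar_ne s := by cases s <;> simp

instance {A : Type} [Invol A] {M : ℕ} : Invol (Ext A M) where
  bar
    | .inl a => .inl (bar a)
    | .inr (j, b) => .inr (j, !b)
  bar_bar s := by rcases s with a | ⟨j, b⟩ <;> simp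
  bar_ne s := by rcases s with a | ⟨j, b⟩ <;> simp

section Sym

variable {C D X : Type} [Invol C] [Invol D]

@[simp] lemma bar_symc (a : C) : bar (Sym.c a : Sym C X) = .c (bar a) := rfl
@[simp] lemma bar_symv (x : X) (b : Bool) : bar (Sym.v x b : Sym C X) = .v x !b := rfl

/-- The substitution of constants `h`, extended by the identity on variables. -/
def liftSub (h : C → List D) : Sym C X → List (Sym D X)
  | .c a => (h a).map .c
  | .v x b => [.v x b]

/-- The assignment of words to symbols determined by the images of the positive variables. -/
def asg (s : X → List C) : Sym C X → List C
  | .c a => [a]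
  | .v x true => s x
  | .v x false => lbar (s x)

@[simp] lemma asg_c (s : X → List C) (a : C) : asg s (.c a) = [a] := rfl
@[simp] lemma asg_true (s : X → List C) (x : X) : asg s (.v x true) = s x := rfl
@[simp] lemma asg_false (s : X → List C) (x : X) : asg s (.v x false) = lbar (s x) := rfl

lemma asg_invHom (s : X → List C) : InvHom (asg s : Sym C X → List C) := by
  rintro (a | ⟨x, _ | _⟩) <;> simp

lemma InvHom.eq_asg {t : Sym C X → List C} (ht : InvHom t) (hc : ∀ a, t (.c a) = [a]) :
    t = asg fun x => t (.v x true) := by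
  funext s
  rcases s with a | ⟨x, _ | _⟩
  · simp [hc]
  · simpa using ht (.v x true)
  · rfl

end Sym

lemma map_c_flatMap {C X β : Type} (w : List C) (f : Sym C X → List β) :
    (w.map Sym.c).flatMap f = w.flatMap fun a => f (.c a) := by
  simp [List.flatMap_map]

/-! ### Systems of word equations -/

/-- A system of word equations with output word: the word at `none` is the output, and the
words at `some (k, true)` and `some (k, false)` are the two sides of the `k`-th equation. -/
abbrev WSys (C X K : Type) : Type := Option (K × Bool) → List (Sym C X)

section WSys

variable {C X K : Type} [Invol C]

/-- The assignment `s` solves all equations of `W`. -/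
def Solves (s : X → List C) (W : WSys C X K) : Prop :=
  ∀ k, (W (some (k, true))).flatMap (asg s) = (W (some (k, false))).flatMap (asg s)

/-- `W` becomes `W'` read through `h` after a substitution of its variables. -/
def Arc (W : WSys C X K) (h : C → List C) (W' : WSys C X K) : Prop :=
  InvHom h ∧ ∃ t : Sym C X → List (Sym C X), InvHom t ∧ (∀ a, t (.c a) = [.c a]) ∧
    ∀ k, (W k).flatMap t = (W' k).flatMap (liftSub h)

lemma Arc.sound {W W' : WSys C X K} {h : C → List C} (H : Arc W h W') {s' : X → List C}
    (hs : Solves s' W') :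
    ∃ s, Solves s W ∧ ∀ k, (W k).flatMap (asg s) = ((W' k).flatMap (asg s')).flatMap h := by
  obtain ⟨hh, t, ht, htc, hW⟩ := H
  let s'' : X → List C := fun x => (s' x).flatMap h
  let T : Sym C X → List C := fun a => (t a).flatMap (asg s'')
  have hT : T = asg fun x => T (.v x true) :=
    InvHom.eq_asg (ht.comp (asg_invHom _)) fun a => by simp [T, htc]
  have key : ∀ k, (W k).flatMap T = ((W' k).flatMap (asg s')).flatMap h := by
    intro k
    rw [← List.flatMap_assoc, hW k, List.flatMap_assoc, List.flatMap_assoc]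
    congr 1; funext a
    rcases a with a | ⟨x, _ | _⟩
    · simp [liftSub, map_c_flatMap]
    · simp [liftSub, s'', hh.lbar_flatMap]
    · simp [liftSub, s'']
  refine ⟨fun x => T (.v x true), ?_, ?_⟩
  · intro k
    rw [← hT, key, key, hs k]
  · intro k; rw [← hT, key]

end WSys

/-! ### EDT0L languages from labelled graphs -/

/-- `GraphPath step fin n ls`: the labels `ls` are read along a path from `n` to a final node. -/
inductive GraphPath {N Φ : Type} (step : N → Φ → N → Prop) (fin : N → Prop) : N → List Φ → Prop
  | nil {n : N} : fin n → GraphPath step fin n []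
  | cons {n n' : N} {i : Φ} {l : List Φ} : step n i n' → GraphPath step fin n' l →
      GraphPath step fin n (i :: l)

lemma isRegular_graphPath {N Φ : Type} [Finite N] (step : N → Φ → N → Prop) (fin : N → Prop)
    (start : N → Prop) :
    Language.IsRegular ({l | ∃ n, start n ∧ GraphPath step fin n l} : Language Φ) := by
  classical
  let A : NFA Φ N := ⟨fun n i => {n' | step n i n'}, {n | start n}, {n | fin n}⟩
  have key : ∀ (l : List Φ) (S : Set N),
      l ∈ A.acceptsFrom S ↔ ∃ n ∈ S, GraphPath step fin n l := by
    intro l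
    induction l with
    | nil =>
      intro S
      rw [NFA.nil_mem_acceptsFrom]
      constructor
      · rintro ⟨n, hn, hf⟩; exact ⟨n, hn, .nil hf⟩
      · rintro ⟨n, hn, h⟩; cases h with | nil hf => exact ⟨n, hn, hf⟩
    | cons i l ih =>
      intro S
      rw [NFA.cons_mem_acceptsFrom, ih]
      constructor
      · rintro ⟨n', hn', h⟩
        obtain ⟨n, hn, hs⟩ := NFA.mem_stepSet.1 hn'
        exact ⟨n, hn, .cons hs h⟩
      · rintro ⟨n, hn, h⟩
        cases h with
        | cons hs h => exact ⟨_, NFA.mem_stepSet.2 ⟨n, hn, hs⟩, h⟩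
  have : ({l | ∃ n, start n ∧ GraphPath step fin n l} : Language Φ) = A.accepts := by
    ext l
    exact (key l _).symm
  rw [this, ← NFA.toDFA_correct]
  have := Fintype.ofFinite N
  exact ⟨_, inferInstance, _, rfl⟩

/-- The composite substitution `ψ ∘ φ₁ ∘ ⋯ ∘ φₖ` on letters. -/
def foldSub {C : Type} (φs : List (C → List C)) (w : List C) : List C :=
  φs.foldr (fun φ v => v.flatMap φ) w

@[simp] lemma foldSub_nil {C : Type} (w : List C) : foldSub [] w = w := rfl

@[simp] lemma foldSub_cons {C : Type} (φ : C → List C) (φs : List (C → List C)) (w : List C) :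
    foldSub (φ :: φs) w = (foldSub φs w).flatMap φ := rfl

lemma foldSub_flatMap {C : Type} (φs : List (C → List C)) (w : List C) :
    foldSub φs w = w.flatMap fun c => foldSub φs [c] := by
  induction φs with
  | nil => simp [foldSub]
  | cons φ φs ih =>
    rw [foldSub_cons, ih, List.flatMap_assoc]; rfl

lemma subApply_eq {C : Type} (f : C → List C) (w : List C) : subApply f w = w.flatMap f := by
  simp [subApply, List.flatMap]

/-- A finite graph labelled by substitutions generates an EDT0L language. -/
theorem isEDT0L_of_graph {α C N Φ : Type} [Finite C] [Finite N] [Finite Φ]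
    (term : C → Option α) (term_inj : ∀ c c' a, term c = some a → term c' = some a → c = c')
    (tab : Φ → C → List C) (w0 : List C) (step : N → Φ → N → Prop) (start fin : N → Prop)
    (L : Language α)
    (hL : ∀ w, w ∈ L ↔ ∃ n ls, start n ∧ GraphPath step fin n ls ∧
      (foldSub (ls.map tab) w0).map term = w.map some) : IsEDT0L L := by
  let S : EDT0LSystem α :=
    { C := C, finC := Fintype.ofFinite C, term := term, term_inj := term_inj, start := w0,
      ι := Φ, finι := Fintype.ofFinite Φ, tab := tab
      control := Language.reverse {l | ∃ n, start n ∧ GraphPath step fin n l}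
      control_reg := (isRegular_graphPath step fin start).reverse }
  refine ⟨S, ?_⟩
  have happ : ∀ (ls : List Φ), S.apply ls.reverse w0 = foldSub (ls.map tab) w0 := by
    intro ls
    simp only [EDT0LSystem.apply, List.foldl_reverse, foldSub, List.foldr_map, subApply_eq]
    rfl
  ext w
  rw [hL]
  constructor
  · rintro ⟨φs, hφ, h⟩
    obtain ⟨n, hn, hp⟩ := hφ
    refine ⟨n, φs.reverse, hn, hp, ?_⟩
    rw [← happ, List.reverse_reverse]; exact h
  · rintro ⟨n, ls, hn, hp, h⟩
    refine ⟨ls.reverse, ?_, ?_⟩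
    · change ls.reverse.reverse ∈ ({l | ∃ n, start n ∧ GraphPath step fin n l} : Language Φ)
      rw [List.reverse_reverse]; exact ⟨n, hn, hp⟩
    · change (S.apply ls.reverse w0).map term = _
      rw [happ]; exact h

/-! ### The graph of bounded systems -/

instance finite_boundedList {α : Type} [Finite α] (n : ℕ) :
    Finite {l : List α // l.length ≤ n} := (List.finite_length_le α n).to_subtype

instance {C X : Type} [Finite C] [Finite X] : Finite (Sym C X) := by
  let f : Sym C X → C ⊕ (X × Bool) := fun s => match s with
    | .c a => .inl a
    | .v x b => .inr (x, b)
  refine Finite.of_injective f ?_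
  rintro (a | ⟨x, b⟩) (a' | ⟨x', b'⟩) h <;> simp_all [f]

/-- Is the symbol a variable? -/
def Sym.isVar {C X : Type} : Sym C X → Bool
  | .c _ => false
  | .v _ _ => true

section Graph

variable (C X K : Type) (N B : ℕ)

/-- Substitutions with images of length at most `B`. -/
abbrev Lab : Type := C → {l : List C // l.length ≤ B}

/-- Systems all of whose words have length at most `N`. -/
abbrev BSys : Type := Option (K × Bool) → {l : List (Sym C X) // l.length ≤ N}

/-- Nodes are bounded systems with a set of admissible loops, and one final node. -/
abbrev CNode : Type := Option (BSys C X K N × Set (Lab C B))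

variable {C X K N B}

/-- The substitution underlying a label. -/
def Lab.sub (i : Lab C B) (c : C) : List C := (i c).1

/-- The system underlying a bounded system. -/
def BSys.sys (W : BSys C X K N) : WSys C X K := fun k => (W k).1

variable [Invol C]

/-- Edges of the graph of bounded systems. -/
inductive CStep (c0 : C) : CNode C X K N B → Lab C B → CNode C X K N B → Prop
  | loop {W : BSys C X K N} {V : Set (Lab C B)} {i : Lab C B} : i ∈ V →
      CStep c0 (some (W, V)) i (some (W, V))
  | edge {W W' : BSys C X K N} {V V' : Set (Lab C B)} {i : Lab C B} :
      (∀ φs : List (Lab C B), (∀ φ ∈ φs, φ ∈ V') →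
        Arc W.sys (fun c => foldSub (i.sub :: φs.map Lab.sub) [c]) W'.sys) →
      CStep c0 (some (W, V)) i (some (W', V'))
  | fin {W : BSys C X K N} {V : Set (Lab C B)} {i : Lab C B} :
      W.sys none = (i.sub c0).map .c →
      (∀ k, W.sys (some (k, true)) = W.sys (some (k, false))) →
      CStep c0 (some (W, V)) i none

lemma CStep.sound {c0 : C} {n : CNode C X K N B} {ls : List (Lab C B)}
    (h : GraphPath (CStep c0) (· = none) n ls) :
    ∀ W V, n = some (W, V) → ∃ φs : List (Lab C B), (∀ φ ∈ φs, φ ∈ V) ∧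
      ∃ s : X → List C, Solves s W.sys ∧
        foldSub (ls.map Lab.sub) [c0] =
          foldSub (φs.map Lab.sub) ((W.sys none).flatMap (asg s)) := by
  induction h with
  | nil hn => rintro W V rfl; cases hn
  | @cons n n' i l hs hp ih =>
    rintro W V rfl
    cases hs with
    | loop hi =>
      obtain ⟨φs, hφ, s, hs, e⟩ := ih W V rfl
      exact ⟨i :: φs, by simpa using ⟨hi, hφ⟩, s, hs, by simp [e]⟩
    | edge hA =>
      obtain ⟨φs, hφ, s', hs', e⟩ := ih _ _ rfl
      obtain ⟨s, hs, hW⟩ := (hA φs hφ).sound hs'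
      refine ⟨[], by simp, s, hs, ?_⟩
      simp only [List.map_cons, foldSub_cons, List.map_nil, foldSub_nil, e, hW none]
      rw [← foldSub_cons, foldSub_flatMap]
      rfl
    | fin h0 he =>
      have : l = [] := by
        cases hp with
        | nil _ => rfl
        | cons h _ => cases h
      subst this
      refine ⟨[], by simp, fun _ => [], fun k => by rw [he k], ?_⟩
      simp [h0, map_c_flatMap]

end Graph

section Complete

variable {A X K : Type} [Fintype K] {M : ℕ}

/-- Total length of a system. -/
def wsize {C : Type} (W : WSys C X K) : ℕ := ∑ k, (W k).length

/-- Total number of variable occurrences in a system. -/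
def vcount {C : Type} (W : WSys C X K) : ℕ := ∑ k, (W k).countP Sym.isVar

lemma length_le_wsize {C : Type} (W : WSys C X K) (k : Option (K × Bool)) :
    (W k).length ≤ wsize W :=
  Finset.single_le_sum (f := fun k => (W k).length) (fun _ _ => Nat.zero_le _)
    (Finset.mem_univ k)

/-- Every fresh letter used by the assignment is visible in the system, up to inversion. -/
def Clean (s : X → List (Ext A M)) (W : WSys (Ext A M) X K) : Prop :=
  ∀ x j b, Sum.inr (j, b) ∈ s x → ∃ k b', Sym.c (Sum.inr (j, b')) ∈ W k

variable [Invol A]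

/-- The conclusion of a compression round. -/
def Shrinks (B : ℕ) (s : X → List (Ext A M)) (W : WSys (Ext A M) X K) : Prop :=
  ∃ (W' : WSys (Ext A M) X K) (s' : X → List (Ext A M)) (i : Lab (Ext A M) B)
    (V : Set (Lab (Ext A M) B)) (φs : List (Lab (Ext A M) B)),
    (∀ φ ∈ φs, φ ∈ V) ∧
    (∀ φs : List (Lab (Ext A M) B), (∀ φ ∈ φs, φ ∈ V) →
      Arc W (fun c => foldSub (i.sub :: φs.map Lab.sub) [c]) W') ∧
    Solves s' W' ∧
    (∀ k, (W k).flatMap (asg s) = ((W' k).flatMap (asg s')).flatMap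
      fun c => foldSub (i.sub :: φs.map Lab.sub) [c]) ∧
    (∀ a, foldSub (i.sub :: φs.map Lab.sub) [Sum.inl a] = [Sum.inl a]) ∧
    (∀ c, foldSub (i.sub :: φs.map Lab.sub) [c] ≠ []) ∧
    (∀ x, ((s' x).flatMap fun c => foldSub (i.sub :: φs.map Lab.sub) [c]) <:+: s x) ∧
    vcount W' ≤ vcount W ∧ wsize W' < wsize W

lemma arc_flatMap {C : Type} [Invol C] (W : WSys C X K) (t : Sym C X → List (Sym C X))
    (ht : InvHom t) (htc : ∀ a, t (.c a) = [.c a]) :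
    Arc W (fun c => [c]) fun k => (W k).flatMap t := by
  refine ⟨invHom_singleton, t, ht, htc, fun k => ?_⟩
  have : (liftSub fun c : C => [c]) = fun s : Sym C X => [s] := by
    funext s; cases s <;> rfl
  simp only [this, flatMap_pure']

/-- The positive image determines an involution-compatible substitution of variables. -/
def vsub {C Y : Type} [Invol C] (f : X → List (Sym C Y)) : Sym C X → List (Sym C Y)
  | .c a => [.c a]
  | .v x true => f x
  | .v x false => lbar (f x)

lemma vsub_invHom {C Y : Type} [Invol C] (f : X → List (Sym C Y)) : InvHom (vsub f) := by
  rintro (a | ⟨x, _ | _⟩) <;> simp [vsub]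

lemma vsub_asg {C Y : Type} [Invol C] {f : X → List (Sym C Y)} {s : X → List C} {s' : Y → List C}
    (h : ∀ x, (f x).flatMap (asg s') = s x) (w : List (Sym C X)) :
    (w.flatMap (vsub f)).flatMap (asg s') = w.flatMap (asg s) := by
  rw [List.flatMap_assoc]
  congr 1; funext a
  rcases a with a | ⟨x, _ | _⟩
  · simp [vsub]
  · simp [vsub, ← h, (asg_invHom s').lbar_flatMap]
  · simp [vsub, h]

lemma solves_vsub {C : Type} [Invol C] {f : X → List (Sym C X)} {s s' : X → List C}
    (h : ∀ x, (f x).flatMap (asg s') = s x) {W : WSys C X K} (hs : Solves s W) :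
    Solves s' fun k => (W k).flatMap (vsub f) := by
  intro k
  simp only [vsub_asg h]
  exact hs k

section Steps

variable {C : Type} [Invol C]

lemma remove_step {W : WSys C X K} {s : X → List C} (hs : Solves s W) {x : X} (hsx : s x = [])
    {k : Option (K × Bool)} {b : Bool} (hx : Sym.v x b ∈ W k) :
    ∃ W', Arc W (fun c => [c]) W' ∧ Solves s W' ∧ vcount W' ≤ vcount W ∧ wsize W' < wsize W ∧
      ∀ k, (W' k).flatMap (asg s) = (W k).flatMap (asg s) := by
  classical
  let f : X → List (Sym C X) := fun y => if y = x then [] else [.v y true]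
  have hf : ∀ y, (f y).flatMap (asg s) = s y := by
    intro y
    by_cases h : y = x
    · subst h; simp [f, hsx]
    · simp [f, h]
  have hfy : ∀ y, f y = [] ∨ f y = [.v y true] := by
    intro y
    by_cases h : y = x
    · exact .inl (if_pos h)
    · exact .inr (if_neg h)
  have hlen : ∀ a : Sym C X, (vsub f a).length ≤ 1 := by
    rintro (a | ⟨y, _ | _⟩)
    · simp [vsub]
    all_goals rcases hfy y with h | h <;> simp [vsub, h]
  have hcnt : ∀ a : Sym C X, (vsub f a).countP Sym.isVar ≤ if a.isVar then 1 else 0 := by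
    rintro (a | ⟨y, _ | _⟩)
    · simp [vsub, Sym.isVar]
    all_goals rcases hfy y with h | h <;> simp [vsub, h, Sym.isVar]
  have hl : ∀ w : List (Sym C X), (w.flatMap (vsub f)).length ≤ w.length := by
    intro w
    induction w with
    | nil => simp
    | cons a w ihw =>
      have := hlen a
      rw [List.flatMap_cons, List.length_append, List.length_cons]; omega
  have hl2 : ∀ w : List (Sym C X), Sym.v x b ∈ w → (w.flatMap (vsub f)).length < w.length := by
    intro w hw
    induction w with
    | nil => simp at hw
    | cons a w ihw =>
      rw [List.flatMap_cons, List.length_append, List.length_cons]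
      rcases List.mem_cons.1 hw with rfl | hw
      · have h0 : vsub f (Sym.v x b) = [] := by cases b <;> simp [vsub, f]
        have := hl w
        rw [h0, List.length_nil]; omega
      · have := hlen a; have := ihw hw; omega
  have hc : ∀ w : List (Sym C X), (w.flatMap (vsub f)).countP Sym.isVar ≤ w.countP Sym.isVar := by
    intro w
    induction w with
    | nil => simp
    | cons a w ihw =>
      have := hcnt a
      rw [List.flatMap_cons, List.countP_append, List.countP_cons]; omega
  exact ⟨fun k => (W k).flatMap (vsub f), arc_flatMap W _ (vsub_invHom f) fun _ => rfl,
    solves_vsub hf hs, Finset.sum_le_sum fun k _ => hc _,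
    Finset.sum_lt_sum (fun k _ => hl _) ⟨k, Finset.mem_univ _, hl2 _ hx⟩, fun k => vsub_asg hf _⟩

lemma pop_step [DecidableEq X] {W : WSys C X K} {s : X → List C} (hs : Solves s W) {x : X}
    {c : C} {u : List C} (hsx : s x = c :: u) :
    ∃ W', Arc W (fun c => [c]) W' ∧ Solves (Function.update s x u) W' ∧ vcount W' ≤ vcount W ∧
      wsize W' ≤ wsize W + vcount W ∧
      ∀ k, (W' k).flatMap (asg (Function.update s x u)) = (W k).flatMap (asg s) := by
  let f : X → List (Sym C X) := fun y => if y = x then [.c c, .v y true] else [.v y true]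
  have hf : ∀ y, (f y).flatMap (asg (Function.update s x u)) = s y := by
    intro y
    by_cases h : y = x
    · subst h; simp [f, hsx]
    · simp [f, h]
  have hfy : ∀ y, f y = [.c c, .v y true] ∨ f y = [.v y true] := by
    intro y
    by_cases h : y = x
    · exact .inl (if_pos h)
    · exact .inr (if_neg h)
  have hlen : ∀ a : Sym C X, (vsub f a).length ≤ 1 + if a.isVar then 1 else 0 := by
    rintro (a | ⟨y, _ | _⟩)
    · simp [vsub, Sym.isVar]
    all_goals rcases hfy y with h | h <;> simp [vsub, h, Sym.isVar]
  have hcnt : ∀ a : Sym C X, (vsub f a).countP Sym.isVar ≤ if a.isVar then 1 else 0 := by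
    rintro (a | ⟨y, _ | _⟩)
    · simp [vsub, Sym.isVar]
    all_goals rcases hfy y with h | h <;> simp [vsub, h, Sym.isVar, List.countP_cons]
  have hl : ∀ w : List (Sym C X),
      (w.flatMap (vsub f)).length ≤ w.length + w.countP Sym.isVar := by
    intro w
    induction w with
    | nil => simp
    | cons a w ihw =>
      have := hlen a
      rw [List.flatMap_cons, List.length_append, List.length_cons, List.countP_cons]; omega
  have hc : ∀ w : List (Sym C X), (w.flatMap (vsub f)).countP Sym.isVar ≤ w.countP Sym.isVar := by
    intro w
    induction w with
    | nil => simp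
    | cons a w ihw =>
      have := hcnt a
      rw [List.flatMap_cons, List.countP_append, List.countP_cons]; omega
  refine ⟨fun k => (W k).flatMap (vsub f), arc_flatMap W _ (vsub_invHom f) fun _ => rfl,
    solves_vsub hf hs, Finset.sum_le_sum fun k _ => hc _, ?_, fun k => vsub_asg hf _⟩
  calc _ ≤ ∑ k, ((W k).length + (W k).countP Sym.isVar) := Finset.sum_le_sum fun k _ => hl _
    _ = wsize W + vcount W := Finset.sum_add_distrib

end Steps

lemma exists_eq_map_c {C X : Type} {w : List (Sym C X)} (h : ∀ a ∈ w, a.isVar = false) :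
    ∃ u : List C, w = u.map .c := by
  induction w with
  | nil => exact ⟨[], rfl⟩
  | cons a w ih =>
    obtain ⟨u, rfl⟩ := ih fun b hb => h b (by simp [hb])
    have := h a (by simp)
    rcases a with a | _
    · exact ⟨a :: u, rfl⟩
    · simp [Sym.isVar] at this

/-- Clean an assignment: hidden fresh letters are replaced by their values. -/
lemma exists_clean (W : WSys (Ext A M) X K) (s : X → List (Ext A M)) (hs : Solves s W)
    (g : Ext A M → List (Ext A M)) (hg : InvHom g) (hgA : ∀ a, g (.inl a) = [.inl a])
    (hgb : ∀ c, ∀ d ∈ g c, ∃ a, d = Sum.inl a) :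
    ∃ s', Solves s' W ∧ Clean s' W ∧ (∀ x, (s' x).flatMap g = (s x).flatMap g) ∧
      ∀ k, ((W k).flatMap (asg s')).flatMap g = ((W k).flatMap (asg s)).flatMap g := by
  classical
  let vis : Ext A M → Prop := fun c => match c with
    | .inl _ => True
    | .inr (j, _) => ∃ k b', Sym.c (Sum.inr (j, b')) ∈ W k
  have hvis : ∀ c, vis (bar c) ↔ vis c := by
    rintro (a | ⟨j, b⟩) <;> exact Iff.rfl
  let r : Ext A M → List (Ext A M) := fun c => if vis c then [c] else g c
  have hr : InvHom r := by
    intro c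
    simp only [r, hvis]
    split_ifs
    · rfl
    · exact hg c
  have hrg : ∀ w : List (Ext A M), (w.flatMap r).flatMap g = w.flatMap g := by
    intro w
    rw [List.flatMap_assoc]
    congr 1; funext c
    simp only [r]
    split_ifs
    · simp
    · rw [flatMap_congr_mem (g := fun d => [d]) (fun d hd => ?_), flatMap_pure']
      obtain ⟨a, rfl⟩ := hgb c d hd
      exact hgA a
  have hW : ∀ k, (W k).flatMap (asg fun x => (s x).flatMap r) =
      ((W k).flatMap (asg s)).flatMap r := by
    intro k
    rw [List.flatMap_assoc]
    refine flatMap_congr_mem fun a ha => ?_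
    rcases a with a | ⟨x, _ | _⟩
    · have : vis a := by
        rcases a with a | ⟨j, b⟩
        · trivial
        · exact ⟨k, b, ha⟩
      simp [r, this]
    · simp [hr.lbar_flatMap]
    · simp
  refine ⟨fun x => (s x).flatMap r, ?_, ?_, fun x => hrg _, fun k => by rw [hW, hrg]⟩
  · intro k; rw [hW, hW, hs k]
  · intro x j b h
    obtain ⟨c, -, hc⟩ := List.mem_flatMap.1 h
    simp only [r] at hc
    split_ifs at hc with hv
    · rw [List.mem_singleton] at hc
      subst hc; exact hv
    · obtain ⟨a, ha⟩ := hgb c _ hc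
      cases ha

end Complete

section Complete

variable {A X K : Type} [Invol A] [Fintype X] [Fintype K] {M N B : ℕ}

/-- Bundle a system with words of bounded length. -/
def BSys.mk' {C : Type} (W : WSys C X K) (h : wsize W ≤ N) : BSys C X K N :=
  fun k => ⟨W k, (length_le_wsize W k).trans h⟩

/-- The identity substitution as a label. -/
def Lab.id {C : Type} (h : 1 ≤ B) : Lab C B := fun c => ⟨[c], h⟩

lemma CStep.edge_of_arc {C : Type} [Invol C] {c0 : C} {W W' : WSys C X K} (h : wsize W ≤ N)
    (h' : wsize W' ≤ N) (V : Set (Lab C B)) (hB : 1 ≤ B) (hA : Arc W (fun c => [c]) W') :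
    CStep c0 (some (BSys.mk' W h, V)) (Lab.id hB) (some (BSys.mk' W' h', ∅)) := by
  refine .edge fun φs hφ => ?_
  have : φs = [] := by
    cases φs with
    | nil => rfl
    | cons φ φs => exact absurd (hφ φ (by simp)) (Set.notMem_empty _)
  subst this
  simpa [Lab.sub, Lab.id] using! hA

lemma GraphPath.loops {C : Type} [Invol C] {c0 : C} {W : BSys C X K N} {V : Set (Lab C B)}
    {φs ls : List (Lab C B)} (hφ : ∀ φ ∈ φs, φ ∈ V)
    (h : GraphPath (CStep c0) (· = none) (some (W, V)) ls) :
    GraphPath (CStep c0) (· = none) (some (W, V)) (φs ++ ls) := by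
  induction φs with
  | nil => exact h
  | cons φ φs ih =>
    exact .cons (.loop (hφ φ (by simp))) (ih fun φ' h' => hφ φ' (by simp [h']))

lemma foldSub_append {C : Type} (φs φs' : List (C → List C)) (w : List C) :
    foldSub (φs ++ φs') w = foldSub φs (foldSub φs' w) := by
  simp [foldSub, List.foldr_append]

theorem exists_path {N' n0 : ℕ} (hN : N' + n0 ≤ N) (hB : N ≤ B) (hB1 : 1 ≤ B)
    (hround : ∀ (W : WSys (Ext A M) X K) (s : X → List (Ext A M)), Solves s W → Clean s W →
      wsize W ≤ N → N' < wsize W → vcount W ≤ n0 → Shrinks B s W) (c0 : Ext A M) :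
    ∀ (μ : ℕ) (W : WSys (Ext A M) X K) (hW : wsize W ≤ N) (s : X → List (Ext A M))
      (g : Ext A M → List (Ext A M)), Solves s W → vcount W ≤ n0 →
      InvHom g → (∀ a, g (.inl a) = [.inl a]) → (∀ c, ∀ d ∈ g c, ∃ a, d = Sum.inl a) →
      (∀ c, g c ≠ []) → (∑ x, ((s x).flatMap g).length) * (N + 1) + wsize W = μ →
      ∀ V : Set (Lab (Ext A M) B), ∃ ls,
        GraphPath (CStep c0) (· = none) (some (BSys.mk' W hW, V)) ls ∧
        (foldSub (ls.map Lab.sub) [c0]).flatMap g = ((W none).flatMap (asg s)).flatMap g := by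
  classical
  intro μ
  induction μ using Nat.strong_induction_on with
  | _ μ ih =>
  intro W hW s g hs hvc hg hgA hgb hgn hμ V
  by_cases hsz : wsize W ≤ N'
  · by_cases hvar : ∃ k x b, Sym.v x b ∈ W k
    · obtain ⟨k, x, b, hx⟩ := hvar
      have hid : (Lab.id hB1 : Lab (Ext A M) B).sub = fun c => [c] := rfl
      rcases hsx : s x with _ | ⟨c, u⟩
      · obtain ⟨W', hA, hs', hvc', hlt, hout⟩ := remove_step hs hsx hx
        obtain ⟨ls, hp, he⟩ := ih _ (by rw [← hμ]; omega) W' (hlt.le.trans hW) s g hs'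
          (hvc'.trans hvc) hg hgA hgb hgn rfl ∅
        refine ⟨Lab.id hB1 :: ls, .cons (CStep.edge_of_arc _ _ V hB1 hA) hp, ?_⟩
        rw [List.map_cons, foldSub_cons, hid, flatMap_pure', he, hout]
      · obtain ⟨W', hA, hs', hvc', hle, hout⟩ := pop_step hs hsx
        have hmu : ∑ y, ((Function.update s x u y).flatMap g).length <
            ∑ y, ((s y).flatMap g).length := by
          refine Finset.sum_lt_sum (fun y _ => ?_) ⟨x, Finset.mem_univ _, ?_⟩
          · by_cases h : y = x
            · subst h; simp [hsx]
            · simp [h]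
          · have := List.length_pos_iff.2 (hgn c)
            simp only [Function.update_self, hsx, List.flatMap_cons, List.length_append]
            omega
        obtain ⟨ls, hp, he⟩ := ih _ (by
            rw [← hμ]
            have := Nat.mul_le_mul_right (N + 1) (Nat.succ_le_of_lt hmu)
            rw [Nat.succ_mul] at this
            omega) W' (by omega) _ g hs' (hvc'.trans hvc) hg hgA hgb hgn rfl ∅
        refine ⟨Lab.id hB1 :: ls, .cons (CStep.edge_of_arc _ _ V hB1 hA) hp, ?_⟩
        rw [List.map_cons, foldSub_cons, hid, flatMap_pure', he, hout]
    · push Not at hvar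
      have hno : ∀ k, ∃ u : List (Ext A M), W k = u.map .c := by
        intro k
        refine exists_eq_map_c fun a ha => ?_
        rcases a with a | ⟨x, b⟩
        · rfl
        · exact absurd ha (hvar k x b)
      obtain ⟨u, hu⟩ := hno none
      have hul : u.length ≤ B := by
        have := length_le_wsize W none
        rw [hu, List.length_map] at this
        omega
      refine ⟨[fun _ => ⟨u, hul⟩], .cons (.fin hu fun k => ?_) (.nil rfl), ?_⟩
      · obtain ⟨w1, h1⟩ := hno (some (k, true))
        obtain ⟨w2, h2⟩ := hno (some (k, false))
        have := hs k
        simp only [h1, h2, map_c_flatMap, asg_c, flatMap_pure'] at this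
        change W _ = W _
        rw [h1, h2, this]
      · simp [Lab.sub, hu, map_c_flatMap]
  · obtain ⟨s1, hs1, hcl, hmeas, hout⟩ := exists_clean W s hs g hg hgA hgb
    obtain ⟨W', s', i, V', φs, hφ, harc, hs', hWW, hA, hne, hinf, hvc', hlt⟩ :=
      hround W s1 hs1 hcl hW (not_le.1 hsz) hvc
    set h : Ext A M → List (Ext A M) := fun c => foldSub (i.sub :: φs.map Lab.sub) [c] with hh
    have hinv : InvHom h := (harc φs hφ).1
    have hb : ∀ w : List (Ext A M), ∀ d ∈ w.flatMap g, ∃ a, d = Sum.inl a := by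
      intro w d hd
      obtain ⟨c, -, hc⟩ := List.mem_flatMap.1 hd
      exact hgb c d hc
    have hsum : ∑ x, ((s' x).flatMap fun c => (h c).flatMap g).length ≤
        ∑ x, ((s x).flatMap g).length := by
      refine Finset.sum_le_sum fun x _ => ?_
      rw [← hmeas x, ← List.flatMap_assoc]
      obtain ⟨p, q, e⟩ := hinf x
      rw [← e]
      simp only [List.flatMap_append, List.length_append]
      omega
    obtain ⟨ls, hp, he⟩ := ih _ (by
        rw [← hμ]
        have := Nat.mul_le_mul_right (N + 1) hsum
        omega) W' (hlt.le.trans hW) s' (fun c => (h c).flatMap g) hs' (hvc'.trans hvc)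
      (hinv.comp hg) (fun a => by simp [hA, hh, hgA, -foldSub_cons])
      (fun c d hd => hb _ d hd)
      (fun c hc => by
        obtain ⟨d, hd⟩ := List.exists_mem_of_ne_nil _ (hne c)
        exact hgn d (List.flatMap_eq_nil_iff.1 hc d hd)) rfl V'
    refine ⟨i :: (φs ++ ls), .cons (.edge harc) (hp.loops hφ), ?_⟩
    rw [← hout, hWW, List.map_cons, List.map_append, ← List.cons_append, foldSub_append,
      foldSub_flatMap, List.flatMap_assoc, he, ← List.flatMap_assoc]

end Complete

section Core

variable {A X K J : Type} [Invol A] [Fintype X] [Fintype K] {M N B : ℕ}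

/-- Embed a system over `A` into the extended alphabet. -/
def embSys (M : ℕ) (W : WSys A X K) : WSys (Ext A M) X K := fun k =>
  (W k).flatMap (liftSub fun a => [Sum.inl a])

lemma embSys_asg (W : WSys A X K) (s : X → List A) (k : Option (K × Bool)) :
    (embSys M W k).flatMap (asg fun x => (s x).map Sum.inl) =
      ((W k).flatMap (asg s)).map Sum.inl := by
  rw [embSys, List.flatMap_assoc, List.map_flatMap]
  congr 1; funext a
  rcases a with a | ⟨x, _ | _⟩
  · simp [liftSub]
  · simp [liftSub, lbar, Function.comp_def]; intros; rfl
  · simp [liftSub]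

/-- The solution language of a finite family of systems is EDT0L, given compression rounds. -/
theorem isEDT0L_of_rounds [Finite A] [Nonempty A] {N' n0 : ℕ} (hN : N' + n0 ≤ N) (hB : N ≤ B)
    (hB1 : 1 ≤ B)
    (hround : ∀ (W : WSys (Ext A M) X K) (s : X → List (Ext A M)), Solves s W → Clean s W →
      wsize W ≤ N → N' < wsize W → vcount W ≤ n0 → Shrinks B s W)
    (W0 : J → WSys A X K) (hocc : ∀ j k x b, .v x b ∈ W0 j k → ∃ b', .v x b' ∈ W0 j none)
    (hsz : ∀ j, wsize (embSys M (W0 j)) ≤ N) (hvc : ∀ j, vcount (embSys M (W0 j)) ≤ n0) :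
    IsEDT0L ({w | ∃ j s, Solves s (W0 j) ∧ (W0 j none).flatMap (asg s) = w} : Language A) := by
  classical
  obtain ⟨a0⟩ := ‹Nonempty A›
  let g : Ext A M → List (Ext A M) := fun c => match c with
    | .inl a => [.inl a]
    | .inr (_, true) => [.inl a0]
    | .inr (_, false) => [.inl (bar a0)]
  have hginv : InvHom g := by
    rintro (a | ⟨i, _ | _⟩)
    · rfl
    · change [Sum.inl a0] = [Sum.inl (bar (bar a0))]
      rw [Invol.bar_bar]
    · rfl
  have hg1 : ∀ c, (g c).length ≤ B := by
    rintro (a | ⟨i, _ | _⟩) <;> exact hB1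
  let gl : Lab (Ext A M) B := fun c => ⟨g c, hg1 c⟩
  have hfold : ∀ φs : List (Lab (Ext A M) B), (∀ φ ∈ φs, φ ∈ ({gl} : Set _)) →
      InvHom (fun c => foldSub (φs.map Lab.sub) [c]) ∧
        ∀ a, foldSub (φs.map Lab.sub) [Sum.inl a] = [Sum.inl a] := by
    intro φs hφ
    induction φs with
    | nil => exact ⟨invHom_singleton, fun _ => rfl⟩
    | cons φ φs ih =>
      obtain ⟨h1, h2⟩ := ih fun φ' h => hφ φ' (by simp [h])
      obtain rfl : φ = gl := hφ φ (by simp)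
      refine ⟨h1.comp hginv, fun a => ?_⟩
      rw [List.map_cons, foldSub_cons, h2]; rfl
  refine isEDT0L_of_graph (C := Ext A M) (N := CNode (Ext A M) X K N B) (Φ := Lab (Ext A M) B)
    (fun c => c.getLeft?) ?_ Lab.sub [Sum.inl a0] (CStep (Sum.inl a0))
    (fun n => ∃ j, n = some (BSys.mk' (embSys M (W0 j)) (hsz j), {gl})) (· = none) _ ?_
  · rintro (c | c) (c' | c') a h h' <;> simp_all
  intro w
  constructor
  · rintro ⟨j, s, hs, rfl⟩
    obtain ⟨ls, hp, he⟩ := exists_path hN hB hB1 hround (Sum.inl a0) _ (embSys M (W0 j)) (hsz j)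
      (fun x => (s x).map Sum.inl) g (fun k => by rw [embSys_asg, embSys_asg, hs k]) (hvc j)
      hginv
      (fun _ => rfl)
      (by rintro (a | ⟨i, _ | _⟩) d hd <;> exact ⟨_, List.mem_singleton.1 hd⟩)
      (by rintro (a | ⟨i, _ | _⟩) h <;> cases h) rfl {gl}
    refine ⟨_, gl :: ls, ⟨j, rfl⟩, .cons (.loop rfl) hp, ?_⟩
    have hg : (gl : Lab (Ext A M) B).sub = g := rfl
    rw [List.map_cons, foldSub_cons, hg, he, embSys_asg, List.flatMap_map]
    generalize (W0 j none).flatMap (asg s) = u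
    clear he
    induction u with
    | nil => rfl
    | cons a u ih => simpa [g] using ih
  · rintro ⟨n, ls, ⟨j, rfl⟩, hp, he⟩
    obtain ⟨φs, hφ, s₀, hs, h⟩ := CStep.sound hp _ _ rfl
    obtain ⟨hi1, hi2⟩ := hfold φs hφ
    have harc : Arc (embSys M (W0 j)) (fun c => foldSub (φs.map Lab.sub) [c])
        (embSys M (W0 j)) := by
      refine ⟨hi1, fun s => [s], invHom_singleton, fun _ => rfl, fun k => ?_⟩
      refine flatMap_congr_mem fun c hc => ?_
      obtain ⟨d, -, hd⟩ := List.mem_flatMap.1 hc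
      rcases d with d | ⟨y, b'⟩ <;> simp only [liftSub, List.map_cons, List.map_nil,
        List.mem_singleton] at hd <;> subst hd <;> simp [liftSub, hi2]
    obtain ⟨s, hs, h'⟩ := harc.sound hs
    replace h := h.trans ((foldSub_flatMap _ _).trans (h' none).symm)
    rw [h] at he
    have hval : ((embSys M (W0 j)) none).flatMap (asg s) = w.map Sum.inl := by
      generalize (embSys M (W0 j) none).flatMap (asg s) = u at he
      clear h hs hφ h'
      induction u generalizing w with
      | nil => cases w <;> simp_all
      | cons c u ih =>
        cases w with
        | nil => simp at he
        | cons a w =>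
          simp only [List.map_cons, List.cons.injEq] at he ⊢
          exact ⟨by rcases c with c | c <;> simp_all, ih _ he.2⟩
    let s' : X → List A := fun x => (s x).filterMap Sum.getLeft?
    have hx : ∀ x b, Sym.v x b ∈ W0 j none → (s' x).map Sum.inl = s x := by
      intro x b hx
      have hm : ∀ c ∈ s x, ∃ a, c = Sum.inl a := by
        intro c hc
        have h1 : Sym.v x b ∈ embSys M (W0 j) none :=
          List.mem_flatMap.2 ⟨_, hx, by simp [liftSub]⟩
        rcases b with _ | _
        · have h2 : bar c ∈ w.map Sum.inl := by
            rw [← hval]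
            exact List.mem_flatMap.2 ⟨_, h1, by rw [asg_false, mem_lbar]; simpa using hc⟩
          obtain ⟨a, -, ha⟩ := List.mem_map.1 h2
          exact ⟨bar a, by rw [← Invol.bar_bar c, ← ha]; rfl⟩
        · have h2 : c ∈ w.map Sum.inl := by
            rw [← hval]
            exact List.mem_flatMap.2 ⟨_, h1, hc⟩
          obtain ⟨a, -, ha⟩ := List.mem_map.1 h2
          exact ⟨a, ha.symm⟩
      change (List.filterMap _ _).map _ = _
      generalize s x = u at hm
      induction u with
      | nil => rfl
      | cons c u ih =>
        obtain ⟨a, rfl⟩ := hm c (by simp)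
        simpa using ih fun c hc => hm c (by simp [hc])
    have hk : ∀ k, (embSys M (W0 j) k).flatMap (asg s) =
        (embSys M (W0 j) k).flatMap (asg fun x => (s' x).map Sum.inl) := by
      intro k
      refine flatMap_congr_mem fun c hc => ?_
      rcases c with c | ⟨x, b⟩
      · rfl
      · obtain ⟨d, hd, hdx⟩ := List.mem_flatMap.1 hc
        rcases d with d | ⟨y, b'⟩
        · simp [liftSub] at hdx
        · simp only [liftSub, List.mem_singleton, Sym.v.injEq] at hdx
          obtain ⟨rfl, rfl⟩ := hdx
          obtain ⟨b', hb'⟩ := hocc j k x b hd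
          cases b <;> simp [hx x b' hb']
    have hinj : Function.Injective (List.map (Sum.inl : A → Ext A M)) :=
      List.map_injective_iff.2 Sum.inl_injective
    refine ⟨j, s', fun k => ?_, ?_⟩
    · have := hs k
      rw [hk, hk, embSys_asg, embSys_asg] at this
      exact hinj this
    · rw [hk, embSys_asg] at hval
      exact hinj hval

end Core

/-! ### Maximal chains -/

section Chains

variable {C β : Type} (J : C → C → Bool)

/-- Is the last letter of `u` related to the first letter of `w`? -/
def JL (u w : List C) : Bool :=
  match u.getLast?, w.head? with
  | some a, some b => J a b
  | _, _ => false

lemma JL_eq_false {u w : List C} :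
    JL J u w = false ↔ ∀ x ∈ u.getLast?, ∀ y ∈ w.head?, J x y = false := by
  rcases h : u.getLast? with _ | a <;> rcases h' : w.head? with _ | b <;> simp [JL, h, h']

lemma JL_eq_true {u w : List C} (h : JL J u w = true) :
    ∀ x ∈ u.getLast?, ∀ y ∈ w.head?, J x y = true := by
  rcases h1 : u.getLast? with _ | a <;> rcases h2 : w.head? with _ | b <;> simp_all [JL]

lemma head?_flatMap_cons {F : β → List C} {g : β} (hg : F g ≠ []) (gs : List β) :
    ((g :: gs).flatMap F).head? = (F g).head? := by
  rw [List.flatMap_cons, List.head?_append]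
  cases h : F g with
  | nil => exact absurd h hg
  | cons a u => simp

lemma splitBy_flatMap {gs : List β} {F : β → List C} (hF : ∀ g ∈ gs, F g ≠ [])
    (hc : gs.IsChain fun a b => JL J (F a) (F b) = false) :
    (gs.flatMap F).splitBy J = gs.flatMap fun g => (F g).splitBy J := by
  induction gs with
  | nil => rfl
  | cons g gs ih =>
    have hc' := hc.tail
    rw [List.flatMap_cons, List.splitBy_append, ih (fun g hg => hF g (by simp [hg])) hc',
      List.flatMap_cons]
    rcases gs with _ | ⟨g', gs⟩
    · simp
    · rw [head?_flatMap_cons (hF g' (by simp)), ← JL_eq_false]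
      exact (List.isChain_cons_cons.1 hc).1

lemma isChain_flatMap {gs : List β} {F : β → List C} (hF : ∀ g ∈ gs, F g ≠ [])
    (hj : ∀ g ∈ gs, (F g).IsChain fun a b => J a b = true)
    (hc : gs.IsChain fun a b => JL J (F a) (F b) = true) :
    (gs.flatMap F).IsChain fun a b => J a b = true := by
  induction gs with
  | nil => simp
  | cons g gs ih =>
    have hc' := hc.tail
    rw [List.flatMap_cons, List.isChain_append]
    refine ⟨hj g (by simp), ih (fun g hg => hF g (by simp [hg]))
      (fun g hg => hj g (by simp [hg])) hc', ?_⟩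
    rcases gs with _ | ⟨g', gs⟩
    · simp
    · rw [head?_flatMap_cons (hF g' (by simp))]
      exact JL_eq_true J (List.isChain_cons_cons.1 hc).1

variable [Invol C]

lemma getLast?_lbar (u : List C) : (lbar u).getLast? = u.head?.map bar := by
  simp [lbar]

lemma head?_lbar (u : List C) : (lbar u).head? = u.getLast?.map bar := by
  simp [lbar]

variable {J}

lemma JL_lbar (hJ : ∀ a b, J a b = J (bar b) (bar a)) (u w : List C) : JL J (lbar w) (lbar u) = JL J u w := by
  rw [JL, JL, getLast?_lbar, head?_lbar]
  rcases h : u.getLast? with _ | a <;> rcases h' : w.head? with _ | b <;> simp [← hJ]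

lemma isChain_lbar (hJ : ∀ a b, J a b = J (bar b) (bar a)) {u : List C}
    (h : u.IsChain fun a b => J a b = true) :
    (lbar u).IsChain fun a b => J a b = true := by
  rw [lbar, List.isChain_reverse, List.isChain_map]
  refine h.imp fun a b h => ?_
  rw [← hJ]; exact h

lemma splitBy_lbar (hJ : ∀ a b, J a b = J (bar b) (bar a)) (w : List C) :
    (lbar w).splitBy J = ((w.splitBy J).map lbar).reverse := by
  have hf : ((w.splitBy J).map lbar).reverse.flatten = lbar w := by
    conv_rhs => rw [← List.flatten_splitBy J w]
    induction w.splitBy J with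
    | nil => rfl
    | cons u us ih => simp [ih]
  rw [List.splitBy_eq_iff]
  refine ⟨hf.symm, ?_, ?_, ?_⟩
  · simp [List.nil_notMem_splitBy]
  · intro m hm
    obtain ⟨u, hu, rfl⟩ := List.mem_map.1 (List.mem_reverse.1 hm)
    exact isChain_lbar hJ (List.isChain_of_mem_splitBy hu)
  · rw [List.isChain_reverse, List.isChain_map]
    refine (List.isChain_getLast_head_splitBy J w).imp ?_
    rintro u v ⟨hu, hv, h⟩
    refine ⟨by simpa using hv, by simpa using hu, ?_⟩
    have e : JL J (lbar v) (lbar u) = false := by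
      rw [JL_lbar hJ, JL_eq_false, List.getLast?_eq_getLast_of_ne_nil hu, List.head?_eq_some_head hv]
      simpa using h
    exact JL_eq_false J |>.1 e _ (List.getLast_mem_getLast? _) _ (List.head_mem_head? _)

end Chains

/-! ### Uncrossing: splitting off the outer chains of variables -/

section Uncross

variable {C X K : Type}

/-- Variables after uncrossing: the old ones together with a prefix and a suffix chain. -/
abbrev UVar (X : Type) : Type := X ⊕ (X × Bool)

/-- The replacement of a variable whose value has the given list of chains. -/
def uncSub : List (List C) → X → List (Sym C (UVar X))
  | [], _ => []
  | [_], x => [.v (.inr (x, true)) true]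
  | [_, _], x => [.v (.inr (x, true)) true, .v (.inr (x, false)) true]
  | _ :: _ :: _ :: _, x =>
    [.v (.inr (x, true)) true, .v (.inl x) true, .v (.inr (x, false)) true]

/-- The values of the variables after uncrossing. -/
def uncVal (J : C → C → Bool) (s : X → List C) : UVar X → List C
  | .inl x => ((s x).splitBy J).tail.dropLast.flatten
  | .inr (x, true) => ((s x).splitBy J).headD []
  | .inr (x, false) => ((s x).splitBy J).getLastD []

/-- Is the symbol one of the old variables? -/
def isOld : Sym C (UVar X) → Bool
  | .v (.inl _) _ => true
  | _ => false

lemma getLast?_flatten_concat {us : List (List C)} {u : List C} (hu : u ≠ []) :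
    (us ++ [u]).flatten.getLast? = u.getLast? := by
  rw [List.flatten_append, List.flatten_singleton, List.getLast?_append_of_ne_nil _ hu]

lemma head?_flatten_cons {us : List (List C)} {u : List C} (hu : u ≠ []) :
    (u :: us).flatten.head? = u.head? := by
  rw [List.flatten_cons, List.head?_append_of_ne_nil _ hu]

lemma flatten_flatMap {α β : Type} (L : List (List α)) (f : α → List β) :
    L.flatten.flatMap f = L.flatMap fun l => l.flatMap f := by
  induction L with
  | nil => rfl
  | cons l L ih => simp [ih]

lemma isChain_and {α : Type} {R S : α → α → Prop} {l : List α} (h : l.IsChain R)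
    (h' : l.IsChain S) : l.IsChain fun a b => R a b ∧ S a b := by
  induction h with
  | nil => exact .nil
  | singleton a => exact .singleton a
  | cons_cons hr _ ih =>
    rw [List.isChain_cons_cons] at h'
    exact .cons_cons ⟨hr, h'.1⟩ (ih h'.2)

lemma isChain_JL_splitBy (J : C → C → Bool) (w : List C) :
    (w.splitBy J).IsChain fun a b => JL J a b = false := by
  refine (List.isChain_getLast_head_splitBy J w).imp ?_
  rintro u v ⟨hu, hv, h⟩
  rw [JL_eq_false, List.getLast?_eq_getLast_of_ne_nil hu, List.head?_eq_some_head hv]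
  simpa using h

variable [Invol C] (J : C → C → Bool) (s : X → List C)

/-- Two adjacent symbols must not be joined if one of them is an old variable. -/
def Apart (a b : Sym C (UVar X)) : Prop :=
  isOld a = true ∨ isOld b = true → JL J (asg (uncVal J s) a) (asg (uncVal J s) b) = false

/-- The properties of the blocks replacing symbols. -/
structure UncBlock (l : List (Sym C (UVar X))) : Prop where
  ne : ∀ a ∈ l, asg (uncVal J s) a ≠ []
  chain : ∀ a ∈ l, isOld a = false → (asg (uncVal J s) a).IsChain fun a b => J a b = true
  apart : l.IsChain (Apart J s)
  head : ∀ a ∈ l.head?, isOld a = false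
  last : ∀ a ∈ l.getLast?, isOld a = false

lemma uncSub_spec (x : X) : UncBlock J s (uncSub ((s x).splitBy J) x) ∧
    (uncSub ((s x).splitBy J) x).flatMap (asg (uncVal J s)) = s x := by
  have hnil := List.nil_notMem_splitBy J (s x)
  have hch : ∀ u ∈ (s x).splitBy J, u.IsChain fun a b => J a b = true :=
    fun u hu => List.isChain_of_mem_splitBy hu
  have hbd := isChain_JL_splitBy J (s x)
  have hfl := List.flatten_splitBy J (s x)
  rcases hcs : (s x).splitBy J with _ | ⟨u, cs⟩
  · rw [hcs] at hfl
    refine ⟨⟨?_, ?_, ?_, ?_, ?_⟩, ?_⟩ <;> simp [uncSub, ← hfl]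
  rw [hcs] at hnil hch hbd hfl
  have hP : uncVal J s (.inr (x, true)) = u := by simp [uncVal, hcs]
  have hu : u ≠ [] := fun h => hnil (by simp [h])
  rcases List.eq_nil_or_concat' cs with rfl | ⟨mid, z, rfl⟩
  · have := hch u (by simp)
    refine ⟨⟨?_, ?_, ?_, ?_, ?_⟩, ?_⟩ <;> simp_all [uncSub, isOld]
  have hQ : uncVal J s (.inr (x, false)) = z := by
    simp only [uncVal, hcs]
    rw [← List.cons_append, List.getLastD_concat]
  have hz : z ≠ [] := fun h => hnil (by simp [h])
  have hcu := hch u (by simp)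
  have hcz := hch z (by simp)
  rcases mid with _ | ⟨m, ms⟩
  · refine ⟨⟨?_, ?_, ?_, ?_, ?_⟩, ?_⟩ <;> simp_all [uncSub, isOld, Apart]
  · have hM : uncVal J s (.inl x) = (m :: ms).flatten := by
      simp only [uncVal, hcs, List.tail_cons, List.dropLast_concat]
    have hm : m ≠ [] := fun h => hnil (by simp [h])
    have hM0 : (m :: ms).flatten ≠ [] := by simp [hm]
    have e : (uncSub (u :: (m :: ms ++ [z])) x : List (Sym C (UVar X))) =
        [.v (.inr (x, true)) true, .v (.inl x) true, .v (.inr (x, false)) true] := by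
      cases ms <;> rfl
    have b1 : JL J u (m :: ms).flatten = false := by
      have h := (List.isChain_cons_cons.1 hbd).1
      rw [JL_eq_false] at h ⊢
      rwa [head?_flatten_cons hm]
    have b2 : JL J (m :: ms).flatten z = false := by
      have h := hbd.tail
      rw [List.tail_cons, List.isChain_append] at h
      have h3 := h.2.2
      rcases List.eq_nil_or_concat' (m :: ms) with h0 | ⟨ms', m', h0⟩
      · cases h0
      have hm' : m' ≠ [] := fun h => hnil (by
        have : m' ∈ m :: ms := by rw [h0]; simp
        rw [← h]; simp only [List.mem_cons, List.mem_append] at this ⊢; tauto)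
      rw [h0] at h3 ⊢
      have := h3 m' (by simp) z (by simp)
      rw [JL_eq_false] at this ⊢
      rwa [getLast?_flatten_concat hm']
    rw [e]
    refine ⟨⟨?_, ?_, ?_, ?_, ?_⟩, ?_⟩
    · simp [hP, hM, hQ, hu, hz, hm]
    · simp [isOld, hP, hQ, hcu, hcz]
    · simp only [List.isChain_cons_cons, List.isChain_singleton, Apart, asg_true, hP, hM, hQ]
      exact ⟨fun _ => b1, fun _ => b2, trivial⟩
    · simp [isOld]
    · simp [isOld]
    · simp only [List.flatMap_cons, asg_true, hP, hM, hQ, List.flatMap_nil, ← hfl]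
      simp

@[simp] lemma isOld_bar (a : Sym C (UVar X)) : isOld (bar a) = isOld a := by
  rcases a with a | ⟨x | x, b⟩ <;> rfl

/-- The uncrossing substitution. -/
def unc : Sym C X → List (Sym C (UVar X)) := vsub fun x => uncSub ((s x).splitBy J) x

variable (hJ : ∀ a b, J a b = J (bar b) (bar a))

variable {J s} in
lemma UncBlock.lbar (hJ : ∀ a b, J a b = J (bar b) (bar a)) {l : List (Sym C (UVar X))}
    (h : UncBlock J s l) : UncBlock J s (lbar l) where
  ne a ha := by
    rw [mem_lbar] at ha
    have := h.ne _ ha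
    rwa [asg_invHom, Ne, lbar_eq_nil] at this
  chain a ha hN := by
    rw [mem_lbar] at ha
    have := isChain_lbar hJ (h.chain _ ha (by simpa using hN))
    rwa [asg_invHom, lbar_lbar] at this
  apart := by
    rw [Paper.lbar, List.isChain_reverse, List.isChain_map]
    refine h.apart.imp fun a b h h' => ?_
    rw [asg_invHom, asg_invHom, JL_lbar hJ]
    exact h (by simpa [or_comm] using h')
  head a ha := by
    rw [head?_lbar] at ha
    obtain ⟨b, hb, rfl⟩ := Option.mem_map.1 ha
    simpa using h.last b hb
  last a ha := by
    rw [getLast?_lbar] at ha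
    obtain ⟨b, hb, rfl⟩ := Option.mem_map.1 ha
    simpa using h.head b hb

lemma unc_block (hJ : ∀ a b, J a b = J (bar b) (bar a)) (a : Sym C X) :
    UncBlock J s (unc J s a) := by
  rcases a with a | ⟨x, _ | _⟩
  · constructor <;> simp [unc, vsub, isOld]
  · exact (uncSub_spec J s x).1.lbar hJ
  · exact (uncSub_spec J s x).1

lemma UncBlock.flatMap (hJ : ∀ a b, J a b = J (bar b) (bar a)) (w : List (Sym C X)) :
    UncBlock J s (w.flatMap (unc J s)) := by
  induction w with
  | nil => constructor <;> simp
  | cons a w ih =>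
    have ha := unc_block J s hJ a
    rw [List.flatMap_cons]
    refine ⟨?_, ?_, ?_, ?_, ?_⟩
    · intro b hb
      exact (List.mem_append.1 hb).elim (ha.ne b) (ih.ne b)
    · intro b hb
      exact (List.mem_append.1 hb).elim (ha.chain b) (ih.chain b)
    · rw [List.isChain_append]
      refine ⟨ha.apart, ih.apart, fun x hx y hy h => ?_⟩
      rw [ha.last x hx, ih.head y hy] at h
      simp at h
    · intro b hb
      rcases hu : unc J s a with _ | ⟨c, l⟩
      · rw [hu] at hb; exact ih.head b hb
      · refine ha.head b ?_
        rw [hu] at hb ⊢; exact hb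
    · intro b hb
      rcases List.eq_nil_or_concat' (w.flatMap (unc J s)) with hu | ⟨l, c, hu⟩
      · rw [hu, List.append_nil] at hb; exact ha.last b hb
      · refine ih.last b ?_
        rw [hu] at hb ⊢
        rw [← List.append_assoc] at hb
        simpa using hb

lemma unc_asg (w : List (Sym C X)) :
    (w.flatMap (unc J s)).flatMap (asg (uncVal J s)) = w.flatMap (asg s) :=
  vsub_asg (fun x => (uncSub_spec J s x).2) w

lemma length_unc (a : Sym C X) : (unc J s a).length ≤ 1 + 2 * if a.isVar then 1 else 0 := by
  have : ∀ x : X, (uncSub ((s x).splitBy J) x).length ≤ 3 := by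
    intro x
    rcases (s x).splitBy J with _ | ⟨_, _ | ⟨_, _ | _⟩⟩ <;> simp [uncSub]
  rcases a with a | ⟨x, _ | _⟩
  · simp [unc, vsub, Sym.isVar]
  all_goals simpa [unc, vsub, Sym.isVar] using this x

lemma countP_unc (a : Sym C X) : (unc J s a).countP isOld ≤ if a.isVar then 1 else 0 := by
  have h : ∀ x : X, (uncSub ((s x).splitBy J) x).countP isOld ≤ 1 := by
    intro x
    rcases (s x).splitBy J with _ | ⟨_, _ | ⟨_, _ | _⟩⟩ <;>
      simp [uncSub, isOld, List.countP_cons]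
  have h' : ∀ l : List (Sym C (UVar X)), (lbar l).countP isOld = l.countP isOld := by
    intro l
    rw [lbar, List.countP_reverse, List.countP_map]
    congr 1; funext a; simp
  rcases a with a | ⟨x, _ | _⟩
  · simp [unc, vsub, Sym.isVar, isOld]
  · simpa [unc, vsub, Sym.isVar, h'] using h x
  · simpa [unc, vsub, Sym.isVar] using h x

lemma length_flatMap_unc (w : List (Sym C X)) :
    (w.flatMap (unc J s)).length ≤ w.length + 2 * w.countP Sym.isVar := by
  induction w with
  | nil => simp
  | cons a w ih =>
    have := length_unc J s a
    rw [List.flatMap_cons, List.length_append, List.length_cons, List.countP_cons]; omega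

lemma countP_flatMap_unc (w : List (Sym C X)) :
    (w.flatMap (unc J s)).countP isOld ≤ w.countP Sym.isVar := by
  induction w with
  | nil => simp
  | cons a w ih =>
    have := countP_unc J s a
    rw [List.flatMap_cons, List.countP_append, List.countP_cons]; omega

/-! ### Groups of symbols -/

/-- Adjacent symbols whose words are joined into one chain. -/
def grel (a b : Sym C (UVar X)) : Bool :=
  !isOld a && !isOld b && JL J (asg (uncVal J s) a) (asg (uncVal J s) b)

/-- The maximal groups of joined symbols of the uncrossed word. -/
def grp (w : List (Sym C X)) : List (List (Sym C (UVar X))) :=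
  (w.flatMap (unc J s)).splitBy (grel J s)

/-- The word of a group. -/
def gword (G : List (Sym C (UVar X))) : List C := G.flatMap (asg (uncVal J s))

lemma grp_spec (hJ : ∀ a b, J a b = J (bar b) (bar a)) {w : List (Sym C X)}
    {G : List (Sym C (UVar X))} (hG : G ∈ grp J s w) :
    gword J s G ≠ [] ∧ ((∃ x b, G = [.v (.inl x) b]) ∨
      (∀ a ∈ G, isOld a = false) ∧ (gword J s G).IsChain fun a b => J a b = true) := by
  have hB := UncBlock.flatMap J s hJ w
  have hmem : ∀ a ∈ G, a ∈ w.flatMap (unc J s) := by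
    intro a ha
    rw [← List.flatten_splitBy (grel J s) (w.flatMap (unc J s))]
    exact List.mem_flatten.2 ⟨G, hG, ha⟩
  have hne : G ≠ [] := List.ne_nil_of_mem_splitBy hG
  have hch : G.IsChain fun a b => grel J s a b = true := List.isChain_of_mem_splitBy hG
  refine ⟨?_, ?_⟩
  · obtain ⟨a, ha⟩ := List.exists_mem_of_ne_nil _ hne
    exact fun h => hB.ne a (hmem a ha) (List.flatMap_eq_nil_iff.1 h a ha)
  · by_cases hold : ∃ x b, G = [.v (.inl x) b]
    · exact .inl hold
    have hno : ∀ a ∈ G, isOld a = false := by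
      rcases G with _ | ⟨a, _ | ⟨a', G⟩⟩
      · exact absurd rfl hne
      · intro b hb
        rw [List.mem_singleton] at hb
        subst hb
        rcases b with b | ⟨x | x, t⟩
        · rfl
        · exact absurd ⟨x, t, rfl⟩ hold
        · rfl
      · have h1 := (List.isChain_cons_cons.1 hch).1
        have h2 := (List.isChain_cons_cons.1 hch).2
        clear hold hmem hne hch hG
        have key : ∀ (l : List (Sym C (UVar X))) a, isOld a = false →
            (a :: l).IsChain (fun a b => grel J s a b = true) → ∀ b ∈ a :: l, isOld b = false := by
          intro l
          induction l with
          | nil => intro a ha _ b hb; rw [List.mem_singleton.1 hb]; exact ha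
          | cons c l ih =>
            intro a ha hc b hb
            rw [List.isChain_cons_cons] at hc
            rcases List.mem_cons.1 hb with rfl | hb
            · exact ha
            · exact ih c (by simp [grel] at hc; exact hc.1.1.2) hc.2 b hb
        intro b hb
        simp only [grel, Bool.and_eq_true, Bool.not_eq_true'] at h1
        rcases List.mem_cons.1 hb with rfl | hb
        · exact h1.1.1
        · exact key G a' h1.1.2 h2 b hb
    refine .inr ⟨hno, isChain_flatMap J (fun a ha => hB.ne a (hmem a ha))
      (fun a ha => hB.chain a (hmem a ha) (hno a ha)) (hch.imp fun a b h => ?_)⟩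
    simp only [grel, Bool.and_eq_true] at h
    exact h.2

lemma splitBy_grp (hJ : ∀ a b, J a b = J (bar b) (bar a)) (w : List (Sym C X)) :
    (w.flatMap (asg s)).splitBy J = (grp J s w).flatMap fun G => (gword J s G).splitBy J := by
  have hB := UncBlock.flatMap J s hJ w
  have hfl : w.flatMap (asg s) = (grp J s w).flatMap (gword J s) := by
    rw [← unc_asg J s]
    conv_lhs => rw [← List.flatten_splitBy (grel J s) (w.flatMap (unc J s))]
    exact flatten_flatMap _ _
  rw [hfl]
  refine splitBy_flatMap J (fun G hG => (grp_spec J s hJ hG).1) ?_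
  have hap := hB.apart
  rw [← List.flatten_splitBy (grel J s) (w.flatMap (unc J s)),
    List.isChain_flatten (List.nil_notMem_splitBy _ _)] at hap
  have hnemem : ∀ G ∈ grp J s w, ∀ a ∈ G, asg (uncVal J s) a ≠ [] := by
    intro G hG a ha
    refine hB.ne a ?_
    rw [← List.flatten_splitBy (grel J s) (w.flatMap (unc J s))]
    exact List.mem_flatten.2 ⟨G, hG, ha⟩
  have hbd := List.isChain_getLast_head_splitBy (grel J s) (w.flatMap (unc J s))
  refine (isChain_and hap.2 hbd).imp_of_mem_imp ?_
  rintro G G' hG hG' ⟨h1, hu, hv, h2⟩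
  have ha := List.getLast_mem hu
  have hb := List.head_mem hv
  have h3 := h1 _ (List.getLast_mem_getLast? hu) _ (List.head_mem_head? hv)
  have h4 : JL J (asg (uncVal J s) (G.getLast hu)) (asg (uncVal J s) (G'.head hv)) = false := by
    by_cases ho : isOld (G.getLast hu) = true ∨ isOld (G'.head hv) = true
    · exact h3 ho
    · rw [not_or, Bool.not_eq_true, Bool.not_eq_true] at ho
      simpa [grel, ho.1, ho.2] using h2
  have e1 : (gword J s G).getLast? = (asg (uncVal J s) (G.getLast hu)).getLast? := by
    conv_lhs => rw [← List.dropLast_append_getLast hu]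
    rw [gword, List.flatMap_append, List.flatMap_singleton,
      List.getLast?_append_of_ne_nil _ (hnemem G hG _ ha)]
  have e2 : (gword J s G').head? = (asg (uncVal J s) (G'.head hv)).head? := by
    conv_lhs => rw [← List.cons_head_tail hv]
    exact head?_flatMap_cons (hnemem G' hG' _ hb) _
  rw [JL_eq_false] at h4 ⊢
  rwa [e1, e2]

end Uncross

/-! ### Compression of chains -/

section Compress

variable {C X K : Type} [Invol C] (J : C → C → Bool) (s : X → List C) (κ : List C → List C)

/-- Replace every maximal chain `u` by `κ u`. -/
def comp (w : List C) : List C := (w.splitBy J).flatMap κ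

lemma comp_lbar (hJ : ∀ a b, J a b = J (bar b) (bar a)) (hκ : ∀ u, κ (lbar u) = lbar (κ u))
    (w : List C) : comp J κ (lbar w) = lbar (comp J κ w) := by
  rw [comp, comp, splitBy_lbar hJ]
  induction w.splitBy J with
  | nil => rfl
  | cons u us ih => simp [ih, hκ]

lemma comp_of_isChain {u : List C} (hu : u ≠ []) (h : u.IsChain fun a b => J a b = true) :
    comp J κ u = κ u := by
  have : u.splitBy J = [u] := by
    rw [List.splitBy_eq_iff]
    simp [hu, h]
  simp [comp, this]

/-- Forget the chain variables. -/
def normSym : Sym C (UVar X) → List (Sym C X)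
  | .v (.inl x) b => [.v x b]
  | _ => []

/-- The compressed form of a group of symbols. -/
def khat (G : List (Sym C (UVar X))) : List (Sym C X) :=
  if G.any isOld then G.flatMap normSym else (κ (gword J s G)).map .c

/-- The compressed system. -/
def compSys (W : WSys C X K) : WSys C X K :=
  fun k => (grp J s (W k)).flatMap (khat J s κ)

/-- The compressed assignment. -/
def compVal (x : X) : List C := comp J κ (uncVal J s (.inl x))

lemma compSys_asg (hJ : ∀ a b, J a b = J (bar b) (bar a)) (hκ : ∀ u, κ (lbar u) = lbar (κ u))
    (W : WSys C X K) (k : Option (K × Bool)) :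
    (compSys J s κ W k).flatMap (asg (compVal J s κ)) = comp J κ ((W k).flatMap (asg s)) := by
  rw [comp, splitBy_grp J s hJ, compSys, List.flatMap_assoc, List.flatMap_assoc]
  refine flatMap_congr_mem fun G hG => ?_
  obtain ⟨hne, ⟨x, b, rfl⟩ | ⟨hno, hc⟩⟩ := grp_spec J s hJ hG
  · rcases b with _ | _
    · simp only [khat, normSym, compVal, isOld, gword, List.any_cons, List.any_nil, Bool.or_false,
        if_true, List.flatMap_cons, List.flatMap_nil, List.append_nil, asg_false]
      rw [← comp, comp_lbar J κ hJ hκ]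
    · simp [khat, normSym, compVal, isOld, gword, comp]
  · rw [← comp, comp_of_isChain J κ hne hc]
    have : G.any isOld = false := by simpa using hno
    simp [khat, this, map_c_flatMap]

lemma solves_compSys (hJ : ∀ a b, J a b = J (bar b) (bar a)) (hκ : ∀ u, κ (lbar u) = lbar (κ u))
    {W : WSys C X K} (hs : Solves s W) : Solves (compVal J s κ) (compSys J s κ W) := by
  intro k
  rw [compSys_asg J s κ hJ hκ, compSys_asg J s κ hJ hκ, hs k]

lemma arc_compSys (hJ : ∀ a b, J a b = J (bar b) (bar a)) (W : WSys C X K)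
    {h : C → List C} (hh : InvHom h) (ρ : X × Bool → List C)
    (hρ : ∀ k, ∀ G ∈ grp J s (W k), (∀ a ∈ G, isOld a = false) →
      G.flatMap (asg (Sum.elim (fun _ => []) ρ)) = (κ (gword J s G)).flatMap h) :
    Arc W h (compSys J s κ W) := by
  let f : UVar X → List (Sym C X) := Sum.elim (fun x => [.v x true]) fun y => (ρ y).map .c
  have hlm : ∀ w : List C, lbar (w.map (Sym.c : C → Sym C X)) = (lbar w).map .c := by
    intro w; simp [lbar, Function.comp_def]
  refine ⟨hh, fun a => (unc J s a).flatMap (vsub f), (vsub_invHom _).comp (vsub_invHom f),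
    fun a => rfl, fun k => ?_⟩
  rw [← List.flatMap_assoc]
  conv_lhs => rw [← List.flatten_splitBy (grel J s) ((W k).flatMap (unc J s))]
  rw [flatten_flatMap, compSys, List.flatMap_assoc]
  refine flatMap_congr_mem fun G hG => ?_
  obtain ⟨hne, ⟨x, b, rfl⟩ | ⟨hno, hc⟩⟩ := grp_spec J s hJ hG
  · rcases b with _ | _ <;> simp [khat, normSym, isOld, vsub, f, liftSub]
  · have h1 : G.any isOld = false := by simpa using hno
    rw [khat, if_neg (by simp [h1]), map_c_flatMap]
    have h2 : ((κ (gword J s G)).flatMap fun a => liftSub h (.c a : Sym C X)) =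
        ((κ (gword J s G)).flatMap h).map .c := by
      rw [List.map_flatMap]; rfl
    rw [h2, ← hρ k G hG hno, List.map_flatMap]
    refine flatMap_congr_mem fun a ha => ?_
    have := hno a ha
    rcases a with a | ⟨x | y, _ | _⟩
    · rfl
    · simp [isOld] at this
    · simp [isOld] at this
    · simp [vsub, f, hlm]
    · simp [vsub, f]

lemma compVal_isInfix {h : C → List C} {x : X}
    (hx : (comp J κ (uncVal J s (.inl x))).flatMap h = uncVal J s (.inl x)) :
    ((compVal J s κ x).flatMap h) <:+: s x := by
  rw [compVal, hx, uncVal]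
  conv_rhs => rw [← List.flatten_splitBy J (s x)]
  rcases (s x).splitBy J with _ | ⟨u, us⟩
  · simp
  · rcases List.eq_nil_or_concat' us with rfl | ⟨mid, z, rfl⟩
    · simp
    · rw [List.tail_cons, List.dropLast_concat]
      exact ⟨u, z, by simp⟩

lemma mem_uncVal {x : X} {a : C} (h : a ∈ uncVal J s (.inl x)) : a ∈ s x := by
  rw [uncVal] at h
  rw [← List.flatten_splitBy J (s x)]
  obtain ⟨u, hu, ha⟩ := List.mem_flatten.1 h
  exact List.mem_flatten.2 ⟨u, List.mem_of_mem_tail (List.mem_of_mem_dropLast hu), ha⟩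

lemma countP_flatMap_normSym (G : List (Sym C (UVar X))) :
    (G.flatMap normSym).countP Sym.isVar ≤ G.countP isOld := by
  induction G with
  | nil => simp
  | cons a G ih =>
    rw [List.flatMap_cons, List.countP_append, List.countP_cons]
    have : (normSym a).countP Sym.isVar ≤ if isOld a = true then 1 else 0 := by
      rcases a with a | ⟨x | x, b⟩ <;> simp [normSym, isOld, Sym.isVar]
    omega

lemma countP_khat (G : List (Sym C (UVar X))) :
    (khat J s κ G).countP Sym.isVar ≤ G.countP isOld := by
  rw [khat]
  split_ifs
  · exact countP_flatMap_normSym G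
  · have : ((κ (gword J s G)).map (Sym.c : C → Sym C X)).countP Sym.isVar = 0 := by
      rw [List.countP_map, List.countP_eq_zero]; simp [Sym.isVar]
    omega

lemma vcount_compSys [Fintype K] (W : WSys C X K) : vcount (compSys J s κ W) ≤ vcount W := by
  refine Finset.sum_le_sum fun k _ => le_trans ?_ (countP_flatMap_unc J s (W k))
  conv_rhs => rw [← List.flatten_splitBy (grel J s) ((W k).flatMap (unc J s))]
  rw [compSys, grp]
  induction ((W k).flatMap (unc J s)).splitBy (grel J s) with
  | nil => simp
  | cons G gs ih =>
    have := countP_khat J s κ G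
    rw [List.flatMap_cons, List.countP_append, List.flatten_cons, List.countP_append]; omega

end Compress

/-! ### Naming chains by fresh letters -/

section Orient

variable {C : Type} [Invol C]

/-- A choice of one word from each pair of mutually inverse words. -/
def Pos (u : List C) : Prop := lbar u = u ∨ WellOrderingRel u (lbar u)

lemma pos_lbar {u : List C} (h : lbar u ≠ u) : Pos (lbar u) ↔ ¬ Pos u := by
  simp only [Pos, lbar_lbar, h, h.symm, false_or]
  constructor
  · exact fun h1 h2 => asymm_of WellOrderingRel h1 h2
  · intro h1
    rcases trichotomous_of WellOrderingRel u (lbar u) with h2 | h2 | h2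
    · exact absurd h2 h1
    · exact absurd h2.symm h
    · exact h2

open Classical in
/-- The chosen word among `u` and its inverse. -/
noncomputable def rep (u : List C) : List C := if Pos u then u else lbar u

lemma rep_lbar (u : List C) : rep (lbar u) = rep u := by
  by_cases h : lbar u = u
  · rw [h]
  · by_cases h' : Pos u <;> simp [rep, pos_lbar h, h']

lemma rep_of_pos {u : List C} (h : Pos u) : rep u = u := if_pos h

lemma length_rep (u : List C) : (rep u).length = u.length := by
  rw [rep]; split_ifs <;> simp

/-- The value represented by the value of the letters naming `v`. -/
noncomputable def full (H : List C → List C) (v : List C) : List C :=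
  open Classical in if lbar v = v then H v ++ lbar (H v) else H v

end Orient

section Naming

variable {A : Type} [Invol A] {M : ℕ} (nm : List (Ext A M) → Fin M) (P : Set (List (Ext A M)))

open Classical in
/-- The letters naming a chain. -/
noncomputable def kap (u : List (Ext A M)) : List (Ext A M) :=
  if rep u ∈ P then
    if lbar u = u then [.inr (nm (rep u), true), .inr (nm (rep u), false)]
    else if Pos u then [.inr (nm (rep u), true)] else [.inr (nm (rep u), false)]
  else u

lemma kap_lbar (u : List (Ext A M)) : kap nm P (lbar u) = lbar (kap nm P u) := by
  simp only [kap, rep_lbar, lbar_lbar]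
  by_cases h : lbar u = u
  · split_ifs <;> simp_all [bar]
  · have h' := Ne.symm h
    by_cases hp : Pos u <;> by_cases hr : rep u ∈ P <;> simp [pos_lbar h, h, h', hp, hr, bar, rep_lbar]

lemma length_kap_le {u : List (Ext A M)} (h : rep u ∈ P) :
    (kap nm P u).length ≤ 2 ∧ (lbar u ≠ u → (kap nm P u).length ≤ 1) := by
  rw [kap, if_pos h]
  split_ifs <;> simp_all

open Classical in
/-- The substitution replacing names by values. -/
noncomputable def hom (H : List (Ext A M) → List (Ext A M)) : Ext A M → List (Ext A M)
  | .inl a => [.inl a]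
  | .inr (j, b) => if h : ∃ v ∈ P, nm v = j then
      (if b then H h.choose else lbar (H h.choose)) else [.inr (j, b)]

lemma hom_invHom (H : List (Ext A M) → List (Ext A M)) : InvHom (hom nm P H) := by
  rintro (a | ⟨j, b⟩)
  · rfl
  · by_cases h : ∃ v ∈ P, nm v = j
    · cases b <;> simp [bar, hom, h]
    · cases b <;> simp [bar, hom, h]

/-- Letters which are not names. -/
def Plain (c : Ext A M) : Prop := ∀ j b, c = .inr (j, b) → ∀ v ∈ P, nm v ≠ j

variable {nm P}

lemma plain_bar {c : Ext A M} : Plain nm P (bar c) ↔ Plain nm P c := by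
  rcases c with a | ⟨j, b⟩
  · simp [Plain, bar]
  · constructor
    · rintro h j b e v hv rfl
      cases e
      exact h _ _ rfl v hv rfl
    · rintro h j b e v hv rfl
      cases e
      exact h _ _ rfl v hv rfl

lemma hom_plain (H : List (Ext A M) → List (Ext A M)) {c : Ext A M} (h : Plain nm P c) :
    hom nm P H c = [c] := by
  rcases c with a | ⟨j, b⟩
  · rfl
  · have : ¬ ∃ v ∈ P, nm v = j := by rintro ⟨v, hv, e⟩; exact h j b rfl v hv e
    rw [hom, dif_neg this]

lemma hom_flatMap_plain (H : List (Ext A M) → List (Ext A M)) {w : List (Ext A M)}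
    (h : ∀ c ∈ w, Plain nm P c) : w.flatMap (hom nm P H) = w := by
  rw [flatMap_congr_mem (g := fun c => [c]) fun c hc => hom_plain H (h c hc), flatMap_pure']

lemma hom_nm (hinj : Set.InjOn nm P) (H : List (Ext A M) → List (Ext A M)) {v : List (Ext A M)} (hv : v ∈ P) (b : Bool) :
    hom nm P H (.inr (nm v, b)) = if b then H v else lbar (H v) := by
  have h : ∃ v' ∈ P, nm v' = nm v := ⟨v, hv, rfl⟩
  have : h.choose = v := hinj h.choose_spec.1 hv h.choose_spec.2
  rw [hom, dif_pos h, this]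

lemma kap_hom (hinj : Set.InjOn nm P) (H : List (Ext A M) → List (Ext A M)) {u : List (Ext A M)} (hu : rep u ∈ P) :
    (kap nm P u).flatMap (hom nm P H) =
      open Classical in if Pos u then full H u else lbar (full H (lbar u)) := by
  classical
  by_cases h : lbar u = u
  · have hp : Pos u := .inl h
    rw [rep_of_pos hp] at hu
    simp [kap, hu, h, hp, full, hom_nm hinj H hu, rep_of_pos hp]
  · have h' := Ne.symm h
    by_cases hp : Pos u
    · rw [rep_of_pos hp] at hu
      simp [kap, hu, h, hp, full, hom_nm hinj H hu, rep_of_pos hp]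
    · have : rep u = lbar u := if_neg hp
      rw [this] at hu
      simp [kap, hu, h, h', hp, full, hom_nm hinj H hu, this]

lemma kap_hom_eq (hinj : Set.InjOn nm P) {H : List (Ext A M) → List (Ext A M)} (hH : ∀ v ∈ P, full H v = v)
    {u : List (Ext A M)} (hu : ∀ c ∈ u, Plain nm P c) :
    (kap nm P u).flatMap (hom nm P H) = u := by
  by_cases hr : rep u ∈ P
  · rw [kap_hom hinj H hr]
    split_ifs with hp
    · exact hH u (by rwa [rep_of_pos hp] at hr)
    · have : rep u = lbar u := if_neg hp
      rw [hH _ (by rwa [this] at hr), lbar_lbar]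
  · rw [kap, if_neg hr, hom_flatMap_plain H hu]

lemma hom_comp (hinj : Set.InjOn nm P) {H H' H'' : List (Ext A M) → List (Ext A M)}
    (h : ∀ v ∈ P, (H' v).flatMap (hom nm P H) = H'' v) (c : Ext A M) :
    (hom nm P H' c).flatMap (hom nm P H) = hom nm P H'' c := by
  by_cases hc : Plain nm P c
  · rw [hom_plain _ hc, hom_plain _ hc]; simp [hom_plain _ hc]
  · simp only [Plain, not_forall, not_not] at hc
    obtain ⟨j, b, rfl, v, hv, rfl⟩ := hc
    rw [hom_nm hinj _ hv, hom_nm hinj _ hv]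
    cases b
    · simp [← (hom_invHom nm P H).lbar_flatMap, h v hv]
    · simp [h v hv]

end Naming

section Shrink

variable {A X K : Type} [Invol A] [Fintype K] {M : ℕ} (J : Ext A M → Ext A M → Bool)
  (s : X → List (Ext A M)) (W : WSys (Ext A M) X K)

/-- The words of the visible chain groups. -/
def chainWords : Set (List (Ext A M)) :=
  {u | ∃ k, ∃ G ∈ grp J s (W k), (∀ a ∈ G, isOld a = false) ∧ gword J s G = u}

lemma length_splitBy_le {α : Type} (r : α → α → Bool) (l : List α) :
    (l.splitBy r).length ≤ l.length := by
  have h := List.flatten_splitBy r l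
  have hn := List.nil_notMem_splitBy r l
  have key : ∀ L : List (List α), [] ∉ L → L.length ≤ L.flatten.length := by
    intro L
    induction L with
    | nil => simp
    | cons u L ih =>
      intro hn
      have h1 : u ≠ [] := fun e => hn (by simp [e])
      have h2 := List.length_pos_of_ne_nil h1
      have := ih fun e => hn (by simp [e])
      simp only [List.length_cons, List.flatten_cons, List.length_append]; omega
  calc _ ≤ _ := key _ hn
    _ = _ := by rw [h]

lemma exists_chainWords_cover : ∃ F : Finset (List (Ext A M)), chainWords J s W ⊆ F ∧
    F.card ≤ wsize W + 2 * vcount W := by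
  classical
  refine ⟨Finset.univ.biUnion fun k => ((grp J s (W k)).map (gword J s)).toFinset, ?_, ?_⟩
  · rintro u ⟨k, G, hG, -, rfl⟩
    simp only [Finset.coe_biUnion, Set.mem_iUnion, Finset.mem_coe, List.mem_toFinset]
    exact ⟨k, Finset.mem_univ _, List.mem_map_of_mem hG⟩
  · refine Finset.card_biUnion_le.trans ?_
    rw [wsize, vcount, Finset.mul_sum, ← Finset.sum_add_distrib]
    refine Finset.sum_le_sum fun k _ => (List.toFinset_card_le _).trans ?_
    rw [List.length_map]
    exact (length_splitBy_le _ _).trans (length_flatMap_unc J s (W k))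

lemma exists_visible_cover : ∃ F : Finset (Fin M),
    (∀ k j b, Sym.c (Sum.inr (j, b)) ∈ W k → j ∈ F) ∧ F.card ≤ wsize W := by
  classical
  let g : Sym (Ext A M) X → Option (Fin M) := fun a => match a with
    | .c (.inr (j, _)) => some j
    | _ => none
  refine ⟨Finset.univ.biUnion fun k => ((W k).filterMap g).toFinset, ?_, ?_⟩
  · intro k j b h
    simp only [Finset.mem_biUnion, Finset.mem_univ, true_and, List.mem_toFinset,
      List.mem_filterMap]
    exact ⟨k, _, h, rfl⟩
  · refine Finset.card_biUnion_le.trans (Finset.sum_le_sum fun k _ => ?_)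
    exact (List.toFinset_card_le _).trans (List.length_filterMap_le _ _)

lemma exists_naming (hM : 2 * wsize W + 2 * vcount W < M) :
    ∃ nm : List (Ext A M) → Fin M, Set.InjOn nm (rep '' chainWords J s W) ∧
      ∀ v ∈ rep '' chainWords J s W, ∀ k b, Sym.c (Sum.inr (nm v, b)) ∉ W k := by
  classical
  obtain ⟨F, hF, hFc⟩ := exists_chainWords_cover J s W
  obtain ⟨E, hE, hEc⟩ := exists_visible_cover W
  have hc : (F.image rep).card ≤ Eᶜ.card := by
    have := Finset.card_image_le (s := F) (f := rep)
    rw [Finset.card_compl, Fintype.card_fin]; omega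
  obtain ⟨f⟩ : Nonempty ((F.image rep) ↪ (Eᶜ : Finset (Fin M))) :=
    Function.Embedding.nonempty_of_card_le (by
      rw [Fintype.card_coe, Fintype.card_coe]; exact hc)
  have hsub : ∀ v ∈ rep '' chainWords J s W, v ∈ F.image rep := by
    rintro v ⟨u, hu, rfl⟩
    exact Finset.mem_image_of_mem _ (hF hu)
  refine ⟨fun v => if h : v ∈ F.image rep then (f ⟨v, h⟩).1 else ⟨0, by omega⟩, ?_, ?_⟩
  · intro u hu v hv h
    simp only [dif_pos (hsub u hu), dif_pos (hsub v hv)] at h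
    have := f.injective (Subtype.ext h)
    simpa using this
  · intro v hv k b h
    simp only [dif_pos (hsub v hv)] at h
    exact Finset.mem_compl.1 (f ⟨v, hsub v hv⟩).2 (hE k _ b h)

variable {J s W}

lemma plain_of_clean {nm : List (Ext A M) → Fin M} {P : Set (List (Ext A M))}
    (hav : ∀ v ∈ P, ∀ k b, Sym.c (Sum.inr (nm v, b)) ∉ W k) (hcl : Clean s W) :
    (∀ x, ∀ c ∈ s x, Plain nm P c) ∧ ∀ k, ∀ c ∈ (W k).flatMap (asg s), Plain nm P c := by
  have h1 : ∀ x, ∀ c ∈ s x, Plain nm P c := by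
    rintro x c hc j b rfl v hv rfl
    obtain ⟨k, b', h⟩ := hcl x _ b hc
    exact hav v hv k b' h
  refine ⟨h1, fun k c hc => ?_⟩
  obtain ⟨a, ha, hc⟩ := List.mem_flatMap.1 hc
  rcases a with a | ⟨x, _ | _⟩
  · rw [asg_c, List.mem_singleton] at hc
    subst hc
    rintro j b rfl v hv rfl
    exact hav v hv k b ha
  · rw [asg_false, mem_lbar] at hc
    exact plain_bar.1 (h1 x _ hc)
  · exact h1 x c hc

lemma shrinks_of_values {B : ℕ} (hJ : ∀ a b, J a b = J (bar b) (bar a)) (hs : Solves s W)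
    (hcl : Clean s W) {nm : List (Ext A M) → Fin M}
    (hinj : Set.InjOn nm (rep '' chainWords J s W))
    (hav : ∀ v ∈ rep '' chainWords J s W, ∀ k b, Sym.c (Sum.inr (nm v, b)) ∉ W k)
    {H : List (Ext A M) → List (Ext A M)} (hH : ∀ v ∈ rep '' chainWords J s W, full H v = v)
    {i : Lab (Ext A M) B} {V : Set (Lab (Ext A M) B)} {φs : List (Lab (Ext A M) B)}
    (hφ : ∀ φ ∈ φs, φ ∈ V)
    (hsub : ∀ c, foldSub (i.sub :: φs.map Lab.sub) [c] = hom nm (rep '' chainWords J s W) H c)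
    (harc : ∀ φs : List (Lab (Ext A M) B), (∀ φ ∈ φs, φ ∈ V) →
      Arc W (fun c => foldSub (i.sub :: φs.map Lab.sub) [c])
        (compSys J s (kap nm (rep '' chainWords J s W)) W))
    (hsz : wsize (compSys J s (kap nm (rep '' chainWords J s W)) W) < wsize W) :
    Shrinks B s W := by
  set P := rep '' chainWords J s W with hP
  have hpl := plain_of_clean hav hcl
  have hcomp : ∀ w : List (Ext A M), (∀ c ∈ w, Plain nm P c) →
      (comp J (kap nm P) w).flatMap (hom nm P H) = w := by
    intro w hw
    rw [comp, List.flatMap_assoc]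
    conv_rhs => rw [← List.flatten_splitBy J w]
    rw [flatMap_congr_mem (g := _root_.id), List.flatMap_id]
    intro u hu
    refine kap_hom_eq hinj hH fun c hc => hw c ?_
    rw [← List.flatten_splitBy J w]
    exact List.mem_flatten.2 ⟨u, hu, hc⟩
  refine ⟨compSys J s (kap nm P) W, compVal J s (kap nm P), i, V, φs, hφ, harc,
    solves_compSys J s _ hJ (kap_lbar nm P) hs, ?_, ?_, ?_, ?_, vcount_compSys J s _ W, hsz⟩
  · intro k
    simp only [hsub]
    rw [compSys_asg J s _ hJ (kap_lbar nm P), hcomp _ (hpl.2 k)]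
  · intro a; rw [hsub]; rfl
  · intro c
    rw [hsub]
    by_cases hc : Plain nm P c
    · simp [hom_plain _ hc]
    · simp only [Plain, not_forall, not_not] at hc
      obtain ⟨j, b, rfl, v, hv, rfl⟩ := hc
      have hne : H v ≠ [] := by
        intro h0
        have h1 := hH v hv
        have h2 : full H v = [] := by rw [full]; split_ifs <;> simp [h0]
        obtain ⟨u, ⟨k, G, hG, -, rfl⟩, rfl⟩ := hv
        have h3 := (grp_spec J s hJ hG).1
        have h4 := length_rep (gword J s G)
        rw [← h1, h2] at h4
        exact h3 (List.eq_nil_of_length_eq_zero h4.symm)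
      rw [hom_nm hinj H hv]
      cases b <;> simp [hne]
  · intro x
    simp only [hsub]
    refine compVal_isInfix J s _ (hcomp _ fun c hc => hpl.1 x c (mem_uncVal J s hc))

end Shrink

/-! ### Counting adjacent pairs -/

section Count

variable {α : Type} (r : α → α → Bool)

/-- The number of adjacent related pairs. -/
def pcount : List α → ℕ
  | a :: b :: l => (if r a b then 1 else 0) + pcount (b :: l)
  | _ => 0

/-- The number of consecutive triples both of whose pairs are related. -/
def tcount : List α → ℕ
  | a :: b :: c :: l => (if r a b && r b c then 1 else 0) + tcount (b :: c :: l)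
  | _ => 0

variable {r}

lemma pcount_append_le {u v : List α} (h : ∀ a ∈ u.getLast?, ∀ b ∈ v.head?, r a b = false) :
    pcount r (u ++ v) ≤ (u.length - 1) + pcount r v := by
  induction u with
  | nil => simp
  | cons a u ih =>
    rcases u with _ | ⟨b, u⟩
    · rcases v with _ | ⟨c, v⟩
      · simp [pcount]
      · have := h a (by simp) c (by simp)
        simp [pcount, this]
    · have := ih (by simpa using h)
      simp only [List.cons_append, pcount, List.length_cons] at this ⊢
      split_ifs <;> omega

lemma tcount_append_le {u v : List α} (h : ∀ a ∈ u.getLast?, ∀ b ∈ v.head?, r a b = false) :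
    tcount r (u ++ v) ≤ (u.length - 2) + tcount r v := by
  induction u with
  | nil => simp
  | cons a u ih =>
    rcases u with _ | ⟨b, _ | ⟨c, u⟩⟩
    · rcases v with _ | ⟨c, _ | ⟨d, v⟩⟩
      · simp [tcount]
      · simp [tcount]
      · have := h a (by simp) c (by simp)
        simp [tcount, this]
    · have ih := ih (by simpa using h)
      rcases v with _ | ⟨c, v⟩
      · simp [tcount]
      · have := h b (by simp) c (by simp)
        simp only [List.cons_append, List.nil_append, tcount, this, Bool.and_false,
          List.length_cons, List.length_nil] at ih ⊢
        simpa using ih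
    · have := ih (by simpa using h)
      simp only [List.cons_append, tcount, List.length_cons] at this ⊢
      split_ifs <;> omega

lemma pcount_le_cons (a : α) (l : List α) : pcount r l ≤ pcount r (a :: l) := by
  rcases l with _ | ⟨b, l⟩ <;> simp [pcount]

lemma tcount_le_cons (a : α) (l : List α) : tcount r l ≤ tcount r (a :: l) := by
  rcases l with _ | ⟨b, _ | ⟨c, l⟩⟩ <;> simp [tcount]

lemma pcount_le_append (u l : List α) : pcount r l ≤ pcount r (u ++ l) := by
  induction u with
  | nil => rfl
  | cons a u ih => exact ih.trans (pcount_le_cons _ _)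

lemma tcount_le_append (u l : List α) : tcount r l ≤ tcount r (u ++ l) := by
  induction u with
  | nil => rfl
  | cons a u ih => exact ih.trans (tcount_le_cons _ _)

lemma boundary_splitBy (l : List α) : (l.splitBy r).IsChain fun u v =>
    ∀ a ∈ u.getLast?, ∀ b ∈ v.head?, r a b = false := by
  refine (List.isChain_getLast_head_splitBy r l).imp ?_
  rintro u v ⟨hu, hv, h⟩
  rw [List.getLast?_eq_getLast_of_ne_nil hu, List.head?_eq_some_head hv]
  simpa using h

lemma head?_flatten_of_ne {L : List (List α)} (hn : [] ∉ L) :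
    L.flatten.head? = L.head?.bind List.head? := by
  rcases L with _ | ⟨u, L⟩
  · rfl
  · rw [head?_flatten_cons fun h => hn (by simp [h])]; rfl

lemma length_add_pcount {L : List (List α)} (hn : [] ∉ L)
    (hb : L.IsChain fun u v => ∀ a ∈ u.getLast?, ∀ b ∈ v.head?, r a b = false) :
    L.length + pcount r L.flatten ≤ L.flatten.length := by
  induction L with
  | nil => simp [pcount]
  | cons u L ih =>
    rw [List.mem_cons, not_or] at hn
    have hu := List.length_pos_of_ne_nil (Ne.symm hn.1)
    have h1 : pcount r (u ++ L.flatten) ≤ _ := pcount_append_le (by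
      rw [head?_flatten_of_ne hn.2]
      rcases L with _ | ⟨v, L⟩
      · simp
      · exact (List.isChain_cons_cons.1 hb).1)
    have := ih hn.2 hb.tail
    simp only [List.length_cons, List.flatten_cons, List.length_append]
    omega

lemma sum_add_tcount {L : List (List α)} (hn : [] ∉ L)
    (hb : L.IsChain fun u v => ∀ a ∈ u.getLast?, ∀ b ∈ v.head?, r a b = false) :
    (L.map fun G => min G.length 2).sum + tcount r L.flatten ≤ L.flatten.length := by
  induction L with
  | nil => simp [tcount]
  | cons u L ih =>
    rw [List.mem_cons, not_or] at hn
    have h1 : tcount r (u ++ L.flatten) ≤ _ := tcount_append_le (by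
      rw [head?_flatten_of_ne hn.2]
      rcases L with _ | ⟨v, L⟩
      · simp
      · exact (List.isChain_cons_cons.1 hb).1)
    have := ih hn.2 hb.tail
    simp only [List.map_cons, List.sum_cons, List.flatten_cons, List.length_append]
    omega

lemma length_splitBy_add_pcount (l : List α) :
    (l.splitBy r).length + pcount r l ≤ l.length := by
  have := length_add_pcount (List.nil_notMem_splitBy r l) (boundary_splitBy l)
  rwa [List.flatten_splitBy] at this

lemma sum_splitBy_add_tcount (l : List α) :
    ((l.splitBy r).map fun G => min G.length 2).sum + tcount r l ≤ l.length := by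
  have := sum_add_tcount (List.nil_notMem_splitBy r l) (boundary_splitBy l)
  rwa [List.flatten_splitBy] at this

end Count

section CountSym

variable {C X K : Type}

/-- The relation on symbols induced on constants. -/
def cc (J : C → C → Bool) : Sym C X → Sym C X → Bool
  | .c a, .c b => J a b
  | _, _ => false

variable [Invol C] (J : C → C → Bool) (s : X → List C)

lemma grel_c (a b : C) : grel J s (.c a) (.c b) = J a b := by
  simp [grel, isOld, JL]

lemma pcount_unc (w : List (Sym C X)) :
    pcount (cc J) w ≤ pcount (grel J s) (w.flatMap (unc J s)) := by
  induction w with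
  | nil => rfl
  | cons a w ih =>
    rcases w with _ | ⟨b, w⟩
    · simp [pcount]
    · rcases a with a | a
      · rcases b with b | b
        · simp only [List.flatMap_cons, unc, vsub, List.singleton_append, pcount, cc, grel_c] at ih ⊢
          exact Nat.add_le_add_left ih _
        · simp only [pcount, cc]
          rw [List.flatMap_cons]
          simpa using ih.trans (pcount_le_append _ _)
      · simp only [pcount, cc]
        rw [List.flatMap_cons]
        simpa using ih.trans (pcount_le_append _ _)

lemma tcount_unc (w : List (Sym C X)) :
    tcount (cc J) w ≤ tcount (grel J s) (w.flatMap (unc J s)) := by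
  induction w with
  | nil => rfl
  | cons a w ih =>
    rcases w with _ | ⟨b, _ | ⟨c, w⟩⟩
    · simp [tcount]
    · simp [tcount]
    · by_cases h : (cc J a b && cc J b c) = true
      · rcases a with a | a <;> rcases b with b | b <;> rcases c with c | c <;> simp [cc] at h
        simp only [List.flatMap_cons, unc, vsub, List.singleton_append, tcount, cc, grel_c] at ih ⊢
        exact Nat.add_le_add_left ih _
      · rw [tcount, if_neg h, zero_add, List.flatMap_cons]
        exact ih.trans (tcount_le_append _ _)

/-! ### Size estimates -/

variable (κ : List C → List C)

lemma length_khat_le {w : List (Sym C X)} {G : List (Sym C (UVar X))}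
    (hJ : ∀ a b, J a b = J (bar b) (bar a)) (hG : G ∈ grp J s w) {n : ℕ} (hn : 1 ≤ n)
    (hκ : (∀ a ∈ G, isOld a = false) → (κ (gword J s G)).length ≤ n) :
    (khat J s κ G).length ≤ n := by
  obtain ⟨hne, ⟨x, b, rfl⟩ | ⟨hno, hc⟩⟩ := grp_spec J s hJ hG
  · simpa [khat, isOld, normSym] using hn
  · have : G.any isOld = false := by simpa using hno
    rw [khat, if_neg (by simp [this]), List.length_map]
    exact hκ hno

lemma length_flatMap_le_sum {α β : Type} {L : List α} {f : α → List β} {n : α → ℕ}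
    (h : ∀ a ∈ L, (f a).length ≤ n a) : (L.flatMap f).length ≤ (L.map n).sum := by
  induction L with
  | nil => simp
  | cons a L ih =>
    have := h a (by simp)
    have := ih fun b hb => h b (by simp [hb])
    simp only [List.flatMap_cons, List.length_append, List.map_cons, List.sum_cons]; omega

lemma wsize_compSys_pcount [Fintype K] (hJ : ∀ a b, J a b = J (bar b) (bar a)) (W : WSys C X K)
    (hκ : ∀ k, ∀ G ∈ grp J s (W k), (∀ a ∈ G, isOld a = false) → (κ (gword J s G)).length ≤ 1) :
    wsize (compSys J s κ W) + ∑ k, pcount (cc J) (W k) ≤ wsize W + 2 * vcount W := by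
  rw [wsize, wsize, vcount, Finset.mul_sum, ← Finset.sum_add_distrib, ← Finset.sum_add_distrib]
  refine Finset.sum_le_sum fun k _ => ?_
  have h1 := length_splitBy_add_pcount (r := grel J s) ((W k).flatMap (unc J s))
  have h2 := pcount_unc J s (W k)
  have h3 := length_flatMap_unc J s (W k)
  have h4 : (compSys J s κ W k).length ≤ ((grp J s (W k)).map fun _ => 1).sum :=
    length_flatMap_le_sum fun G hG => length_khat_le J s κ hJ hG le_rfl (hκ k G hG)
  rw [List.map_const', List.sum_replicate, smul_eq_mul, mul_one] at h4
  rw [grp] at h4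
  omega

lemma countP_isVar_unc (w : List (Sym C X)) :
    (w.flatMap (unc J s)).countP Sym.isVar ≤ 3 * w.countP Sym.isVar := by
  induction w with
  | nil => simp
  | cons a w ih =>
    have : (unc J s a).countP Sym.isVar ≤ 3 * if a.isVar then 1 else 0 := by
      rcases a with a | a
      · simp [unc, vsub, Sym.isVar]
      · refine List.countP_le_length.trans ((length_unc J s _).trans ?_)
        simp [Sym.isVar]
    rw [List.flatMap_cons, List.countP_append, List.countP_cons]; omega

lemma wsize_compSys_tcount [Fintype K] (hJ : ∀ a b, J a b = J (bar b) (bar a)) (W : WSys C X K)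
    (hκ : ∀ k, ∀ G ∈ grp J s (W k), (∀ a ∈ G, isOld a = false) →
      (κ (gword J s G)).length ≤ min G.length 2 + G.countP Sym.isVar) :
    wsize (compSys J s κ W) + ∑ k, tcount (cc J) (W k) ≤ wsize W + 5 * vcount W := by
  rw [wsize, wsize, vcount, Finset.mul_sum, ← Finset.sum_add_distrib, ← Finset.sum_add_distrib]
  refine Finset.sum_le_sum fun k _ => ?_
  have h1 := sum_splitBy_add_tcount (r := grel J s) ((W k).flatMap (unc J s))
  have h2 := tcount_unc J s (W k)
  have h3 := length_flatMap_unc J s (W k)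
  have h4 : (compSys J s κ W k).length ≤
      ((grp J s (W k)).map fun G => min G.length 2 + G.countP Sym.isVar).sum :=
    length_flatMap_le_sum fun G hG => by
      have hne : G ≠ [] := List.ne_nil_of_mem_splitBy hG
      have := List.length_pos_of_ne_nil hne
      exact length_khat_le J s κ hJ hG (by omega) (hκ k G hG)
  have h5 := countP_isVar_unc J s (W k)
  have h6 : ((grp J s (W k)).map (List.countP Sym.isVar)).sum =
      ((W k).flatMap (unc J s)).countP Sym.isVar := by
    conv_rhs => rw [← List.flatten_splitBy (grel J s) ((W k).flatMap (unc J s)),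
      List.countP_flatten]
    rfl
  rw [List.sum_map_add, h6] at h4
  rw [grp] at h4
  omega

/-! ### The basic inequality -/

open Classical in
/-- Relation of a letter to its image under `f`. -/
noncomputable def relOf (f : C → C) (a b : C) : Bool := decide (b = f a)

open Classical in
/-- Pairs of letters which are neither equal nor mutually inverse. -/
noncomputable def relGood (a b : C) : Bool := decide (b ≠ a ∧ b ≠ bar a)

lemma length_le_counts (w : List (Sym C X)) :
    w.length ≤ 4 * w.countP Sym.isVar + 2 + 2 * pcount (cc (relOf _root_.id)) w +
      2 * pcount (cc relGood) w + tcount (cc (relOf bar)) w := by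
  let n (r : C → C → Bool) (a b : Sym C X) : ℕ := if cc r a b = true then 1 else 0
  let v (a : Sym C X) : ℕ := if a.isVar = true then 1 else 0
  have tri : ∀ a b : Sym C X, v a + v b ≤ 2 ∧
      (v a + v b = 0 → n (relOf _root_.id) a b + n (relOf bar) a b + n relGood a b = 1) ∧
      (v a + v b ≠ 0 → n (relOf _root_.id) a b + n (relOf bar) a b + n relGood a b = 0) := by
    rintro (a | ⟨x, t⟩) (b | ⟨y, t'⟩)
    · refine ⟨by simp [v, Sym.isVar], fun _ => ?_, by simp [v, Sym.isVar]⟩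
      by_cases h1 : b = a
      · simp [n, cc, relOf, relGood, h1, Ne.symm (bar_ne a)]
      · by_cases h2 : b = bar a
        · simp [n, cc, relOf, relGood, h2]
        · simp [n, cc, relOf, relGood, h1, h2]
    all_goals simp [v, n, cc, Sym.isVar]
  have hp : ∀ r (a b : Sym C X) w, pcount (cc r) (a :: b :: w) = n r a b + pcount (cc r) (b :: w) :=
    fun _ _ _ _ => rfl
  have hv : ∀ (a : Sym C X) w, (a :: w).countP Sym.isVar = w.countP Sym.isVar + v a :=
    fun _ _ => List.countP_cons
  have key1 : ∀ (w : List (Sym C X)) a,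
      (a :: w).length + v a ≤ 1 + 2 * (a :: w).countP Sym.isVar +
        pcount (cc (relOf _root_.id)) (a :: w) + pcount (cc relGood) (a :: w) +
        pcount (cc (relOf bar)) (a :: w) := by
    intro w
    induction w with
    | nil => intro a; simp [pcount, hv]; omega
    | cons b w ih =>
      intro a
      have h1 := tri a b
      have h2 := ih b
      rw [hp, hp, hp, hv, List.length_cons]; omega
  have key2 : ∀ (w : List (Sym C X)) a b,
      pcount (cc (relOf bar)) (a :: b :: w) + 1 ≤ tcount (cc (relOf bar)) (a :: b :: w) +
        pcount (cc (relOf _root_.id)) (a :: b :: w) + pcount (cc relGood) (a :: b :: w) +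
        2 * (a :: b :: w).countP Sym.isVar + 1 + n (relOf bar) a b := by
    intro w
    induction w with
    | nil => intro a b; rw [hp]; simp only [pcount]; omega
    | cons c w ih =>
      intro a b
      have h1 := tri a b
      have h2 := ih b c
      have h3 : tcount (cc (relOf bar)) (a :: b :: c :: w) =
        n (relOf bar) a b * n (relOf bar) b c + tcount (cc (relOf bar)) (b :: c :: w) := by
        rw [tcount]; congr 1; simp only [n]
        by_cases h : cc (relOf bar) a b = true <;> simp [h]
      have h4 := tri b c
      rw [h3, hp, hp _ a b, hp _ a b, hv a]
      have h5 : n (relOf bar) a b = 0 ∨ n (relOf bar) a b = 1 := by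
        simp only [n]; split_ifs <;> simp
      have h6 : n (relOf bar) b c = 0 ∨ n (relOf bar) b c = 1 := by
        simp only [n]; split_ifs <;> simp
      have h7 := hv b (c :: w)
      rcases h5 with h5 | h5 <;> rcases h6 with h6 | h6 <;> simp only [h5, h6] at h1 h2 h3 h4 ⊢ <;> omega
  rcases w with _ | ⟨a, _ | ⟨b, w⟩⟩
  · simp
  · simp only [List.length_singleton]; omega
  have h1 := key1 (b :: w) a
  have h2 := key2 w a b
  have h3 : n (relOf bar) a b ≤ 1 := by simp only [n]; split_ifs <;> simp
  omega

end CountSym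

/-! ### Orientations -/

section Orientation

variable {C : Type} [Invol C]

open Classical in
/-- A reference orientation. -/
noncomputable def sgn (c : C) : Bool := decide (WellOrderingRel c (bar c))

/-- The positively oriented letter among `c` and its inverse. -/
noncomputable def key (c : C) : C := if sgn c then c else bar c

lemma sgn_bar (c : C) : sgn (bar c) = !sgn c := by
  rcases trichotomous_of WellOrderingRel c (bar c) with h | h | h
  · have := asymm_of WellOrderingRel h
    simp [sgn, h, this]
  · exact absurd h.symm (bar_ne c)
  · have := asymm_of WellOrderingRel h
    simp [sgn, h, this]

lemma key_bar (c : C) : key (bar c) = key c := by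
  rw [key, key, sgn_bar]
  cases sgn c <;> simp

lemma eq_or_eq_bar_of_key {a b : C} (h : key b = key a) : b = a ∨ b = bar a := by
  have hi := Function.Involutive.injective (f := (bar : C → C)) bar_bar
  simp only [key] at h
  split_ifs at h
  · exact .inl h
  · exact .inr h
  · right; rw [← h, bar_bar]
  · exact .inl (hi h)

/-- The orientation obtained from the reference one by reversing the letters marked by `o`. -/
noncomputable def orient (o : C → Bool) (c : C) : Bool := xor (sgn c) (o (key c))

lemma orient_bar (o : C → Bool) (c : C) : orient o (bar c) = !orient o c := by
  rw [orient, orient, sgn_bar, key_bar]; simp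

open Classical in
lemma sum_orient_flip [Fintype C] (g : (C → Bool) → ℕ) (k : C) :
    ∑ o, g (Function.update o k (!o k)) = ∑ o, g o := by
  have hinv : Function.Involutive fun o : C → Bool => Function.update o k (!o k) := by
    intro o; simp
  exact Equiv.sum_comp hinv.toPerm g

open Classical in
lemma orient_update (o : C → Bool) (c k : C) :
    orient (Function.update o k (!o k)) c = if key c = k then !orient o c else orient o c := by
  by_cases h : key c = k <;> simp [orient, h]

open Classical in
/-- Pairs of a positive and a negative letter which are not mutually inverse. -/
noncomputable def relLR (ε : C → Bool) (a b : C) : Bool := ε a && !ε b && decide (b ≠ bar a)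

lemma relLR_bar {ε : C → Bool} (hε : ∀ c, ε (bar c) = !ε c) (a b : C) :
    relLR ε a b = relLR ε (bar b) (bar a) := by
  simp only [relLR, hε, bar_bar, Bool.not_not, Bool.and_comm (!ε b)]
  congr 1
  simp [eq_comm]

open Classical in
lemma sum_relLR [Fintype C] {a b : C} (h : relGood a b = true) :
    Fintype.card (C → Bool) ≤ 4 * ∑ o : C → Bool, if relLR (orient o) a b = true then 1 else 0 := by
  obtain ⟨h1, h2⟩ : b ≠ a ∧ b ≠ bar a := by simpa [relGood] using h
  have hk : key b ≠ key a := fun e => (eq_or_eq_bar_of_key e).elim h1 h2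
  let g : Bool → Bool → ℕ := fun p q => if p && !q then 1 else 0
  have e0 : (∑ o : C → Bool, if relLR (orient o) a b = true then 1 else 0) =
      ∑ o : C → Bool, g (orient o a) (orient o b) := by
    refine Finset.sum_congr rfl fun o _ => ?_
    simp [g, relLR, h2]
  have ea : ∀ g' : Bool → Bool → ℕ, ∑ o : C → Bool, g' (!orient o a) (orient o b) =
      ∑ o : C → Bool, g' (orient o a) (orient o b) := by
    intro g'
    rw [← sum_orient_flip _ (key a)]
    simp [orient_update, hk]
  have eb : ∀ g' : Bool → Bool → ℕ, ∑ o : C → Bool, g' (orient o a) (!orient o b) =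
      ∑ o : C → Bool, g' (orient o a) (orient o b) := by
    intro g'
    rw [← sum_orient_flip _ (key b)]
    simp [orient_update, hk.symm]
  have h3 : Fintype.card (C → Bool) = ∑ o : C → Bool, (g (orient o a) (orient o b) +
      g (!orient o a) (orient o b) + (g (orient o a) (!orient o b) +
      g (!orient o a) (!orient o b))) := by
    rw [Fintype.card, Finset.card_eq_sum_ones]
    refine Finset.sum_congr rfl fun o _ => ?_
    cases orient o a <;> cases orient o b <;> rfl
  rw [h3, Finset.sum_add_distrib, Finset.sum_add_distrib, Finset.sum_add_distrib, ea g,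
    ea fun p q => g p (!q), eb g, e0]
  omega

open Classical in
lemma sum_pcount_relLR [Fintype C] {X : Type} (w : List (Sym C X)) :
    Fintype.card (C → Bool) * pcount (cc relGood) w ≤
      4 * ∑ o : C → Bool, pcount (cc (relLR (orient o))) w := by
  induction w with
  | nil => simp [pcount]
  | cons a w ih =>
    rcases w with _ | ⟨b, w⟩
    · simp [pcount]
    · simp only [pcount, Finset.sum_add_distrib, mul_add]
      refine Nat.add_le_add ?_ ih
      split_ifs with h
      · rcases a with a | a <;> rcases b with b | b <;> simp [cc] at h
        rw [mul_one]
        exact sum_relLR h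
      · simp

lemma exists_orientation [Finite C] {X K : Type} [Fintype K] (W : WSys C X K) :
    ∃ ε : C → Bool, (∀ c, ε (bar c) = !ε c) ∧
      ∑ k, pcount (cc relGood) (W k) ≤ 4 * ∑ k, pcount (cc (relLR ε)) (W k) := by
  classical
  have := Fintype.ofFinite C
  obtain ⟨o, -, ho⟩ := Finset.exists_le_of_sum_le (s := (Finset.univ : Finset (C → Bool)))
    (f := fun _ => ∑ k, pcount (cc relGood) (W k))
    (g := fun o => 4 * ∑ k, pcount (cc (relLR (orient o))) (W k)) Finset.univ_nonempty (by
      rw [Finset.sum_const, smul_eq_mul, ← Finset.mul_sum, Finset.sum_comm, Finset.mul_sum,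
        Finset.mul_sum]
      exact Finset.sum_le_sum fun k _ => sum_pcount_relLR (W k))
  exact ⟨orient o, orient_bar o, ho⟩

lemma relLR_chain {ε : C → Bool} {u : List C} (hne : u ≠ [])
    (h : u.IsChain fun a b => relLR ε a b = true) : u.length ≤ 2 ∧ lbar u ≠ u := by
  rcases u with _ | ⟨a, _ | ⟨b, _ | ⟨c, u⟩⟩⟩
  · exact absurd rfl hne
  · simp [bar_ne]
  · simp only [List.isChain_cons_cons, relLR, Bool.and_eq_true, decide_eq_true_eq] at h
    refine ⟨by simp, fun e => ?_⟩
    simp only [lbar, List.map_cons, List.map_nil, List.reverse_cons, List.reverse_nil,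
      List.nil_append, List.cons_append, List.cons.injEq, and_true] at e
    exact h.1.2 e.2.symm
  · simp only [List.isChain_cons_cons, relLR, Bool.and_eq_true, Bool.not_eq_true'] at h
    have h1 := h.1.1.2
    have h2 := h.2.1.1.1
    rw [h1] at h2
    exact absurd h2 (by simp)

end Orientation

/-! ### Compression of pairs -/

section Pairs

variable {A X K : Type} [Invol A] [Fintype K] {M B : ℕ} {W : WSys (Ext A M) X K}
  {s : X → List (Ext A M)}

lemma uncVal_inr_asg {C : Type} [Invol C] (J : C → C → Bool) (t : X → List C)
    {G : List (Sym C (UVar X))} (hno : ∀ a ∈ G, isOld a = false) :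
    G.flatMap (asg (Sum.elim (fun _ => []) fun y => uncVal J t (.inr y))) = gword J t G := by
  refine flatMap_congr_mem fun a ha => ?_
  have := hno a ha
  rcases a with a | ⟨x | y, _ | _⟩
  · rfl
  all_goals simp_all [isOld]

lemma mem_gword {C : Type} [Invol C] {J : C → C → Bool} {t : X → List C}
    (hJ : ∀ a b, J a b = J (bar b) (bar a)) {w : List (Sym C X)} {G : List (Sym C (UVar X))}
    (hG : G ∈ grp J t w) {c : C} (hc : c ∈ gword J t G) : c ∈ w.flatMap (asg t) := by
  rw [← List.flatten_splitBy J (gword J t G)] at hc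
  rw [← List.flatten_splitBy J (w.flatMap (asg t)), splitBy_grp J t hJ]
  obtain ⟨u, hu, hc⟩ := List.mem_flatten.1 hc
  exact List.mem_flatten.2 ⟨u, List.mem_flatMap.2 ⟨G, hG, hu⟩, hc⟩

lemma rep_mem_of_grp {J : Ext A M → Ext A M → Bool} {k : Option (K × Bool)}
    {G : List (Sym (Ext A M) (UVar X))} (hG : G ∈ grp J s (W k))
    (hno : ∀ a ∈ G, isOld a = false) :
    rep (gword J s G) ∈ rep '' chainWords J s W :=
  ⟨_, ⟨k, G, hG, hno, rfl⟩, rfl⟩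

lemma shrinks_of_relLR (hs : Solves s W) (hcl : Clean s W) (hB : 2 ≤ B)
    (hM : 2 * wsize W + 2 * vcount W < M) {ε : Ext A M → Bool} (hε : ∀ c, ε (bar c) = !ε c)
    (hW : 2 * vcount W < ∑ k, pcount (cc (relLR ε)) (W k)) : Shrinks B s W := by
  have hJ := relLR_bar hε
  obtain ⟨nm, hinj, hav⟩ := exists_naming (relLR ε) s W hM
  set P := rep '' chainWords (relLR ε) s W with hP
  have hlen : ∀ k, ∀ G ∈ grp (relLR ε) s (W k), (∀ a ∈ G, isOld a = false) →
      (gword (relLR ε) s G).length ≤ 2 ∧ lbar (gword (relLR ε) s G) ≠ gword (relLR ε) s G := by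
    intro k G hG hno
    obtain ⟨hne, ⟨x, b, rfl⟩ | ⟨-, hc⟩⟩ := grp_spec _ s hJ hG
    · simp [isOld] at hno
    · exact relLR_chain hne hc
  have hPv : ∀ v ∈ P, v.length ≤ 2 ∧ lbar v ≠ v := by
    rintro v ⟨u, ⟨k, G, hG, hno, rfl⟩, rfl⟩
    have h := hlen k G hG hno
    rw [length_rep]
    refine ⟨h.1, fun e => h.2 ?_⟩
    rw [rep] at e
    split_ifs at e
    · exact e
    · rw [lbar_lbar] at e; exact e.symm
  have hH : ∀ v ∈ P, full _root_.id v = v := fun v hv => by rw [full, if_neg (hPv v hv).2]; rfl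
  have hBl : ∀ c : Ext A M, (hom nm P _root_.id c).length ≤ B := by
    intro c
    by_cases hc : Plain nm P c
    · rw [hom_plain _ hc]; simp; omega
    · simp only [Plain, not_forall, not_not] at hc
      obtain ⟨j, b, rfl, v, hv, rfl⟩ := hc
      rw [hom_nm hinj _ hv]
      have := (hPv v hv).1
      cases b <;> simp <;> omega
  let i : Lab (Ext A M) B := fun c => ⟨hom nm P _root_.id c, hBl c⟩
  have hi : ∀ c, foldSub (i.sub :: ([] : List (Lab (Ext A M) B)).map Lab.sub) [c] =
      hom nm P _root_.id c := by
    intro c; simp [i, Lab.sub]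
  have hnil : ∀ φs : List (Lab (Ext A M) B), (∀ φ ∈ φs, φ ∈ (∅ : Set (Lab (Ext A M) B))) →
      φs = [] := fun φs h => List.eq_nil_iff_forall_not_mem.2 fun φ hφ => h φ hφ
  refine shrinks_of_values (i := i) (V := ∅) (φs := []) (H := _root_.id) (nm := nm)
    hJ hs hcl hinj hav hH (by simp) hi ?_ ?_
  · intro φs hφs
    rw [hnil φs hφs]
    simp only [hi]
    have hpl := plain_of_clean hav hcl
    refine arc_compSys _ s _ hJ W (hom_invHom nm P _) (fun y => uncVal (relLR ε) s (.inr y)) ?_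
    intro k G hG hno
    rw [uncVal_inr_asg _ s hno]
    refine (kap_hom_eq hinj hH fun c hc => hpl.2 k c (mem_gword hJ hG hc)).symm
  · have := wsize_compSys_pcount (relLR ε) s (kap nm P) hJ W fun k G hG hno =>
      (length_kap_le nm P (rep_mem_of_grp hG hno)).2 (hlen k G hG hno).2
    change wsize (compSys (relLR ε) s (kap nm P) W) < wsize W
    omega

lemma shrinks_of_relGood [Finite A] (hs : Solves s W) (hcl : Clean s W) (hB : 2 ≤ B)
    (hM : 2 * wsize W + 2 * vcount W < M)
    (hW : 8 * vcount W < ∑ k, pcount (cc relGood) (W k)) : Shrinks B s W := by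
  have : Finite (Ext A M) := inferInstanceAs (Finite (A ⊕ (Fin M × Bool)))
  obtain ⟨ε, hε, h⟩ := exists_orientation W
  exact shrinks_of_relLR hs hcl hB hM hε (by omega)

end Pairs

/-! ### Linear systems over the natural numbers -/

section Dickson

variable {Y : Type} [Fintype Y]

/-- The linear part of an affine form. -/
def lin (q : (Y → ℕ) × ℕ) (d : Y → ℕ) : ℕ := ∑ y, q.1 y * d y

lemma lin_add (q : (Y → ℕ) × ℕ) (d e : Y → ℕ) : lin q (d + e) = lin q d + lin q e := by
  simp [lin, mul_add, Finset.sum_add_distrib]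

lemma lin_smul (q : (Y → ℕ) × ℕ) (n : ℕ) (d : Y → ℕ) : lin q (n • d) = n * lin q d := by
  simp only [lin, Finset.mul_sum, Pi.smul_apply, smul_eq_mul]
  exact Finset.sum_congr rfl fun _ _ => by ring

lemma lin_zero (q : (Y → ℕ) × ℕ) : lin q 0 = 0 := by simp [lin]

lemma finite_minimal (S : Set (Y → ℕ)) : {d | Minimal (· ∈ S) d}.Finite :=
  (setOfPred_minimal_antichain (· ∈ S)).finite_of_wellQuasiOrdered wellQuasiOrdered_le

lemma exists_sum_minimal {S : Set (Y → ℕ)} (hsub : ∀ d e, d ∈ S → d + e ∈ S → e ∈ S)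
    (n : ℕ) : ∀ d ∈ S, ∑ y, d y = n →
      ∃ es : List (Y → ℕ), (∀ e ∈ es, Minimal (fun e => e ∈ S ∧ e ≠ 0) e) ∧ es.sum = d := by
  induction n using Nat.strong_induction_on with
  | _ n ih =>
    intro d hd hn
    by_cases h0 : d = 0
    · exact ⟨[], by simp, by simp [h0]⟩
    obtain ⟨e, hle, he⟩ := exists_minimal_le_of_wellFoundedLT (fun e => e ∈ S ∧ e ≠ 0) d ⟨hd, h0⟩
    obtain ⟨c, rfl⟩ := exists_add_of_le hle
    have hpos : 0 < ∑ y, e y := by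
      rw [Nat.pos_iff_ne_zero]
      intro h
      rw [Finset.sum_eq_zero_iff] at h
      exact he.prop.2 (funext fun y => h y (Finset.mem_univ y))
    have hsum : ∑ y, (e + c) y = ∑ y, e y + ∑ y, c y := by
      simp [Finset.sum_add_distrib]
    obtain ⟨es, h1, h2⟩ := ih (∑ y, c y) (by omega) c (hsub e c he.prop.1 hd) rfl
    exact ⟨e :: es, by simpa using ⟨he, h1⟩, by simp [h2]⟩

/-- The solutions of a system of affine equations. -/
def Sol (E : Set (((Y → ℕ) × ℕ) × ((Y → ℕ) × ℕ))) : Set (Y → ℕ) :=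
  {d | ∀ e ∈ E, e.1.2 + lin e.1 d = e.2.2 + lin e.2 d}

/-- The solutions of the associated homogeneous system. -/
def HSol (E : Set (((Y → ℕ) × ℕ) × ((Y → ℕ) × ℕ))) : Set (Y → ℕ) :=
  {d | ∀ e ∈ E, lin e.1 d = lin e.2 d}

lemma add_mem_sol {E : Set (((Y → ℕ) × ℕ) × ((Y → ℕ) × ℕ))} {d e : Y → ℕ} (hd : d ∈ Sol E)
    (he : e ∈ HSol E) : d + 4 • e ∈ Sol E := by
  intro q hq
  have h1 := hd q hq
  have h2 := he q hq
  rw [lin_add, lin_add, lin_smul, lin_smul]; omega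

/-- Every solution is obtained from a small one by adding small homogeneous solutions. -/
def SolBound (E : Set (((Y → ℕ) × ℕ) × ((Y → ℕ) × ℕ))) (D : ℕ) : Prop :=
  ∀ d ∈ Sol E, ∃ d0 ∈ Sol E, ∃ es : List (Y → ℕ), (∀ y, d0 y ≤ D) ∧
    (∀ e ∈ es, e ∈ HSol E ∧ ∀ y, e y ≤ D) ∧ d = d0 + 4 • es.sum

lemma exists_solBound (E : Set (((Y → ℕ) × ℕ) × ((Y → ℕ) × ℕ))) : ∃ D, SolBound E D := by
  classical
  have hfin : ∀ T : Set (Y → ℕ), T.Finite → ∃ D : ℕ, ∀ d ∈ T, ∀ y, d y ≤ D := by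
    intro T hT
    refine ⟨∑ d ∈ hT.toFinset, ∑ y, d y, fun d hd y => ?_⟩
    exact (Finset.single_le_sum (f := fun y => d y) (fun _ _ => Nat.zero_le _)
      (Finset.mem_univ y)).trans (Finset.single_le_sum (f := fun d : Y → ℕ => ∑ y, d y)
        (fun _ _ => Nat.zero_le _) (hT.mem_toFinset.2 hd))
  obtain ⟨D1, h1⟩ := hfin _ (finite_minimal {e | e ∈ HSol E ∧ e ≠ 0})
  have h2 : ∀ r : Y → Fin 4, ∃ D : ℕ,
      ∀ d ∈ {d | Minimal (· ∈ {d | d ∈ Sol E ∧ ∀ y, d y % 4 = r y}) d}, ∀ y, d y ≤ D :=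
    fun r => hfin _ (finite_minimal _)
  choose D2 h2 using h2
  refine ⟨D1 + ∑ r, D2 r, fun d hd => ?_⟩
  let r : Y → Fin 4 := fun y => ⟨d y % 4, Nat.mod_lt _ (by norm_num)⟩
  obtain ⟨d0, hle, h0⟩ := exists_minimal_le_of_wellFoundedLT
    (· ∈ {d | d ∈ Sol E ∧ ∀ y, d y % 4 = r y}) d ⟨hd, fun y => rfl⟩
  let c : Y → ℕ := fun y => (d y - d0 y) / 4
  have hdc : d = d0 + 4 • c := by
    funext y
    have e1 : d0 y % 4 = d y % 4 := h0.prop.2 y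
    have e2 : d0 y ≤ d y := hle y
    simp only [c, Pi.add_apply, Pi.smul_apply, smul_eq_mul]
    omega
  have hc : c ∈ HSol E := by
    intro q hq
    have e1 := hd q hq
    have e2 := h0.prop.1 q hq
    rw [hdc, lin_add, lin_add, lin_smul, lin_smul] at e1
    omega
  obtain ⟨es, h3, h4⟩ := exists_sum_minimal (S := HSol E) (fun d e hd hde q hq => by
    have e1 := hd q hq
    have e2 := hde q hq
    rw [lin_add, lin_add] at e2; omega) _ c hc rfl
  refine ⟨d0, h0.prop.1, es, fun y => ?_, fun e he => ⟨(h3 e he).prop.1, fun y => ?_⟩,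
    by rw [h4]; exact hdc⟩
  · have := h2 r d0 h0 y
    have := Finset.single_le_sum (f := D2) (fun _ _ => Nat.zero_le _) (Finset.mem_univ r)
    omega
  · have := h1 e (h3 e he) y
    omega

lemma exists_uniform_solBound (Y : Type) [Fintype Y] (R : ℕ) :
    ∃ D, ∀ E : Set (((Y → ℕ) × ℕ) × ((Y → ℕ) × ℕ)),
      (∀ e ∈ E, (∀ y, e.1.1 y ≤ R) ∧ e.1.2 ≤ R ∧ (∀ y, e.2.1 y ≤ R) ∧ e.2.2 ≤ R) →
      SolBound E D := by
  classical
  let T : Set (((Y → ℕ) × ℕ) × ((Y → ℕ) × ℕ)) := Set.Iic ((fun _ => R, R), (fun _ => R, R))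
  have hT : T.Finite := Set.finite_Iic _
  choose D hD using exists_solBound (Y := Y)
  obtain ⟨D', hD'⟩ := (hT.finite_subsets.image D).bddAbove
  refine ⟨D', fun E hE d hd => ?_⟩
  have hET : E ⊆ T := fun e he =>
    ⟨⟨(hE e he).1, (hE e he).2.1⟩, ⟨(hE e he).2.2.1, (hE e he).2.2.2⟩⟩
  have hle : D E ≤ D' := hD' ⟨E, hET, rfl⟩
  obtain ⟨d0, h0, es, h1, h2, h3⟩ := hD E d hd
  exact ⟨d0, h0, es, fun y => (h1 y).trans hle,
    fun e he => ⟨(h2 e he).1, fun y => ((h2 e he).2 y).trans hle⟩, h3⟩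

end Dickson

/-! ### Orbits of an involution -/

section Stretch

variable {C : Type} [Invol C] (f : C → C)

/-- The alternating word of length `n` starting like `u`. -/
def stretch (u : List C) (n : ℕ) : List C :=
  match u with
  | [] => []
  | a :: _ => List.iterate f a n

variable {f}

lemma iterate_concat (a : C) (n : ℕ) : List.iterate f a (n + 1) = List.iterate f a n ++ [f^[n] a] := by
  induction n generalizing a with
  | zero => rfl
  | succ n ih =>
    rw [List.iterate, ih, List.iterate, List.cons_append, Function.iterate_succ_apply]

lemma iterate_add' (a : C) (n k : ℕ) :
    List.iterate f a (n + k) = List.iterate f a n ++ List.iterate f (f^[n] a) k := by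
  induction n generalizing a with
  | zero => simp [List.iterate]
  | succ n ih =>
    rw [Nat.succ_add, List.iterate, ih, List.iterate, List.cons_append,
      Function.iterate_succ_apply]

lemma mem_iterate {a b : C} {n : ℕ} (h : b ∈ List.iterate f a n) : ∃ k, b = f^[k] a := by
  induction n generalizing a with
  | zero => simp [List.iterate] at h
  | succ n ih =>
    rw [List.iterate, List.mem_cons] at h
    rcases h with rfl | h
    · exact ⟨0, rfl⟩
    · obtain ⟨k, rfl⟩ := ih h
      exact ⟨k + 1, rfl⟩

lemma chain_eq_iterate {a : C} {u : List C}
    (h : (a :: u).IsChain fun a b => relOf f a b = true) :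
    a :: u = List.iterate f a (u.length + 1) := by
  induction u generalizing a with
  | nil => rfl
  | cons b u ih =>
    rw [List.isChain_cons_cons] at h
    have hb : b = f a := by simpa [relOf] using h.1
    rw [List.length_cons, List.iterate, ← hb, ← ih h.2]

lemma chain_eq_stretch {u : List C} (h : u.IsChain fun a b => relOf f a b = true) :
    u = stretch f u u.length := by
  rcases u with _ | ⟨a, u⟩
  · rfl
  · exact chain_eq_iterate h

lemma length_stretch_le (u : List C) (n : ℕ) : (stretch f u n).length ≤ n := by
  cases u <;> simp [stretch]

lemma iterate_eq_of_mod (hff : ∀ a, f (f a) = a) {n k : ℕ} (h : n % 2 = k % 2) (a : C) : f^[n] a = f^[k] a := by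
  have hinv : Function.Involutive f := hff
  rcases Nat.even_or_odd n with hn | hn
  · have hk : Even k := by rw [Nat.even_iff] at hn ⊢; omega
    rw [hinv.iterate_even hn, hinv.iterate_even hk]
  · have hk : Odd k := by rw [Nat.odd_iff] at hn ⊢; omega
    rw [hinv.iterate_odd hn, hinv.iterate_odd hk]

lemma stretch_append (hff : ∀ a, f (f a) = a) {u v : List C} (hu : u ≠ []) (hv : v ≠ [])
    (h : (u ++ v).IsChain fun a b => relOf f a b = true) {n : ℕ} (hn : n % 2 = u.length % 2)
    (k : ℕ) : stretch f u n ++ stretch f v k = stretch f (u ++ v) (n + k) := by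
  rcases u with _ | ⟨a, u⟩
  · exact absurd rfl hu
  rcases v with _ | ⟨b, v⟩
  · exact absurd rfl hv
  rw [List.cons_append] at h
  have h1 := chain_eq_iterate h
  rw [show (u ++ b :: v).length + 1 = (u.length + 1) + (v.length + 1) by simp; omega,
    iterate_add', ← List.cons_append] at h1
  have h2 := (List.append_inj h1 (by simp)).2
  rw [List.iterate] at h2
  have hb : b = f^[u.length + 1] a := (List.cons.inj h2).1
  rw [List.length_cons] at hn
  rw [← iterate_eq_of_mod hff hn] at hb
  rw [List.cons_append, stretch, stretch, stretch, hb, iterate_add']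

lemma lbar_iterate (hfb : ∀ a, f (bar a) = bar (f a)) (hff : ∀ a, f (f a) = a) (a : C) (n : ℕ) :
    lbar (List.iterate f a n) = List.iterate f (bar (f^[n + 1] a)) n := by
  induction n generalizing a with
  | zero => rfl
  | succ n ih =>
    rw [iterate_concat, lbar_append, ih, List.iterate, lbar_singleton, List.singleton_append,
      hfb]
    rw [Function.iterate_succ_apply' f (n + 1), Function.iterate_succ_apply' f n, hff]

lemma lbar_stretch (hfb : ∀ a, f (bar a) = bar (f a)) (hff : ∀ a, f (f a) = a) {u : List C}
    (h : u.IsChain fun a b => relOf f a b = true) {n : ℕ} (hn : n % 2 = u.length % 2) :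
    lbar (stretch f u n) = stretch f (lbar u) n := by
  rcases u with _ | ⟨a, u⟩
  · rfl
  conv_rhs => rw [chain_eq_iterate h, lbar_iterate hfb hff]
  rw [stretch, lbar_iterate hfb hff, List.iterate, stretch]
  congr 2
  exact iterate_eq_of_mod hff (by rw [List.length_cons] at hn; omega) a

lemma self_inverse_chain (hfb : ∀ a, f (bar a) = bar (f a)) (hff : ∀ a, f (f a) = a) {a : C}
    {u : List C} (h : (a :: u).IsChain fun a b => relOf f a b = true)
    (hs : lbar (a :: u) = a :: u) : bar (f a) = a ∧ (a :: u).length % 2 = 0 := by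
  have h1 := hs
  rw [chain_eq_iterate h, lbar_iterate hfb hff, List.iterate, List.iterate] at h1
  have h2 := (List.cons.inj h1).1
  rcases Nat.mod_two_eq_zero_or_one (u.length + 1) with h3 | h3
  · rw [iterate_eq_of_mod (k := 1) hff (by omega)] at h2
    exact ⟨h2, h3⟩
  · rw [iterate_eq_of_mod (k := 0) hff (by omega)] at h2
    exact absurd h2 (bar_ne a)

lemma stretch_half (hfb : ∀ a, f (bar a) = bar (f a)) (hff : ∀ a, f (f a) = a) {u : List C}
    (h : u.IsChain fun a b => relOf f a b = true) (hs : lbar u = u) (m : ℕ) :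
    stretch f u m ++ lbar (stretch f u m) = stretch f u (2 * m) := by
  rcases u with _ | ⟨a, u⟩
  · rfl
  have ha := (self_inverse_chain hfb hff h hs).1
  rw [stretch, stretch, lbar_iterate hfb hff, two_mul, iterate_add']
  congr 2
  have : ∀ k, bar (f^[k] a) = f^[k] (bar a) := fun k =>
    ((Function.Commute.iterate_left (f := f) (g := bar) hfb k) a).symm
  rw [this, Function.iterate_succ_apply, hfb, ha]

lemma stretch_even_append (hff : ∀ a, f (f a) = a) (u : List C) {p : ℕ} (hp : p % 2 = 0) (m : ℕ) :
    stretch f u p ++ stretch f u m = stretch f u (p + m) := by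
  rcases u with _ | ⟨a, u⟩
  · rfl
  rw [stretch, stretch, stretch, iterate_add', iterate_eq_of_mod (k := 0) hff hp]
  rfl

lemma relOf_bar (hfb : ∀ a, f (bar a) = bar (f a)) (hff : ∀ a, f (f a) = a) (a b : C) :
    relOf f a b = relOf f (bar b) (bar a) := by
  have hi := Function.Involutive.injective (f := (bar : C → C)) bar_bar
  simp only [relOf, hfb, decide_eq_decide]
  constructor
  · rintro rfl; rw [hff]
  · intro h
    rw [hi h, hff]

end Stretch

section Forms

variable {C X : Type} [Invol C] [Fintype X] [DecidableEq X]

/-- The affine form giving the length of a symbol. -/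
def symForm : Sym C (UVar X) → ((X × Bool) → ℕ) × ℕ
  | .c _ => (0, 1)
  | .v (.inl _) _ => (0, 0)
  | .v (.inr y) _ => (Pi.single y 1, 0)

/-- The affine form giving the length of a group. -/
def grpForm (G : List (Sym C (UVar X))) : ((X × Bool) → ℕ) × ℕ := (G.map symForm).sum

/-- The value of an affine form. -/
def formVal (q : ((X × Bool) → ℕ) × ℕ) (d : X × Bool → ℕ) : ℕ := q.2 + lin q d

lemma lin_form_add (q q' : ((X × Bool) → ℕ) × ℕ) (d : X × Bool → ℕ) :
    lin (q + q') d = lin q d + lin q' d := by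
  simp [lin, add_mul, Finset.sum_add_distrib]

lemma grpForm_cons (a : Sym C (UVar X)) (G : List (Sym C (UVar X))) :
    grpForm (a :: G) = symForm a + grpForm G := by simp [grpForm]

lemma formVal_cons (a : Sym C (UVar X)) (G : List (Sym C (UVar X))) (d : X × Bool → ℕ) :
    formVal (grpForm (a :: G)) d = formVal (symForm a) d + formVal (grpForm G) d := by
  rw [grpForm_cons, formVal, lin_form_add, formVal, formVal, Prod.snd_add]; omega

lemma formVal_single (y : X × Bool) (d : X × Bool → ℕ) :
    formVal (Pi.single y 1, 0) d = d y := by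
  simp [formVal, lin, Pi.single_apply]

lemma grpForm_le (G : List (Sym C (UVar X))) :
    (∀ y, (grpForm G).1 y ≤ G.length) ∧ (grpForm G).2 ≤ G.length := by
  induction G with
  | nil => simp [grpForm]
  | cons a G ih =>
    have h : (∀ y, (symForm a).1 y ≤ 1) ∧ (symForm a).2 ≤ 1 := by
      rcases a with a | ⟨x | y, b⟩
      · simp [symForm]
      · simp [symForm]
      · refine ⟨fun z => ?_, by simp [symForm]⟩
        simp only [symForm, Pi.single_apply]
        split_ifs <;> simp
    rw [grpForm_cons]
    refine ⟨fun y => ?_, ?_⟩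
    · have := h.1 y; have := ih.1 y
      simp only [Prod.fst_add, Pi.add_apply, List.length_cons]; omega
    · have := h.2; have := ih.2
      simp only [Prod.snd_add, List.length_cons]; omega

lemma lin_grpForm_le (G : List (Sym C (UVar X))) {D : ℕ} {d : X × Bool → ℕ} (h : ∀ y, d y ≤ D) :
    lin (grpForm G) d ≤ G.length * D := by
  induction G with
  | nil => simp [grpForm, lin]
  | cons a G ih =>
    rw [grpForm_cons, lin_form_add, List.length_cons, Nat.succ_mul]
    have : lin (symForm a) d ≤ D := by
      rcases a with a | ⟨x | y, b⟩
      · simp [symForm, lin]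
      · simp [symForm, lin]
      · have := formVal_single y d
        rw [formVal, zero_add] at this
        rw [symForm, this]
        exact h y
    omega

end Forms

/-! ### Compression of orbits -/

section Groups

variable {C X : Type} [Invol C] [Fintype X] [DecidableEq X] {f : C → C}

/-- The lengths of the chain variables. -/
def chainLen (J : C → C → Bool) (s : X → List C) (y : X × Bool) : ℕ :=
  (uncVal J s (.inr y)).length

/-- The values of the chain variables with prescribed lengths. -/
noncomputable def chainVal (f : C → C) (s : X → List C) (d : X × Bool → ℕ) (y : X × Bool) : List C :=
  stretch f (uncVal (relOf f) s (.inr y)) (d y)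

lemma sym_stretch (hfb : ∀ a, f (bar a) = bar (f a)) (hff : ∀ a, f (f a) = a) (s : X → List C)
    {a : Sym C (UVar X)} (ha : isOld a = false)
    (hc : (asg (uncVal (relOf f) s) a).IsChain fun a b => relOf f a b = true)
    {d : X × Bool → ℕ} (hd : ∀ y, d y % 2 = chainLen (relOf f) s y % 2) :
    asg (Sum.elim (fun _ => []) (chainVal f s d)) a =
        stretch f (asg (uncVal (relOf f) s) a) (formVal (symForm a) d) ∧
      formVal (symForm a) d % 2 = (asg (uncVal (relOf f) s) a).length % 2 := by
  rcases a with a | ⟨x | y, _ | _⟩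
  · simp [symForm, formVal, lin, stretch]
  · simp [isOld] at ha
  · simp [isOld] at ha
  · have hc' : (uncVal (relOf f) s (.inr y)).IsChain fun a b => relOf f a b = true := by
      rw [asg_false] at hc
      have := isChain_lbar (relOf_bar hfb hff) hc
      rwa [lbar_lbar] at this
    rw [symForm, formVal_single, asg_false, asg_false, length_lbar]
    exact ⟨lbar_stretch hfb hff hc' (hd y), hd y⟩
  · rw [symForm, formVal_single, asg_true, asg_true]
    exact ⟨rfl, hd y⟩

lemma grp_stretch (hfb : ∀ a, f (bar a) = bar (f a)) (hff : ∀ a, f (f a) = a) (s : X → List C)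
    {d : X × Bool → ℕ} (hd : ∀ y, d y % 2 = chainLen (relOf f) s y % 2)
    {G : List (Sym C (UVar X))} (hno : ∀ a ∈ G, isOld a = false)
    (hne : ∀ a ∈ G, asg (uncVal (relOf f) s) a ≠ [])
    (hc : (gword (relOf f) s G).IsChain fun a b => relOf f a b = true) :
    G.flatMap (asg (Sum.elim (fun _ => []) (chainVal f s d))) =
        stretch f (gword (relOf f) s G) (formVal (grpForm G) d) ∧
      formVal (grpForm G) d % 2 = (gword (relOf f) s G).length % 2 := by
  induction G with
  | nil => simp [gword, stretch, grpForm, formVal, lin]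
  | cons a G ih =>
    have hg : gword (relOf f) s (a :: G) = asg (uncVal (relOf f) s) a ++ gword (relOf f) s G := rfl
    rw [hg] at hc ⊢
    obtain ⟨h1, h2⟩ := sym_stretch hfb hff s (hno a (by simp)) (List.isChain_append.1 hc).1 hd
    obtain ⟨h3, h4⟩ := ih (fun b hb => hno b (by simp [hb])) (fun b hb => hne b (by simp [hb]))
      (List.isChain_append.1 hc).2.1
    rw [List.flatMap_cons, h1, h3, formVal_cons, List.length_append]
    refine ⟨?_, by omega⟩
    rcases G with _ | ⟨b, G⟩
    · simp [gword, stretch, grpForm, formVal, lin]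
    · refine stretch_append hff (hne a (by simp)) ?_ hc h2 _
      have := hne b (by simp)
      simp [gword, this]

lemma formVal_chainLen (J : C → C → Bool) (s : X → List C) {G : List (Sym C (UVar X))}
    (hno : ∀ a ∈ G, isOld a = false) :
    formVal (grpForm G) (chainLen J s) = (gword J s G).length := by
  induction G with
  | nil => simp [gword, grpForm, formVal, lin]
  | cons a G ih =>
    have hg : gword J s (a :: G) = asg (uncVal J s) a ++ gword J s G := rfl
    rw [hg, formVal_cons, ih fun b hb => hno b (by simp [hb]), List.length_append]
    congr 1
    have ha := hno a (by simp)
    rcases a with a | ⟨x | y, _ | _⟩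
    · simp [symForm, formVal, lin]
    · simp [isOld] at ha
    · simp [isOld] at ha
    · rw [symForm, formVal_single, asg_false, length_lbar, chainLen]
    · rw [symForm, formVal_single, asg_true, chainLen]

lemma grp_ne {J : C → C → Bool} (hJ : ∀ a b, J a b = J (bar b) (bar a)) (s : X → List C)
    {w : List (Sym C X)} {G : List (Sym C (UVar X))} (hG : G ∈ grp J s w) :
    ∀ a ∈ G, asg (uncVal J s) a ≠ [] := by
  intro a ha
  refine (UncBlock.flatMap J s hJ w).ne a ?_
  rw [← List.flatten_splitBy (grel J s) (w.flatMap (unc J s))]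
  exact List.mem_flatten.2 ⟨G, hG, ha⟩

lemma length_grp_le {K : Type} [Fintype K] {J : C → C → Bool} (s : X → List C) {W : WSys C X K}
    {k : Option (K × Bool)} {G : List (Sym C (UVar X))} (hG : G ∈ grp J s (W k)) :
    G.length ≤ wsize W + 2 * vcount W := by
  have h1 : G.length ≤ ((W k).flatMap (unc J s)).length := by
    conv_rhs => rw [← List.flatten_splitBy (grel J s) ((W k).flatMap (unc J s))]
    exact (List.sublist_flatten_of_mem hG).length_le
  have h2 := length_flatMap_unc J s (W k)
  have h3 := length_le_wsize W k
  have h4 : (W k).countP Sym.isVar ≤ vcount W :=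
    Finset.single_le_sum (f := fun k => (W k).countP Sym.isVar) (fun _ _ => Nat.zero_le _)
      (Finset.mem_univ k)
  omega

end Groups

section Round

variable {A X K : Type} [Invol A] [Fintype X] [DecidableEq X] [Fintype K] {M B : ℕ}
  {W : WSys (Ext A M) X K} {s : X → List (Ext A M)}

open Classical in
/-- The values of the names for prescribed lengths. -/
noncomputable def orbVal (f : Ext A M → Ext A M) (q : List (Ext A M) → ((X × Bool) → ℕ) × ℕ)
    (d : X × Bool → ℕ) (v : List (Ext A M)) : List (Ext A M) :=
  stretch f v (if lbar v = v then formVal (q v) d / 2 else formVal (q v) d)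

open Classical in
/-- The substitution lengthening the values of the names. -/
noncomputable def orbLoop (f : Ext A M → Ext A M) (nm : List (Ext A M) → Fin M)
    (q : List (Ext A M) → ((X × Bool) → ℕ) × ℕ) (e : X × Bool → ℕ) (v : List (Ext A M)) :
    List (Ext A M) :=
  stretch f v ((if lbar v = v then 2 else 4) * lin (q v) e) ++ [.inr (nm v, true)]

lemma orbLoop_orbVal {f : Ext A M → Ext A M} (hff : ∀ a, f (f a) = a)
    {nm : List (Ext A M) → Fin M} {P : Set (List (Ext A M))} (hinj : Set.InjOn nm P)
    (hpl : ∀ v ∈ P, ∀ c ∈ v, ∀ k, Plain nm P (f^[k] c))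
    (q : List (Ext A M) → ((X × Bool) → ℕ) × ℕ) (e d : X × Bool → ℕ)
    {v : List (Ext A M)} (hv : v ∈ P) :
    (orbLoop f nm q e v).flatMap (hom nm P (orbVal f q d)) = orbVal f q (d + 4 • e) v := by
  rw [orbLoop, List.flatMap_append, hom_flatMap_plain, List.flatMap_singleton, hom_nm hinj _ hv,
    if_pos rfl, orbVal, stretch_even_append hff, orbVal]
  · congr 1
    simp only [formVal, lin_add, lin_smul]
    split_ifs <;> omega
  · split_ifs <;> omega
  · intro c hc
    rcases v with _ | ⟨a, v⟩
    · simp [stretch] at hc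
    · obtain ⟨k, rfl⟩ := mem_iterate hc
      exact hpl _ hv a (by simp) k

lemma foldSub_orbVal {f : Ext A M → Ext A M} (hff : ∀ a, f (f a) = a)
    {nm : List (Ext A M) → Fin M} {P : Set (List (Ext A M))} (hinj : Set.InjOn nm P)
    (hpl : ∀ v ∈ P, ∀ c ∈ v, ∀ k, Plain nm P (f^[k] c))
    (q : List (Ext A M) → ((X × Bool) → ℕ) × ℕ) (es : List (X × Bool → ℕ)) (d : X × Bool → ℕ)
    (c : Ext A M) :
    foldSub (hom nm P (orbVal f q d) :: es.map fun e => hom nm P (orbLoop f nm q e)) [c] =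
      hom nm P (orbVal f q (d + 4 • es.sum)) c := by
  induction es generalizing d with
  | nil => simp
  | cons e es ih =>
    have h := ih (d + 4 • e)
    rw [List.map_cons, foldSub_cons, foldSub_cons, List.flatMap_assoc]
    rw [foldSub_cons] at h
    rw [flatMap_congr_mem (g := hom nm P (orbVal f q (d + 4 • e))) fun c _ =>
      hom_comp hinj (fun v hv => orbLoop_orbVal hff hinj hpl q e d hv) c, h, List.sum_cons,
      smul_add, add_assoc]

lemma length_hom_le {nm : List (Ext A M) → Fin M} {P : Set (List (Ext A M))}
    (hinj : Set.InjOn nm P) {H : List (Ext A M) → List (Ext A M)} (hB : 1 ≤ B)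
    (hH : ∀ v ∈ P, (H v).length ≤ B) (c : Ext A M) : (hom nm P H c).length ≤ B := by
  by_cases hc : Plain nm P c
  · rw [hom_plain _ hc]; simpa using hB
  · simp only [Plain, not_forall, not_not] at hc
    obtain ⟨j, b, rfl, v, hv, rfl⟩ := hc
    rw [hom_nm hinj _ hv]
    have := hH v hv
    cases b <;> simpa

lemma shrinks_of_relOf (hs : Solves s W) (hcl : Clean s W) {f : Ext A M → Ext A M}
    (hf : f = _root_.id ∨ f = bar) {R D : ℕ} (hR : wsize W + 2 * vcount W ≤ R)
    (hD : ∀ E : Set (((X × Bool → ℕ) × ℕ) × ((X × Bool → ℕ) × ℕ)),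
      (∀ e ∈ E, (∀ y, e.1.1 y ≤ R) ∧ e.1.2 ≤ R ∧ (∀ y, e.2.1 y ≤ R) ∧ e.2.2 ≤ R) →
      SolBound E D)
    (hB : R + 4 * (R * D) + 1 ≤ B) (hM : 2 * wsize W + 2 * vcount W < M)
    (hsz : ∀ nm, wsize (compSys (relOf f) s
      (kap nm (rep '' chainWords (relOf f) s W)) W) < wsize W) : Shrinks B s W := by
  have hff : ∀ a, f (f a) = a := by rcases hf with rfl | rfl <;> simp
  have hfb : ∀ a, f (bar a) = bar (f a) := by rcases hf with rfl | rfl <;> simp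
  have hJ := relOf_bar hfb hff
  obtain ⟨nm, hinj, hav⟩ := exists_naming (relOf f) s W hM
  have hpl := plain_of_clean hav hcl
  have hsz := hsz nm
  have hPG : ∀ v ∈ rep '' chainWords (relOf f) s W, ∃ k, ∃ G ∈ grp (relOf f) s (W k),
      (∀ a ∈ G, isOld a = false) ∧ rep (gword (relOf f) s G) = v := by
    rintro v ⟨u, ⟨k, G, hG, hno, rfl⟩, rfl⟩
    exact ⟨k, G, hG, hno, rfl⟩
  have hmemP : ∀ {k G}, G ∈ grp (relOf f) s (W k) → (∀ a ∈ G, isOld a = false) →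
      rep (gword (relOf f) s G) ∈ rep '' chainWords (relOf f) s W := fun hG hno =>
    rep_mem_of_grp hG hno
  have hPlain : ∀ v ∈ rep '' chainWords (relOf f) s W, ∀ c ∈ v,
      Plain nm (rep '' chainWords (relOf f) s W) c := by
    intro v hv c hc
    obtain ⟨k, G, hG, hno, rfl⟩ := hPG v hv
    rw [rep] at hc
    split_ifs at hc
    · exact hpl.2 k c (mem_gword hJ hG hc)
    · rw [mem_lbar] at hc
      exact plain_bar.1 (hpl.2 k _ (mem_gword hJ hG hc))
  have hPlain' : ∀ v ∈ rep '' chainWords (relOf f) s W, ∀ c ∈ v, ∀ k,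
      Plain nm (rep '' chainWords (relOf f) s W) (f^[k] c) := by
    intro v hv c hc k
    induction k with
    | zero => exact hPlain v hv c hc
    | succ k ih =>
      rw [Function.iterate_succ_apply']
      rcases hf with rfl | rfl
      · exact ih
      · exact plain_bar.2 ih
  have hch : ∀ {k G}, G ∈ grp (relOf f) s (W k) → (∀ a ∈ G, isOld a = false) →
      gword (relOf f) s G ≠ [] ∧ (gword (relOf f) s G).IsChain fun a b => relOf f a b = true := by
    intro k G hG hno
    obtain ⟨hne, ⟨x, b, rfl⟩ | ⟨-, hc⟩⟩ := grp_spec _ s hJ hG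
    · simp [isOld] at hno
    · exact ⟨hne, hc⟩
  choose! kq Gq hGq hnq hrq using hPG
  set P := rep '' chainWords (relOf f) s W with hP
  let q : List (Ext A M) → ((X × Bool) → ℕ) × ℕ := fun v => grpForm (Gq v)
  have hchP : ∀ v ∈ P, v.IsChain fun a b => relOf f a b = true := by
    intro v hv
    have := (hch (hGq v hv) (hnq v hv)).2
    rw [← hrq v hv, rep]
    split_ifs
    · exact this
    · exact isChain_lbar hJ this
  have hlenP : ∀ v ∈ P, (gword (relOf f) s (Gq v)).length = v.length := by
    intro v hv
    rw [← length_rep, hrq v hv]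
  let E : Set (((X × Bool → ℕ) × ℕ) × ((X × Bool → ℕ) × ℕ)) :=
    {e | ∃ k, ∃ G ∈ grp (relOf f) s (W k), (∀ a ∈ G, isOld a = false) ∧
      e = (grpForm G, q (rep (gword (relOf f) s G)))}
  have hEb : ∀ e ∈ E, (∀ y, e.1.1 y ≤ R) ∧ e.1.2 ≤ R ∧ (∀ y, e.2.1 y ≤ R) ∧ e.2.2 ≤ R := by
    rintro e ⟨k, G, hG, hno, rfl⟩
    have h1 := grpForm_le G
    have h2 := grpForm_le (Gq (rep (gword (relOf f) s G)))
    have h3 := (length_grp_le s hG).trans hR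
    have h4 := (length_grp_le s (hGq _ (hmemP hG hno))).trans hR
    exact ⟨fun y => (h1.1 y).trans h3, h1.2.trans h3, fun y => (h2.1 y).trans h4, h2.2.trans h4⟩
  have hlen : chainLen (relOf f) s ∈ Sol E := by
    rintro e ⟨k, G, hG, hno, rfl⟩
    have h1 := formVal_chainLen (relOf f) s hno
    have h2 := formVal_chainLen (relOf f) s (hnq _ (hmemP hG hno))
    rw [hlenP _ (hmemP hG hno), length_rep, ← h1] at h2
    exact h2.symm
  obtain ⟨d0, hd0, es, hd0D, hes, hde⟩ := hD E hEb _ hlen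
  have hval : ∀ d ∈ Sol E, (∀ y, d y % 2 = chainLen (relOf f) s y % 2) → ∀ v ∈ P,
      full (orbVal f q d) v = stretch f v (formVal (q v) d) := by
    intro d hd hpar v hv
    have hev := (grp_stretch hfb hff s hpar (hnq v hv) (grp_ne hJ s (hGq v hv))
      (hch (hGq v hv) (hnq v hv)).2).2
    rw [full, orbVal]
    split_ifs with h
    · rw [stretch_half hfb hff (hchP v hv) h]
      congr 1
      have hvne : v ≠ [] := by
        rintro rfl
        exact (hch (hGq _ hv) (hnq _ hv)).1 (List.eq_nil_of_length_eq_zero (hlenP _ hv))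
      obtain ⟨a, u, rfl⟩ := List.exists_cons_of_ne_nil hvne
      have := (self_inverse_chain hfb hff (hchP _ hv) h).2
      rw [hlenP _ hv] at hev
      change formVal (q (a :: u)) d % 2 = _ at hev
      omega
    · rfl
  have hlin : ∀ v ∈ P, ∀ d : X × Bool → ℕ, (∀ y, d y ≤ D) → lin (q v) d ≤ R * D := by
    intro v hv d hd
    exact (lin_grpForm_le _ hd).trans (Nat.mul_le_mul_right _
      ((length_grp_le s (hGq v hv)).trans hR))
  have hBi : ∀ c, (hom nm P (orbVal f q d0) c).length ≤ B := by
    refine length_hom_le hinj (by omega) fun v hv => ?_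
    have h1 := hlin v hv d0 hd0D
    have h2 := (grpForm_le (Gq v)).2
    have h3 := (length_grp_le s (hGq v hv)).trans hR
    have h4 : formVal (q v) d0 ≤ R + R * D := by
      rw [formVal]; exact Nat.add_le_add (h2.trans h3) h1
    refine (length_stretch_le _ _).trans ?_
    split_ifs <;> omega
  have hBl : ∀ e : X × Bool → ℕ, (∀ y, e y ≤ D) →
      ∀ c, (hom nm P (orbLoop f nm q e) c).length ≤ B := by
    intro e he
    refine length_hom_le hinj (by omega) fun v hv => ?_
    have h1 := hlin v hv e he
    rw [orbLoop, List.length_append, List.length_singleton]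
    have h2 := length_stretch_le (f := f) v
      ((open Classical in if lbar v = v then 2 else 4) * lin (q v) e)
    refine (Nat.add_le_add_right h2 1).trans ?_
    split_ifs <;> omega
  let i : Lab (Ext A M) B := fun c => ⟨_, hBi c⟩
  let V : Set (Lab (Ext A M) B) :=
    {φ | ∃ e, e ∈ HSol E ∧ φ.sub = hom nm P (orbLoop f nm q e)}
  have hfold : ∀ es : List (X × Bool → ℕ), ∀ φs : List (Lab (Ext A M) B),
      φs.map Lab.sub = es.map (fun e => hom nm P (orbLoop f nm q e)) →
      ∀ c, foldSub (i.sub :: φs.map Lab.sub) [c] =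
        hom nm P (orbVal f q (d0 + 4 • es.sum)) c := by
    intro es φs h c
    rw [h]
    exact foldSub_orbVal hff hinj hPlain' q es d0 c
  have hesum : ∀ es : List (X × Bool → ℕ), (∀ e ∈ es, e ∈ HSol E) → es.sum ∈ HSol E := by
    intro es h
    induction es with
    | nil => intro e _; simp [lin_zero]
    | cons e es ih =>
      intro a ha
      rw [List.sum_cons, lin_add, lin_add, h e (by simp) a ha,
        ih (fun e he => h e (by simp [he])) a ha]
  have hmod : ∀ (e : X × Bool → ℕ) y, (d0 + 4 • e) y % 2 = chainLen (relOf f) s y % 2 := by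
    intro e y
    rw [hde]
    simp only [Pi.add_apply, Pi.smul_apply, smul_eq_mul]; omega
  let φs : List (Lab (Ext A M) B) := es.attach.map fun e c => ⟨_, hBl e.1 (hes e.1 e.2).2 c⟩
  have hφs : φs.map Lab.sub = es.map fun e => hom nm P (orbLoop f nm q e) := by
    simp only [φs, List.map_map]
    conv_rhs => rw [← List.attach_map_subtype_val es, List.map_map]
    rfl
  refine shrinks_of_values (i := i) (V := V) (φs := φs) (nm := nm)
    (H := orbVal f q (chainLen (relOf f) s)) hJ hs hcl hinj hav ?_ ?_ ?_ ?_ hsz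
  · intro v hv
    rw [hval _ hlen (fun _ => rfl) v hv, formVal_chainLen _ _ (hnq v hv), hlenP v hv]
    exact (chain_eq_stretch (hchP v hv)).symm
  · intro φ hφ
    simp only [φs, List.mem_map] at hφ
    obtain ⟨e, -, rfl⟩ := hφ
    exact ⟨e.1, (hes e.1 e.2).1, rfl⟩
  · intro c
    rw [hfold es φs hφs c, ← hde]
  · intro ψs hψs
    obtain ⟨es', hes', hmap⟩ : ∃ es' : List (X × Bool → ℕ), (∀ e ∈ es', e ∈ HSol E) ∧
        ψs.map Lab.sub = es'.map fun e => hom nm P (orbLoop f nm q e) := by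
      clear hfold
      induction ψs with
      | nil => exact ⟨[], by simp, rfl⟩
      | cons ψ ψs ih =>
        obtain ⟨es', h1, h2⟩ := ih fun φ hφ => hψs φ (by simp [hφ])
        obtain ⟨e, h3, h4⟩ := hψs ψ (by simp)
        exact ⟨e :: es', by simpa using ⟨h3, h1⟩, by simp [h2, h4]⟩
    simp only [hfold es' ψs hmap]
    have hsol := add_mem_sol hd0 (hesum es' hes')
    refine arc_compSys _ s _ hJ W (hom_invHom nm P _) (chainVal f s (d0 + 4 • es'.sum)) ?_
    intro k G hG hno
    have hpar := hmod es'.sum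
    obtain ⟨h1, h2⟩ := grp_stretch hfb hff s hpar hno (grp_ne hJ s hG) (hch hG hno).2
    have heq : formVal (grpForm G) (d0 + 4 • es'.sum) =
        formVal (q (rep (gword (relOf f) s G))) (d0 + 4 • es'.sum) :=
      hsol _ ⟨k, G, hG, hno, rfl⟩
    rw [h1, kap_hom hinj _ (hmemP hG hno)]
    have hrm := hmemP hG hno
    split_ifs with hp
    · rw [rep_of_pos hp] at hrm heq
      rw [hval _ hsol hpar _ hrm, heq]
    · have hr : rep (gword (relOf f) s G) = lbar (gword (relOf f) s G) := if_neg hp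
      rw [hr] at hrm heq
      rw [hval _ hsol hpar _ hrm, ← heq,
        lbar_stretch hfb hff (hchP _ hrm) (by rw [h2, length_lbar]), lbar_lbar]

end Round

/-! ### Word equations with involution -/

section Assembly

variable {A X K : Type} [Invol A] [Fintype X] [DecidableEq X] [Fintype K] {M B : ℕ}
  {W : WSys (Ext A M) X K} {s : X → List (Ext A M)}

lemma wsize_compSys_id_lt (nm : List (Ext A M) → Fin M)
    (hW : 2 * vcount W < ∑ k, pcount (cc (relOf _root_.id)) (W k)) :
    wsize (compSys (relOf _root_.id) s
      (kap nm (rep '' chainWords (relOf _root_.id) s W)) W) < wsize W := by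
  have hJ := relOf_bar (C := Ext A M) (f := _root_.id) (fun _ => rfl) (fun _ => rfl)
  have h := wsize_compSys_pcount (relOf _root_.id) s
    (kap nm (rep '' chainWords (relOf _root_.id) s W)) hJ W fun k G hG hno => ?_
  · omega
  · refine (length_kap_le nm _ (rep_mem_of_grp hG hno)).2 fun hs => ?_
    obtain ⟨hne, ⟨x, b, rfl⟩ | ⟨-, hc⟩⟩ := grp_spec _ s hJ hG
    · simp [isOld] at hno
    · obtain ⟨a, u, hu⟩ := List.exists_cons_of_ne_nil hne
      rw [hu] at hs hc
      exact bar_ne a (self_inverse_chain (f := _root_.id) (fun _ => rfl) (fun _ => rfl) hc hs).1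

lemma wsize_compSys_bar_lt (nm : List (Ext A M) → Fin M)
    (hW : 5 * vcount W < ∑ k, tcount (cc (relOf bar)) (W k)) :
    wsize (compSys (relOf bar) s (kap nm (rep '' chainWords (relOf bar) s W)) W) < wsize W := by
  have hJ := relOf_bar (C := Ext A M) (f := bar) (fun _ => rfl) bar_bar
  have h := wsize_compSys_tcount (relOf bar) s
    (kap nm (rep '' chainWords (relOf bar) s W)) hJ W fun k G hG hno => ?_
  · omega
  · have hk := length_kap_le nm _ (rep_mem_of_grp hG hno)
    obtain ⟨hne, ⟨x, b, rfl⟩ | ⟨-, hc⟩⟩ := grp_spec _ s hJ hG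
    · simp [isOld] at hno
    · match G, hne, hc, hk with
      | [], hne, _, _ => exact absurd rfl hne
      | [.v x b], _, _, hk => simpa [Sym.isVar] using hk.1
      | [.c a], _, hc, hk =>
        refine (hk.2 fun hs => ?_).trans (by simp)
        simp only [gword, List.flatMap_cons, List.flatMap_nil, asg_c, List.append_nil] at hc hs
        simpa using (self_inverse_chain (fun _ => rfl) bar_bar hc hs).2
      | a :: b :: G, _, _, hk => exact hk.1.trans (by simp)

lemma shrinks_of_large [Finite A] {n0 R D : ℕ} (hs : Solves s W) (hcl : Clean s W)
    (hv : vcount W ≤ n0) (hR : wsize W + 2 * vcount W ≤ R)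
    (hD : ∀ E : Set (((X × Bool → ℕ) × ℕ) × ((X × Bool → ℕ) × ℕ)),
      (∀ e ∈ E, (∀ y, e.1.1 y ≤ R) ∧ e.1.2 ≤ R ∧ (∀ y, e.2.1 y ≤ R) ∧ e.2.2 ≤ R) →
      SolBound E D)
    (hB : R + 4 * (R * D) + 2 ≤ B) (hM : 2 * wsize W + 2 * vcount W < M)
    (hW : 29 * n0 + 2 * Fintype.card (Option (K × Bool)) < wsize W) : Shrinks B s W := by
  by_cases h1 : 2 * vcount W < ∑ k, pcount (cc (relOf _root_.id)) (W k)
  · exact shrinks_of_relOf hs hcl (.inl rfl) hR hD (by omega) hM fun nm =>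
      wsize_compSys_id_lt nm h1
  by_cases h2 : 8 * vcount W < ∑ k, pcount (cc relGood) (W k)
  · exact shrinks_of_relGood hs hcl (by omega) hM h2
  by_cases h3 : 5 * vcount W < ∑ k, tcount (cc (relOf bar)) (W k)
  · exact shrinks_of_relOf hs hcl (.inr rfl) hR hD (by omega) hM fun nm =>
      wsize_compSys_bar_lt nm h3
  have h := Finset.sum_le_sum fun k (_ : k ∈ Finset.univ) => length_le_counts (W k)
  simp only [Finset.sum_add_distrib, ← Finset.mul_sum, Finset.sum_const, Finset.card_univ,
    smul_eq_mul] at h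
  rw [wsize] at hW
  simp only [vcount] at h1 h2 h3 hv
  omega

end Assembly

/-- The solutions of a family of systems of word equations with involution, of bounded
size, form an EDT0L language. -/
theorem isEDT0L_systems {A X K J : Type} [Invol A] [Finite A] [Nonempty A] [Finite X]
    [Fintype K] {S : ℕ} (W0 : J → WSys A X K)
    (hocc : ∀ j k x b, .v x b ∈ W0 j k → ∃ b', .v x b' ∈ W0 j none)
    (hsz : ∀ j, wsize (W0 j) ≤ S) :
    IsEDT0L ({w | ∃ j s, Solves s (W0 j) ∧ (W0 j none).flatMap (asg s) = w} : Language A) := by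
  classical
  have := Fintype.ofFinite X
  let T := Fintype.card (Option (K × Bool))
  let N' := 29 * S + 2 * T
  let R := N' + S + 2 * S
  obtain ⟨D, hD⟩ := exists_uniform_solBound (X × Bool) R
  have hemb : ∀ j k, (embSys (2 * (N' + S) + 2 * S + 1) (W0 j) k).length ≤ (W0 j k).length := by
    intro j k
    rw [embSys]
    induction W0 j k with
    | nil => simp
    | cons a w ih =>
      rw [List.flatMap_cons, List.length_append, List.length_cons]
      rcases a with a | ⟨x, _ | _⟩ <;> simp [liftSub] at ih ⊢ <;> omega
  have hw : ∀ j, wsize (embSys (2 * (N' + S) + 2 * S + 1) (W0 j)) ≤ S := fun j =>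
    (Finset.sum_le_sum fun k _ => hemb j k).trans (hsz j)
  have hv : ∀ j, vcount (embSys (2 * (N' + S) + 2 * S + 1) (W0 j)) ≤ S := fun j =>
    (Finset.sum_le_sum fun k _ => List.countP_le_length).trans (hw j)
  refine isEDT0L_of_rounds (N := N' + S) (n0 := S) (N' := N')
    (M := 2 * (N' + S) + 2 * S + 1) (B := R + 4 * (R * D) + 2) le_rfl (by omega) (by omega)
    (fun W s hs hcl hN hW hv => ?_) W0 hocc (fun j => (hw j).trans (by omega)) hv
  exact shrinks_of_large hs hcl hv (by omega) hD le_rfl (by omega) hW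

end

section

/-! ### Deterministic transductions of EDT0L languages -/

section Transducer

variable {α β Q : Type}

/-- The output of a sequential transducer. -/
def tout (δ : Q → α → Q) (out : Q → α → List β) : Q → List α → List β
  | _, [] => []
  | q, a :: u => out q a ++ tout δ out (δ q a) u

/-- Annotate the letters of a word by the states reached before them. -/
def ann {C : Type} (r : C → Q → Q) : Q → List C → List (Option ((Q × C) ⊕ β))
  | _, [] => []
  | q, c :: w => some (.inl (q, c)) :: ann r (r c q) w

lemma ann_append {C : Type} (r : C → Q → Q) (q : Q) (u v : List C) :
    ann (β := β) r q (u ++ v) = ann r q u ++ ann r (u.foldl (fun q c => r c q) q) v := by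
  induction u generalizing q with
  | nil => rfl
  | cons a u ih => simp [ann, ih]

/-- The substitutions simulating a transducer. -/
def transTab (S : EDT0LSystem α) (out : Q → α → List β) (q0 : Q) :
    Option (Option S.ι × (S.C → Q → Q)) → Option ((Q × S.C) ⊕ β) →
      List (Option ((Q × S.C) ⊕ β))
  | none, some (.inl (q, c)) => match S.term c with
    | some a => (out q a).map fun b => some (.inr b)
    | none => [none]
  | some (some i, r), some (.inl (q, c)) => ann r q (S.tab i c)
  | some (none, r), none => ann r q0 S.start
  | _, c => [c]

/-- The transition maps after a substitution has been undone. -/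
def pullMap {C : Type} (φ : C → List C) (r : C → Q → Q) (c : C) (q : Q) : Q :=
  (φ c).foldl (fun q c => r c q) q

lemma foldl_flatMap_pullMap {C : Type} (φ : C → List C) (r : C → Q → Q) (w : List C) (q : Q) :
    (w.flatMap φ).foldl (fun q c => r c q) q = w.foldl (fun q c => pullMap φ r c q) q := by
  induction w generalizing q with
  | nil => rfl
  | cons c w ih => simp [ih, pullMap]

lemma ann_flatMap (S : EDT0LSystem α) (out : Q → α → List β) (q0 : Q) (i : S.ι)
    (r : S.C → Q → Q) (w : List S.C) (q : Q) :
    (ann (pullMap (S.tab i) r) q w).flatMap (transTab S out q0 (some (some i, r))) =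
      ann r q (w.flatMap (S.tab i)) := by
  induction w generalizing q with
  | nil => rfl
  | cons c w ih =>
    rw [ann, List.flatMap_cons, ih, List.flatMap_cons, ann_append]
    rfl

/-- The steps of the graph simulating a transducer. -/
inductive TransStep (S : EDT0LSystem α) {σ : Type} (d : DFA S.ι σ) (δ : Q → α → Q) (q0 : Q)
    (acc : Q → Prop) : Option (Option (σ × (S.C → Q → Q))) →
      Option (Option S.ι × (S.C → Q → Q)) → Option (Option (σ × (S.C → Q → Q))) → Prop
  | final : TransStep S d δ q0 acc none none
      (some (some (d.start, fun c q => ((S.term c).map (δ q)).getD q)))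
  | mid (t : σ) (r : S.C → Q → Q) (i : S.ι) : TransStep S d δ q0 acc (some (some (t, r)))
      (some (some i, r)) (some (some (d.step t i, pullMap (S.tab i) r)))
  | init (t : σ) (r : S.C → Q → Q) : t ∈ d.accept →
      acc (S.start.foldl (fun q c => r c q) q0) →
      TransStep S d δ q0 acc (some (some (t, r))) (some (none, r)) (some none)

variable {S : EDT0LSystem α} {σ : Type} {d : DFA S.ι σ} {δ : Q → α → Q}
  {out : Q → α → List β} {q0 : Q} {acc : Q → Prop}

lemma exists_of_transPath {t : σ} {r : S.C → Q → Q}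
    {ls : List (Option (Option S.ι × (S.C → Q → Q)))}
    (h : GraphPath (TransStep S d δ q0 acc) (· = some none) (some (some (t, r))) ls) :
    ∃ φs : List S.ι, d.evalFrom t φs ∈ d.accept ∧
      acc ((foldSub (φs.map S.tab) S.start).foldl (fun q c => r c q) q0) ∧
      foldSub (ls.map (transTab S out q0)) [none] =
        ann r q0 (foldSub (φs.map S.tab) S.start) := by
  induction ls generalizing t r with
  | nil => cases h with | nil h => cases h
  | cons l ls ih =>
    cases h with | cons h1 h2 => ?_
    cases h1 with
    | mid _ _ i =>
      obtain ⟨φs, h3, h4, h5⟩ := ih h2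
      refine ⟨i :: φs, h3, ?_, ?_⟩
      · rwa [List.map_cons, foldSub_cons, foldl_flatMap_pullMap]
      · rw [List.map_cons, foldSub_cons, h5, List.map_cons, foldSub_cons, ann_flatMap]
    | init _ _ ht ha =>
      cases ls with
      | nil => exact ⟨[], ht, ha, by simp [transTab]⟩
      | cons l ls => cases h2 with | cons h1 _ => cases h1

lemma exists_transPath (φs : List S.ι) {t : σ} {r : S.C → Q → Q}
    (h1 : d.evalFrom t φs ∈ d.accept)
    (h2 : acc ((foldSub (φs.map S.tab) S.start).foldl (fun q c => r c q) q0)) :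
    ∃ ls, GraphPath (TransStep S d δ q0 acc) (· = some none) (some (some (t, r))) ls ∧
      foldSub (ls.map (transTab S out q0)) [none] =
        ann r q0 (foldSub (φs.map S.tab) S.start) := by
  induction φs generalizing t r with
  | nil => exact ⟨[some (none, r)], .cons (.init t r h1 h2) (.nil rfl), by simp [transTab]⟩
  | cons i φs ih =>
    rw [List.map_cons, foldSub_cons, foldl_flatMap_pullMap] at h2
    obtain ⟨ls, h3, h4⟩ := ih (t := d.step t i) h1 h2
    refine ⟨some (some i, r) :: ls, .cons (.mid t r i) h3, ?_⟩
    rw [List.map_cons, foldSub_cons, h4, List.map_cons, foldSub_cons, ann_flatMap]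

/-- The terminal letters of the simulating system. -/
def transTerm {C : Type} : Option ((Q × C) ⊕ β) → Option β
  | some (.inr b) => some b
  | _ => none

lemma term_ann {w : List S.C} {v : List β} {q : Q} :
    ((ann (fun c q => ((S.term c).map (δ q)).getD q) q w).flatMap
      (transTab S out q0 none)).map transTerm = v.map some ↔
    ∃ u, w.map S.term = u.map some ∧ tout δ out q u = v := by
  induction w generalizing q v with
  | nil =>
    simp only [ann, List.flatMap_nil, List.map_nil]
    constructor
    · intro h; exact ⟨[], rfl, (List.map_eq_nil_iff.1 h.symm).symm⟩
    · rintro ⟨u, hu, rfl⟩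
      rw [eq_comm, List.map_eq_nil_iff] at hu
      simp [hu, tout]
  | cons c w ih =>
    rw [ann, List.flatMap_cons, List.map_append]
    rcases hc : S.term c with _ | a
    · have : (transTab S out q0 none (some (Sum.inl (q, c)))) = [none] := by
        simp [transTab, hc]
      rw [this]
      constructor
      · intro h; cases v <;> simp [transTerm] at h
      · rintro ⟨u, hu, -⟩
        cases u <;> simp [hc] at hu
    · have : (transTab S out q0 none (some (Sum.inl (q, c)))) =
          (out q a).map fun b => some (.inr b) := by
        simp [transTab, hc]
      rw [this, List.map_map]
      have hid : List.map (transTerm ∘ fun b => (some (.inr b) : Option ((Q × S.C) ⊕ β)))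
          (out q a) = (out q a).map some := rfl
      rw [hid]
      constructor
      · intro h
        obtain ⟨v1, v2, rfl, h1, h2⟩ := List.append_eq_map_iff.1 h
        obtain ⟨u, hu, rfl⟩ := ih.1 h2.symm
        refine ⟨a :: u, by simp [hc, hu], ?_⟩
        rw [tout, List.map_injective_iff.2 (Option.some_injective _) h1]
        rfl
      · rintro ⟨u, hu, rfl⟩
        rcases u with _ | ⟨b, u⟩
        · simp at hu
        · simp only [List.map_cons, hc, List.cons.injEq, Option.some.injEq] at hu
          obtain ⟨rfl, hu⟩ := hu
          rw [tout, List.map_append]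
          congr 1
          exact ih.2 ⟨u, hu, rfl⟩

lemma foldl_term {w : List S.C} {u : List α} (h : w.map S.term = u.map some) (q : Q) :
    w.foldl (fun q c => ((S.term c).map (δ q)).getD q) q = u.foldl δ q := by
  induction w generalizing q u with
  | nil => cases u <;> simp_all
  | cons c w ih =>
    rcases u with _ | ⟨a, u⟩
    · simp at h
    · simp only [List.map_cons, List.cons.injEq] at h
      simp only [List.foldl_cons, h.1, Option.map_some, Option.getD_some]
      exact ih h.2 _

/-- EDT0L languages are closed under deterministic sequential transductions. -/
theorem IsEDT0L.transduce [Finite Q] [Finite β] {L : Language α} (hL : IsEDT0L L)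
    (δ : Q → α → Q) (out : Q → α → List β) (q0 : Q) (acc : Q → Prop) :
    IsEDT0L ({v | ∃ u ∈ L, acc (u.foldl δ q0) ∧ tout δ out q0 u = v} : Language β) := by
  obtain ⟨S, rfl⟩ := hL
  obtain ⟨σ, _, d, hd⟩ := S.control_reg.reverse
  have := S.finC
  have := S.finι
  refine isEDT0L_of_graph (Φ := Option (Option S.ι × (S.C → Q → Q))) transTerm ?_
    (transTab S out q0) [none] (TransStep S d δ q0 acc) (· = none) (· = some none) _ ?_
  · rintro (_ | c | b) (_ | c' | b') a h h' <;> simp_all [transTerm]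
  · have happ : ∀ φs : List S.ι, S.apply φs.reverse S.start =
        foldSub (φs.map S.tab) S.start := by
      intro φs
      simp only [EDT0LSystem.apply, List.foldl_reverse, foldSub, List.foldr_map, subApply_eq]
    have hmem : ∀ φs : List S.ι, d.evalFrom d.start φs ∈ d.accept ↔ φs.reverse ∈ S.control := by
      intro φs
      rw [← Language.mem_reverse, ← hd]; rfl
    intro v
    constructor
    · rintro ⟨u, ⟨φs, h1, h2⟩, h3, h4⟩
      rw [← List.reverse_reverse φs] at h1 h2
      rw [happ] at h2
      obtain ⟨ls, h5, h6⟩ := exists_transPath (out := out) (δ := δ) (acc := acc) (q0 := q0)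
        φs.reverse (t := d.start) (r := fun c q => ((S.term c).map (δ q)).getD q)
        ((hmem _).2 h1) (by rwa [foldl_term h2])
      refine ⟨none, none :: ls, rfl, .cons .final h5, ?_⟩
      rw [List.map_cons, foldSub_cons, h6, term_ann]
      exact ⟨u, h2, h4⟩
    · rintro ⟨_, ls, rfl, h1, h2⟩
      cases ls with
      | nil => cases h1 with | nil h => cases h
      | cons l ls =>
        cases h1 with | cons h3 h4 => ?_
        cases h3
        obtain ⟨φs, h5, h6, h7⟩ := exists_of_transPath (out := out) h4
        rw [List.map_cons, foldSub_cons, h7, term_ann] at h2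
        obtain ⟨u, hu, rfl⟩ := h2
        rw [foldl_term hu] at h6
        exact ⟨u, ⟨φs.reverse, (hmem _).1 h5, by rwa [happ]⟩, h6, rfl⟩

end Transducer

end

section

open Monoid

/-! ### Normal forms in free products -/

section FreeProduct

variable {I : Type} {M : I → Type} [∀ i, Group (M i)]

/-- The value of a word over the factors of a free product. -/
def lval (l : List (Σ i, M i)) : CoprodI M := (l.map fun x => CoprodI.of x.2).prod

/-- The formal inverse of a word. -/
def linv (l : List (Σ i, M i)) : List (Σ i, M i) := (l.map fun x => ⟨x.1, x.2⁻¹⟩).reverse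

@[simp] lemma lval_nil : lval ([] : List (Σ i, M i)) = 1 := rfl

@[simp] lemma lval_cons (x : Σ i, M i) (l : List (Σ i, M i)) :
    lval (x :: l) = CoprodI.of x.2 * lval l := by
  simp [lval]

@[simp] lemma lval_append (u v : List (Σ i, M i)) : lval (u ++ v) = lval u * lval v := by
  simp [lval]

@[simp] lemma lval_linv (u : List (Σ i, M i)) : lval (linv u) = (lval u)⁻¹ := by
  rw [lval, lval, linv, List.prod_inv_reverse, List.map_reverse, List.map_map, List.map_map]
  congr 2

lemma linv_concat (u : List (Σ i, M i)) (x : Σ i, M i) :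
    linv (u ++ [x]) = ⟨x.1, x.2⁻¹⟩ :: linv u := by
  simp [linv]

/-- Reduced words over the factors of a free product. -/
def Red (l : List (Σ i, M i)) : Prop := (∀ x ∈ l, x.2 ≠ 1) ∧ l.IsChain fun x y => x.1 ≠ y.1

lemma Red.append {u v : List (Σ i, M i)} (hu : Red u) (hv : Red v)
    (h : ∀ x ∈ u.getLast?, ∀ y ∈ v.head?, x.1 ≠ y.1) : Red (u ++ v) :=
  ⟨fun x hx => (List.mem_append.1 hx).elim (hu.1 x) (hv.1 x),
    List.isChain_append.2 ⟨hu.2, hv.2, h⟩⟩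

lemma Red.left {u v : List (Σ i, M i)} (h : Red (u ++ v)) : Red u :=
  ⟨fun x hx => h.1 x (List.mem_append_left _ hx), (List.isChain_append.1 h.2).1⟩

lemma Red.right {u v : List (Σ i, M i)} (h : Red (u ++ v)) : Red v :=
  ⟨fun x hx => h.1 x (List.mem_append_right _ hx), (List.isChain_append.1 h.2).2.1⟩

/-- The middle parts of the sides of a triangle. -/
inductive Tri : List (Σ i, M i) → List (Σ i, M i) → List (Σ i, M i) → Prop
  | nil : Tri [] [] []
  | letter (i : I) (a b : M i) : Tri [⟨i, a⟩] [⟨i, b⟩] [⟨i, a * b⟩]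

lemma Tri.lval {α β γ : List (Σ i, M i)} (h : Tri α β γ) : lval α * lval β = lval γ := by
  cases h <;> simp

lemma exists_triangle {u v : List (Σ i, M i)} (hu : Red u) (hv : Red v) :
    ∃ p q r α β γ, Tri α β γ ∧ u = p ++ α ++ q ∧ v = linv q ++ β ++ r ∧
      Red (p ++ γ ++ r) := by
  induction u using List.reverseRecOn generalizing v with
  | nil => exact ⟨[], [], v, [], [], [], .nil, rfl, rfl, hv⟩
  | append_singleton u x ih =>
    rcases v with _ | ⟨y, v⟩
    · exact ⟨u ++ [x], [], [], [], [], [], .nil, by simp, rfl, by simpa using hu⟩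
    by_cases hxy : x.1 = y.1
    · obtain ⟨i, a⟩ := x
      obtain ⟨j, b⟩ := y
      obtain rfl : i = j := hxy
      by_cases hab : a * b = 1
      · obtain ⟨p, q, r, α, β, γ, hT, rfl, rfl, hr⟩ := ih hu.left (v := v)
          (Red.right (u := [⟨i, b⟩]) hv)
        refine ⟨p, q ++ [⟨i, a⟩], r, α, β, γ, hT, by simp, ?_, hr⟩
        rw [linv_concat, eq_inv_of_mul_eq_one_right hab]
        rfl
      · refine ⟨u, [], v, _, _, _, .letter i a b, by simp, rfl, ?_⟩
        have h1 := hu.2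
        have h2 := hv.2
        rw [List.isChain_append] at h1
        rw [List.isChain_cons] at h2
        refine Red.append (Red.append hu.left ⟨by simpa using hab, by simp⟩ ?_)
          (Red.right (u := [⟨i, b⟩]) hv) ?_
        · simpa using h1.2.2
        · simpa using h2.1
    · refine ⟨u ++ [x], [], y :: v, [], [], [], .nil, by simp, rfl, ?_⟩
      rw [List.append_nil]
      exact hu.append hv (by simpa using hxy)

open Classical in
/-- The reduced word representing an element of a free product. -/
noncomputable def nf (g : CoprodI M) : List (Σ i, M i) := (CoprodI.Word.equiv g).toList

lemma red_nf (g : CoprodI M) : Red (nf g) := by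
  classical
  exact ⟨(CoprodI.Word.equiv g).ne_one, (CoprodI.Word.equiv g).chain_ne⟩

@[simp] lemma lval_nf (g : CoprodI M) : lval (nf g) = g := by
  classical
  exact CoprodI.Word.equiv.symm_apply_apply g

lemma nf_lval {u : List (Σ i, M i)} (h : Red u) : nf (lval u) = u := by
  classical
  let w : CoprodI.Word M := ⟨u, h.1, h.2⟩
  change (CoprodI.Word.equiv (CoprodI.Word.equiv.symm w)).toList = u
  rw [Equiv.apply_symm_apply]

lemma length_nf_mul_le (g h : CoprodI M) : (nf (g * h)).length ≤ (nf g).length + (nf h).length := by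
  obtain ⟨p, q, r, α, β, γ, hT, h1, h2, h3⟩ := exists_triangle (red_nf g) (red_nf h)
  have h4 : nf (g * h) = p ++ γ ++ r := by
    rw [← nf_lval h3]
    congr 1
    rw [← lval_nf g, ← lval_nf h, h1, h2]
    simp [mul_assoc, ← hT.lval]
  rw [h4, h1, h2]
  cases hT <;> simp <;> omega

end FreeProduct

end

section

open Invol (bar bar_bar bar_ne)

/-! ### Encoding words by words over an alphabet with involution without fixed points -/

section Encoding

variable {I : Type} {M : I → Type} [∀ i, Group (M i)]

/-- Marked letters and markers. -/
inductive Enc {I : Type} (M : I → Type)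
  | l : (Σ i, M i) → Bool → Enc M
  | mk : Bool → Enc M

instance : Invol (Enc M) where
  bar
    | .l x b => .l ⟨x.1, x.2⁻¹⟩ !b
    | .mk b => .mk !b
  bar_bar c := by cases c <;> simp
  bar_ne c := by cases c <;> simp

instance : Nonempty (Enc M) := ⟨.mk true⟩

instance [Finite I] [∀ i, Finite (M i)] : Finite (Enc M) := by
  refine Finite.of_injective (β := ((Σ i, M i) × Bool) ⊕ Bool)
    (fun c => match c with | .l x b => .inl (x, b) | .mk b => .inr b) ?_
  rintro (⟨x, b⟩ | b) (⟨y, c⟩ | c) h <;> simp_all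

/-- The encoding of words. -/
def encW (u : List (Σ i, M i)) : List (Enc M) := u.flatMap fun x => [.l x false, .l x true]

@[simp] lemma encW_nil : encW ([] : List (Σ i, M i)) = [] := rfl

@[simp] lemma encW_cons (x : Σ i, M i) (u : List (Σ i, M i)) :
    encW (x :: u) = .l x false :: .l x true :: encW u := rfl

@[simp] lemma encW_append (u v : List (Σ i, M i)) : encW (u ++ v) = encW u ++ encW v := by
  simp [encW]

lemma lbar_encW (u : List (Σ i, M i)) : lbar (encW u) = encW (linv u) := by
  induction u with
  | nil => rfl
  | cons x u ih =>
    have : linv (x :: u) = linv u ++ [⟨x.1, x.2⁻¹⟩] := by simp [linv]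
    rw [this, encW_append, ← ih, encW_cons]
    simp only [lbar_cons, List.append_assoc]
    rfl

lemma encW_injective : Function.Injective (encW : List (Σ i, M i) → List (Enc M)) := by
  intro u v h
  induction u generalizing v with
  | nil => cases v <;> simp_all
  | cons x u ih =>
    cases v with
    | nil => simp at h
    | cons y v =>
      simp only [encW_cons, List.cons.injEq, Enc.l.injEq, and_true] at h
      rw [h.1, ih h.2.2]

lemma mk_notMem_encW (b : Bool) (u : List (Σ i, M i)) : Enc.mk b ∉ encW u := by
  simp [encW]

/-- The output word listing the given words. -/
def blocks {γ : Type} (us : List (List γ)) : List (γ ⊕ Unit) :=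
  us.flatMap fun u => u.map Sum.inl ++ [.inr ()]

/-- The list of encoded words. -/
def encBlocks (us : List (List (Σ i, M i))) : List (Enc M) :=
  us.flatMap fun u => encW u ++ [.mk true]

variable (M) in
/-- States of the decoding transducer. -/
abbrev DecState (N : ℕ) : Type := Option (Fin (N + 1) × Option (Σ i, M i))

open Classical in
/-- Transitions of the decoding transducer. -/
noncomputable def decStep (N : ℕ) : DecState M N → Enc M → DecState M N
  | some (k, none), .l x false => if k = 0 then none else some (k, some x)
  | some (k, some x), .l y true => if x = y then some (k, none) else none
  | some (k, none), .mk true => if k = 0 then none else some (k - 1, none)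
  | _, _ => none

/-- Outputs of the decoding transducer, which erases the last `e` blocks. -/
def decOut (N e : ℕ) : DecState M N → Enc M → List ((Σ i, M i) ⊕ Unit)
  | some (k, none), .l x false => if e < k.1 then [.inl x] else []
  | some (k, none), .mk true => if e < k.1 then [.inr ()] else []
  | _, _ => []

lemma foldl_decStep_none (N : ℕ) (w : List (Enc M)) : w.foldl (decStep N) none = none := by
  induction w with
  | nil => rfl
  | cons c w ih => exact ih

lemma decode_encW (N e : ℕ) {k : Fin (N + 1)} (hk : k ≠ 0) (u : List (Σ i, M i))
    (w : List (Enc M)) :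
    (encW u ++ w).foldl (decStep N) (some (k, none)) = w.foldl (decStep N) (some (k, none)) ∧
    tout (decStep N) (decOut N e) (some (k, none)) (encW u ++ w) =
      (if e < k.1 then u.map Sum.inl else []) ++
        tout (decStep N) (decOut N e) (some (k, none)) w := by
  induction u with
  | nil => simp
  | cons x u ih =>
    simp only [encW_cons, List.cons_append, List.foldl_cons, decStep, hk, if_false, if_true,
      tout, ih.1, ih.2, decOut, true_and]
    split_ifs <;> simp

lemma decode_encBlocks (N e : ℕ) (us : List (List (Σ i, M i))) {k : Fin (N + 1)}
    (hk : us.length = k.1) :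
    (encBlocks us).foldl (decStep N) (some (k, none)) = some (0, none) ∧
    tout (decStep N) (decOut N e) (some (k, none)) (encBlocks us) =
      blocks (us.take (k.1 - e)) := by
  induction us generalizing k with
  | nil =>
    have : k = 0 := Fin.ext hk.symm
    simp [encBlocks, blocks, tout, this]
  | cons u us ih =>
    have h0 : k ≠ 0 := by rintro rfl; simp at hk
    have hk1 : us.length = (k - 1).1 := by
      rw [Fin.val_sub_one_of_ne_zero h0, ← hk]; simp
    obtain ⟨h1, h2⟩ := decode_encW N e h0 u (Enc.mk true :: encBlocks us)
    have h3 : encBlocks (u :: us) = encW u ++ (Enc.mk true :: encBlocks us) := by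
      simp [encBlocks]
    rw [h3, h1, h2]
    simp only [List.foldl_cons, tout, decStep, if_neg h0, (ih hk1).1, (ih hk1).2, decOut, true_and]
    rw [Fin.val_sub_one_of_ne_zero h0]
    split_ifs with h
    · obtain ⟨j, hj⟩ : ∃ j, k.1 - e = j + 1 := ⟨k.1 - e - 1, by omega⟩
      have : k.1 - 1 - e = j := by omega
      rw [this, hj, List.take_succ_cons]
      simp [blocks]
    · have : k.1 - e = 0 := by omega
      have h' : k.1 - 1 - e = 0 := by omega
      rw [this, h']
      simp [blocks]

lemma exists_encBlocks (N : ℕ) : ∀ (w : List (Enc M)) (k : Fin (N + 1)),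
    w.foldl (decStep N) (some (k, none)) = some (0, none) →
    ∃ us : List (List (Σ i, M i)), us.length = k.1 ∧ w = encBlocks us
  | [], k, h => by
    simp only [List.foldl_nil, Option.some.injEq, Prod.mk.injEq, and_true] at h
    exact ⟨[], by simp [h], rfl⟩
  | .mk false :: w, k, h => by
    rw [List.foldl_cons, decStep, foldl_decStep_none] at h <;> simp_all
  | .l x true :: w, k, h => by
    rw [List.foldl_cons, decStep, foldl_decStep_none] at h <;> simp_all
  | [.l x false], k, h => by
    rw [List.foldl_cons, decStep] at h
    split_ifs at h
    · simp at h
    · simp at h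
  | .l x false :: .l y false :: w, k, h => by
    rw [List.foldl_cons, decStep] at h
    split_ifs at h
    · rw [foldl_decStep_none] at h; simp at h
    · rw [List.foldl_cons, decStep, foldl_decStep_none] at h <;> simp_all
  | .l x false :: .mk b :: w, k, h => by
    rw [List.foldl_cons, decStep] at h
    split_ifs at h
    · rw [foldl_decStep_none] at h; simp at h
    · rw [List.foldl_cons, decStep, foldl_decStep_none] at h <;> simp_all
  | .mk true :: w, k, h => by
    rw [List.foldl_cons, decStep] at h
    split_ifs at h with hk
    · rw [foldl_decStep_none] at h; simp at h
    · obtain ⟨us, h1, rfl⟩ := exists_encBlocks N w _ h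
      refine ⟨[] :: us, ?_, by simp [encBlocks]⟩
      rw [List.length_cons, h1, Fin.val_sub_one_of_ne_zero hk]
      have : k.1 ≠ 0 := fun h => hk (Fin.ext h)
      omega
  | .l x false :: .l y true :: w, k, h => by
    rw [List.foldl_cons, decStep] at h
    split_ifs at h with hk
    · rw [foldl_decStep_none] at h; simp at h
    · rw [List.foldl_cons, decStep] at h
      split_ifs at h with hxy
      · obtain ⟨us, h1, rfl⟩ := exists_encBlocks N w _ h
        subst hxy
        rcases us with _ | ⟨u, us⟩
        · exact absurd (Fin.ext h1.symm) hk
        · exact ⟨(x :: u) :: us, h1, by simp [encBlocks]⟩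
      · rw [foldl_decStep_none] at h; simp at h

lemma blocks_inj {γ : Type} {m : γ} : ∀ {us vs : List (List γ)}, us.length = vs.length →
    (∀ v ∈ vs, m ∉ v) → us.flatMap (· ++ [m]) = vs.flatMap (· ++ [m]) → us = vs := by
  classical
  intro us vs hl hv h
  have hcount : ∀ ws : List (List γ), (ws.flatMap (· ++ [m])).count m =
      ws.length + (ws.map (List.count m)).sum := by
    intro ws
    induction ws with
    | nil => rfl
    | cons w ws ih => simp [ih]; omega
  have h0 : (vs.map (List.count m)).sum = 0 := by
    simp only [List.sum_eq_zero_iff, List.mem_map]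
    rintro _ ⟨v, hv', rfl⟩
    exact List.count_eq_zero.2 (hv v hv')
  have h1 := hcount us
  rw [h, hcount, h0, hl] at h1
  have hu : ∀ u ∈ us, m ∉ u := by
    intro u hu
    have : (us.map (List.count m)).sum = 0 := by omega
    rw [List.sum_eq_zero_iff] at this
    exact List.count_eq_zero.1 (this _ (List.mem_map.2 ⟨u, hu, rfl⟩))
  clear h1 h0 hcount
  induction us generalizing vs with
  | nil => exact (List.eq_nil_of_length_eq_zero hl.symm).symm
  | cons u us ih =>
    rcases vs with _ | ⟨v, vs⟩
    · simp at hl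
    · simp only [List.flatMap_cons, List.append_assoc, List.singleton_append] at h
      have hlen : u.length = v.length := by
        have h1 := congrArg (List.idxOf m) h
        rwa [List.idxOf_append_of_notMem (hu u (by simp)),
          List.idxOf_append_of_notMem (hv v (by simp)), List.idxOf_cons_self,
          List.idxOf_cons_self] at h1
      obtain ⟨rfl, h2⟩ := List.append_inj h hlen
      rw [ih (by simpa using hl) (fun v hv' => hv v (by simp [hv'])) (List.cons.inj h2).2
        fun u hu' => hu u (by simp [hu'])]

end Encoding

end

section

open Invol (bar bar_bar bar_ne)
open Monoid

/-! ### Equations in free products of finite groups -/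

/-- Solutions of a triangular system of equations: products `x y = z` of variables and values
of variables are prescribed. -/
def TriSat {G K D Z : Type*} [Mul G] (a b c : K → Z) (zc : D → Z) (gc : D → G) (f : Z → G) : Prop :=
  (∀ k, f (a k) * f (b k) = f (c k)) ∧ ∀ d, f (zc d) = gc d

section Triangular

variable {I : Type} {M : I → Type} [∀ i, Group (M i)]

/-- The middle parts of the sides of a triangle. -/
def triMid : Option (Σ i, M i × M i) → Fin 3 → List (Σ i, M i)
  | none, _ => []
  | some ⟨i, a, _⟩, 0 => [⟨i, a⟩]
  | some ⟨i, _, b⟩, 1 => [⟨i, b⟩]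
  | some ⟨i, a, b⟩, 2 => [⟨i, a * b⟩]

lemma lval_triMid (t : Option (Σ i, M i × M i)) :
    lval (triMid t 0) * lval (triMid t 1) = lval (triMid t 2) := by
  rcases t with _ | ⟨i, a, b⟩ <;> simp [triMid]

lemma Tri.exists_eq {α β γ : List (Σ i, M i)} (h : Tri α β γ) :
    ∃ t, α = triMid t 0 ∧ β = triMid t 1 ∧ γ = triMid t 2 := by
  cases h with
  | nil => exact ⟨none, rfl, rfl, rfl⟩
  | letter i a b => exact ⟨some ⟨i, a, b⟩, rfl, rfl, rfl⟩

variable {K D Z : Type} (a b c : K → Z) (zc : D → Z) (gc : D → CoprodI M)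

/-- The word equations describing the solutions of a triangular system. -/
noncomputable def triSys (xs : List (Z ⊕ K × Fin 3)) (j : K → Option (Σ i, M i × M i)) :
    WSys (Enc M) (Z ⊕ K × Fin 3) (K × Fin 3 ⊕ D)
  | none => xs.flatMap fun x => [.v x true, .c (.mk true)]
  | some (.inl (k, 0), true) => [.v (.inl (a k)) true]
  | some (.inl (k, 0), false) =>
    .v (.inr (k, 0)) true :: (encW (triMid (j k) 0)).map .c ++ [.v (.inr (k, 1)) true]
  | some (.inl (k, 1), true) => [.v (.inl (b k)) true]
  | some (.inl (k, 1), false) =>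
    .v (.inr (k, 1)) false :: (encW (triMid (j k) 1)).map .c ++ [.v (.inr (k, 2)) true]
  | some (.inl (k, 2), true) => [.v (.inl (c k)) true]
  | some (.inl (k, 2), false) =>
    .v (.inr (k, 0)) true :: (encW (triMid (j k) 2)).map .c ++ [.v (.inr (k, 2)) true]
  | some (.inr d, true) => [.v (.inl (zc d)) true]
  | some (.inr d, false) => (encW (nf (gc d))).map .c

variable {a b c zc gc} {xs : List (Z ⊕ K × Fin 3)} {j : K → Option (Σ i, M i × M i)}

lemma triSys_none (s : Z ⊕ K × Fin 3 → List (Enc M)) :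
    (triSys a b c zc gc xs j none).flatMap (asg s) = (xs.map s).flatMap (· ++ [.mk true]) := by
  rw [triSys, List.flatMap_assoc, List.flatMap_map]
  simp

lemma solves_triSys {U : Z ⊕ K × Fin 3 → List (Σ i, M i)} :
    Solves (fun x => encW (U x)) (triSys a b c zc gc xs j) ↔
      (∀ k, U (.inl (a k)) = U (.inr (k, 0)) ++ triMid (j k) 0 ++ U (.inr (k, 1)) ∧
        U (.inl (b k)) = linv (U (.inr (k, 1))) ++ triMid (j k) 1 ++ U (.inr (k, 2)) ∧
        U (.inl (c k)) = U (.inr (k, 0)) ++ triMid (j k) 2 ++ U (.inr (k, 2))) ∧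
      ∀ d, U (.inl (zc d)) = nf (gc d) := by
  have hc : ∀ w : List (Enc M), (w.map Sym.c).flatMap (asg fun x => encW (U x)) = w := by
    intro w
    rw [map_c_flatMap]
    simp
  have e : ∀ {u v : List (Σ i, M i)}, encW u = encW v ↔ u = v := encW_injective.eq_iff
  constructor
  · intro h
    refine ⟨fun k => ⟨?_, ?_, ?_⟩, fun d => ?_⟩
    · simpa [triSys, hc, lbar_encW, ← encW_append, e] using h (.inl (k, 0))
    · simpa [triSys, hc, lbar_encW, ← encW_append, e] using h (.inl (k, 1))
    · simpa [triSys, hc, lbar_encW, ← encW_append, e] using h (.inl (k, 2))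
    · simpa [triSys, hc, lbar_encW, ← encW_append, e] using h (.inr d)
  · rintro ⟨h1, h2⟩ (⟨k, i⟩ | d)
    · fin_cases i
      · simpa [triSys, hc, lbar_encW, ← encW_append, e] using (h1 k).1
      · simpa [triSys, hc, lbar_encW, ← encW_append, e] using (h1 k).2.1
      · simpa [triSys, hc, lbar_encW, ← encW_append, e] using (h1 k).2.2
    · simpa [triSys, hc, lbar_encW, ← encW_append, e] using h2 d

/-- The solutions of a triangular system of equations in a free product of finite groups form
an EDT0L language, up to words which are not reduced. -/
theorem exists_isEDT0L_blocks [Finite I] [∀ i, Finite (M i)] [Finite K] [Finite D] [Finite Z]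
    (zs : List Z) : ∃ L : Language ((Σ i, M i) ⊕ Unit), IsEDT0L L ∧
      (∀ w ∈ L, ∃ u : Z → List (Σ i, M i), TriSat a b c zc gc (lval ∘ u) ∧
        w = blocks (zs.map u)) ∧
      ∀ f, TriSat a b c zc gc f → blocks (zs.map (nf ∘ f)) ∈ L := by
  classical
  have := Fintype.ofFinite K
  have := Fintype.ofFinite D
  have := Fintype.ofFinite Z
  let ys : List (Z ⊕ K × Fin 3) := Finset.univ.toList
  let xs : List (Z ⊕ K × Fin 3) := zs.map .inl ++ ys
  have hxs : ∀ x, x ∈ xs := fun x => by simp [xs, ys]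
  let N := xs.length
  obtain ⟨S, hS⟩ := (Set.finite_range fun j => wsize (triSys a b c zc gc xs j)).bddAbove
  have hE := isEDT0L_systems (triSys a b c zc gc xs) (S := S)
    (fun j k x t _ => ⟨true, List.mem_flatMap.2 ⟨x, hxs x, by simp⟩⟩) fun j => hS ⟨j, rfl⟩
  refine ⟨_, hE.transduce (decStep N) (decOut N ys.length) (some (Fin.last N, none))
    (· = some (0, none)), ?_, ?_⟩
  · rintro _ ⟨_, ⟨j, s, hs, rfl⟩, h1, rfl⟩
    obtain ⟨us, h2, h3⟩ := exists_encBlocks N _ _ h1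
    rw [h3, (decode_encBlocks N _ us h2).2]
    have h4 : xs.map s = us.map encW := by
      refine blocks_inj (m := Enc.mk true) (by simpa using h2.symm) ?_ ?_
      · simp only [List.mem_map]
        rintro _ ⟨u, -, rfl⟩
        exact mk_notMem_encW _ _
      · rw [← triSys_none (a := a) (b := b) (c := c) (zc := zc) (gc := gc) (j := j), h3,
          encBlocks, List.flatMap_map]
    have h5 : ∀ x, ∃ u, s x = encW u := by
      intro x
      have : s x ∈ us.map encW := h4 ▸ List.mem_map.2 ⟨x, hxs x, rfl⟩
      obtain ⟨u, -, hu⟩ := List.mem_map.1 this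
      exact ⟨u, hu.symm⟩
    choose U hU using h5
    obtain rfl : s = fun x => encW (U x) := funext hU
    have h6 : us = xs.map U := by
      have : us.map encW = (xs.map U).map encW := by rw [← h4, List.map_map]; rfl
      exact (List.map_injective_iff.2 encW_injective this)
    obtain ⟨h7, h8⟩ := solves_triSys.1 hs
    refine ⟨fun z => U (.inl z), ⟨fun k => ?_, fun d => ?_⟩, ?_⟩
    · obtain ⟨e1, e2, e3⟩ := h7 k
      simp only [Function.comp_apply, e1, e2, e3, lval_append, lval_linv, ← lval_triMid]
      group
    · simp [h8 d]
    · rw [h6]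
      congr 1
      have : (Fin.last N).1 - ys.length = (zs.map fun z => U (.inl z)).length := by
        simp [N, xs]
      rw [this]
      simp only [xs, List.map_append, List.map_map]
      exact List.take_left
  · rintro f ⟨h1, h2⟩
    have h3 : ∀ k, ∃ p q r t, nf (f (a k)) = p ++ triMid t 0 ++ q ∧
        nf (f (b k)) = linv q ++ triMid t 1 ++ r ∧ nf (f (c k)) = p ++ triMid t 2 ++ r := by
      intro k
      obtain ⟨p, q, r, α, β, γ, hT, e1, e2, e3⟩ :=
        exists_triangle (red_nf (f (a k))) (red_nf (f (b k)))
      obtain ⟨t, rfl, rfl, rfl⟩ := hT.exists_eq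
      refine ⟨p, q, r, t, e1, e2, ?_⟩
      rw [← nf_lval e3, ← h1 k, ← lval_nf (f (a k)), ← lval_nf (f (b k)), e1, e2]
      congr 1
      simp [mul_assoc, ← lval_triMid]
    choose p q r t e using h3
    let U : Z ⊕ K × Fin 3 → List (Σ i, M i) := Sum.elim (fun z => nf (f z))
      fun x => ![p x.1, q x.1, r x.1] x.2
    have hs : Solves (fun x => encW (U x)) (triSys a b c zc gc xs t) :=
      solves_triSys.2 ⟨e, fun d => by simp [U, h2 d]⟩
    have hout : (triSys a b c zc gc xs t none).flatMap (asg fun x => encW (U x)) =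
        encBlocks (xs.map U) := by
      rw [triSys_none, encBlocks, List.flatMap_map, List.flatMap_map]
    have hd := decode_encBlocks N ys.length (xs.map U) (k := Fin.last N) (by simp [N])
    refine ⟨_, ⟨t, _, hs, hout⟩, hd.1, ?_⟩
    rw [hd.2]
    congr 1
    have : (Fin.last N).1 - ys.length = (zs.map (nf ∘ f)).length := by
      simp [N, xs]
    rw [this]
    simp only [xs, List.map_append, List.map_map]
    exact List.take_left

end Triangular

end

section

open Monoid

lemma IsEDT0L.congr {α : Type} {L L' : Language α} (hL : IsEDT0L L) (h : ∀ v, v ∈ L' ↔ v ∈ L) :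
    IsEDT0L L' :=
  (Set.ext h : L' = L) ▸ hL

/-! ### Partial transducers -/

section Partial

variable {α β Q : Type}

/-- The run of a partial deterministic transducer. -/
def prun (step : Q → α → Option (Q × List β)) : Q → List α → Option (Q × List β)
  | q, [] => some (q, [])
  | q, a :: u => (step q a).bind fun x => (prun step x.1 u).map fun y => (y.1, x.2 ++ y.2)

lemma prun_append (step : Q → α → Option (Q × List β)) (q : Q) (u v : List α) :
    prun step q (u ++ v) =
      (prun step q u).bind fun x => (prun step x.1 v).map fun y => (y.1, x.2 ++ y.2) := by
  induction u generalizing q with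
  | nil => simp [prun]
  | cons a u ih =>
    rw [List.cons_append, prun, prun]
    rcases step q a with _ | ⟨q', w⟩
    · rfl
    · simp only [Option.bind_some, ih]
      rcases prun step q' u with _ | ⟨q'', w'⟩
      · rfl
      · rcases h : prun step q'' v with _ | ⟨q3, w3⟩ <;> simp [h]

/-- EDT0L languages are closed under partial deterministic transductions. -/
theorem IsEDT0L.ptransduce [Finite Q] [Finite β] {L : Language α} (hL : IsEDT0L L)
    (step : Q → α → Option (Q × List β)) (q0 : Q) (acc : Q → Prop) :
    IsEDT0L ({v | ∃ u ∈ L, ∃ q, acc q ∧ prun step q0 u = some (q, v)} : Language β) := by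
  let δ : Option Q → α → Option Q := fun o a => o.bind fun q => (step q a).map Prod.fst
  let out : Option Q → α → List β := fun o a => ((o.bind (step · a)).map Prod.snd).getD []
  have hnone : ∀ u : List α, u.foldl δ none = none := by
    intro u
    induction u with
    | nil => rfl
    | cons a u ih => exact ih
  have key : ∀ (u : List α) q q' v, prun step q u = some (q', v) ↔
      u.foldl δ (some q) = some q' ∧ tout δ out (some q) u = v := by
    intro u
    induction u with
    | nil => intro q q' v; simp [prun, tout]
    | cons a u ih =>
      intro q q' v
      rw [prun, List.foldl_cons, tout]
      rcases h : step q a with _ | ⟨q1, w⟩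
      · have h1 : δ (some q) a = none := by simp [δ, h]
        simp [h1, hnone]
      · have h1 : δ (some q) a = some q1 := by simp [δ, h]
        have h2 : out (some q) a = w := by simp [out, h]
        simp only [Option.bind_some, Option.map_eq_some_iff, Prod.exists, Prod.mk.injEq, h1, h2,
          ih]
        constructor
        · rintro ⟨q2, v2, ⟨e1, e2⟩, rfl, rfl⟩
          exact ⟨e1, by rw [e2]⟩
        · rintro ⟨e1, rfl⟩
          exact ⟨_, _, ⟨e1, rfl⟩, rfl, rfl⟩
  refine (hL.transduce δ out (some q0) fun o => ∃ q, o = some q ∧ acc q).congr fun v => ?_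
  constructor
  · rintro ⟨u, hu, q, hq, h⟩
    obtain ⟨h1, h2⟩ := (key _ _ _ _).1 h
    exact ⟨u, hu, ⟨q, h1, hq⟩, h2⟩
  · rintro ⟨u, hu, ⟨q, h1, hq⟩, h2⟩
    exact ⟨u, hu, q, hq, (key _ _ _ _).2 ⟨h1, h2⟩⟩

end Partial

section Reduced

variable {I : Type} {M : I → Type} [∀ i, Group (M i)]

open Classical in
/-- The transducer checking that all blocks are reduced. -/
noncomputable def redStep : Option (Σ i, M i) → (Σ i, M i) ⊕ Unit →
    Option (Option (Σ i, M i) × List ((Σ i, M i) ⊕ Unit))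
  | o, .inl a => if a.2 ≠ 1 ∧ ∀ b ∈ o, b.1 ≠ a.1 then some (some a, [.inl a]) else none
  | _, .inr _ => some (none, [.inr ()])

lemma prun_redStep_map (o : Option (Σ i, M i)) (u : List (Σ i, M i)) :
    (Red u ∧ (∀ b ∈ o, ∀ a ∈ u.head?, b.1 ≠ a.1) → ∃ o',
      prun redStep o (u.map .inl) = some (o', u.map .inl)) ∧
    (¬ (Red u ∧ ∀ b ∈ o, ∀ a ∈ u.head?, b.1 ≠ a.1) → prun redStep o (u.map .inl) = none) := by
  induction u generalizing o with
  | nil => exact ⟨fun _ => ⟨o, rfl⟩, fun h => absurd ⟨⟨by simp, by simp⟩, by simp⟩ h⟩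
  | cons a u ih =>
    have hiff : Red (a :: u) ↔ a.2 ≠ 1 ∧ Red u ∧ ∀ b ∈ u.head?, a.1 ≠ b.1 := by
      simp only [Red, List.mem_cons, forall_eq_or_imp, List.isChain_cons]
      tauto
    rw [hiff, List.map_cons, prun, redStep]
    obtain ⟨h1, h2⟩ := ih (some a)
    constructor
    · rintro ⟨⟨ha, hu, hau⟩, ho⟩
      rw [if_pos ⟨ha, fun b hb => ho b hb a rfl⟩]
      obtain ⟨o', h⟩ := h1 ⟨hu, by simpa using hau⟩
      exact ⟨o', by simp [h]⟩
    · intro h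
      split_ifs with h3
      · rw [Option.bind_some, h2]
        · rfl
        · rintro ⟨h4, h5⟩
          exact h ⟨⟨h3.1, h4, by simpa using h5⟩, by simpa using h3.2⟩
      · rfl

lemma prun_redStep_blocks (us : List (List (Σ i, M i))) (q : Option (Σ i, M i))
    (v : List ((Σ i, M i) ⊕ Unit)) :
    prun redStep none (blocks us) = some (q, v) ↔
      (∀ u ∈ us, Red u) ∧ q = none ∧ v = blocks us := by
  induction us generalizing q v with
  | nil => simp [blocks, prun, eq_comm]
  | cons u us ih =>
    have hb : blocks (u :: us) = u.map .inl ++ (.inr () :: blocks us) := by simp [blocks]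
    rw [hb, prun_append]
    by_cases hu : Red u
    · obtain ⟨o', h⟩ := (prun_redStep_map none u).1 ⟨hu, by simp⟩
      rw [h]
      simp only [Option.bind_some, prun, redStep, Option.map_map, Option.map_eq_some_iff,
        Prod.exists, Function.comp_apply, Prod.mk.injEq, ih, List.mem_cons, forall_eq_or_imp, hu,
        true_and]
      constructor
      · rintro ⟨_, _, ⟨h1, rfl, rfl⟩, rfl, rfl⟩
        exact ⟨h1, rfl, rfl⟩
      · rintro ⟨h1, rfl, rfl⟩
        exact ⟨_, _, ⟨h1, rfl, rfl⟩, rfl, rfl⟩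
    · rw [(prun_redStep_map none u).2 fun h => hu h.1]
      simp [hu]

/-- The language of the solutions of a triangular system of equations in a free product of
finite groups, written as reduced words, is EDT0L. -/
theorem isEDT0L_triSat [Finite I] [∀ i, Finite (M i)] {K D Z : Type} [Finite K] [Finite D]
    [Finite Z] (a b c : K → Z) (zc : D → Z) (gc : D → CoprodI M) (zs : List Z) :
    IsEDT0L ({w | ∃ f, TriSat a b c zc gc f ∧ blocks (zs.map (nf ∘ f)) = w} :
      Language ((Σ i, M i) ⊕ Unit)) := by
  obtain ⟨L, hL, h1, h2⟩ := exists_isEDT0L_blocks (a := a) (b := b) (c := c) (zc := zc)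
    (gc := gc) zs
  refine (hL.ptransduce redStep none fun _ => True).congr fun w => ?_
  constructor
  · rintro ⟨f, hf, rfl⟩
    refine ⟨_, h2 f hf, none, trivial, (prun_redStep_blocks _ _ _).2 ⟨?_, rfl, rfl⟩⟩
    simp only [List.mem_map]
    rintro _ ⟨z, -, rfl⟩
    exact red_nf _
  · rintro ⟨v, hv, q, -, h⟩
    obtain ⟨u, hu, rfl⟩ := h1 v hv
    obtain ⟨h3, -, rfl⟩ := (prun_redStep_blocks _ _ _).1 h
    refine ⟨_, hu, ?_⟩
    congr 1
    refine List.map_congr_left fun z hz => nf_lval (h3 _ (List.mem_map.2 ⟨z, hz, rfl⟩))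

end Reduced

/-! ### Reduction of systems of equations to triangular systems -/

section Reduction

variable {G : Type} [Group G] {p : ℕ}

/-- The evaluation of an equation. -/
def evalEq (g : Fin p → G) : Coprod G (FreeGroup (Fin p)) →* G :=
  Coprod.lift (MonoidHom.id G) (FreeGroup.lift g)

/-- Maps which are multiplicative on a set and extend the coefficient map. -/
def Partly {H : Type} [Group H] (θ : G →* H) (S : Set (Coprod G (FreeGroup (Fin p))))
    (f : Coprod G (FreeGroup (Fin p)) → H) : Prop :=
  (∀ u ∈ S, ∀ v ∈ S, u * v ∈ S → f u * f v = f (u * v)) ∧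
    ∀ γ : G, Coprod.inl γ ∈ S → f (Coprod.inl γ) = θ γ

variable {H : Type} [Group H] (θ : G →* H)

lemma exists_determining (e : Coprod G (FreeGroup (Fin p))) :
    ∃ S0 : Set (Coprod G (FreeGroup (Fin p))), S0.Finite ∧ e ∈ S0 ∧
      ∀ S, S0 ⊆ S → ∀ f, Partly θ S f → ∀ g : Fin p → G,
        (∀ i, f (Coprod.inr (.of i)) = θ (g i)) → f e = θ (evalEq g e) := by
  have hmul : ∀ x y : Coprod G (FreeGroup (Fin p)),
      (∃ S0 : Set (Coprod G (FreeGroup (Fin p))), S0.Finite ∧ x ∈ S0 ∧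
        ∀ S, S0 ⊆ S → ∀ f, Partly θ S f → ∀ g : Fin p → G,
          (∀ i, f (Coprod.inr (.of i)) = θ (g i)) → f x = θ (evalEq g x)) →
      (∃ S0 : Set (Coprod G (FreeGroup (Fin p))), S0.Finite ∧ y ∈ S0 ∧
        ∀ S, S0 ⊆ S → ∀ f, Partly θ S f → ∀ g : Fin p → G,
          (∀ i, f (Coprod.inr (.of i)) = θ (g i)) → f y = θ (evalEq g y)) →
      ∃ S0 : Set (Coprod G (FreeGroup (Fin p))), S0.Finite ∧ x * y ∈ S0 ∧
        ∀ S, S0 ⊆ S → ∀ f, Partly θ S f → ∀ g : Fin p → G,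
          (∀ i, f (Coprod.inr (.of i)) = θ (g i)) → f (x * y) = θ (evalEq g (x * y)) := by
    rintro x y ⟨S1, h1, hx, h2⟩ ⟨S2, h3, hy, h4⟩
    refine ⟨insert (x * y) (S1 ∪ S2), (h1.union h3).insert _, Set.mem_insert _ _, ?_⟩
    intro S hS f hf g hg
    have hS1 : S1 ⊆ S := fun u hu => hS (.inr (.inl hu))
    have hS2 : S2 ⊆ S := fun u hu => hS (.inr (.inr hu))
    rw [← hf.1 x (hS1 hx) y (hS2 hy) (hS (.inl rfl)), h2 S hS1 f hf g hg, h4 S hS2 f hf g hg,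
      map_mul, map_mul]
  have hinl : ∀ γ : G, ∃ S0 : Set (Coprod G (FreeGroup (Fin p))), S0.Finite ∧
      Coprod.inl γ ∈ S0 ∧ ∀ S, S0 ⊆ S → ∀ f, Partly θ S f → ∀ g : Fin p → G,
        (∀ i, f (Coprod.inr (.of i)) = θ (g i)) →
        f (Coprod.inl γ) = θ (evalEq g (Coprod.inl γ)) := by
    intro γ
    refine ⟨{Coprod.inl γ}, Set.finite_singleton _, rfl, fun S hS f hf g hg => ?_⟩
    rw [hf.2 γ (hS rfl)]
    simp [evalEq]
  induction e using Coprod.induction_on with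
  | inl γ => exact hinl γ
  | mul x y hx hy => exact hmul x y hx hy
  | inr x =>
    induction x using FreeGroup.induction_on with
    | C1 => simpa using hinl 1
    | of i =>
      refine ⟨{Coprod.inr (.of i)}, Set.finite_singleton _, rfl, fun S hS f hf g hg => ?_⟩
      rw [hg]
      simp [evalEq]
    | inv_of i _ =>
      refine ⟨{1, Coprod.inr (.of i), Coprod.inr (.of i)⁻¹}, by simp, by simp,
        fun S hS f hf g hg => ?_⟩
      have h1 : f 1 = 1 := by
        have := hf.2 1 (by rw [map_one]; exact hS (by simp))
        simpa using this
      have h2 := hf.1 (Coprod.inr (.of i)) (hS (by simp)) (Coprod.inr (.of i)⁻¹) (hS (by simp))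
        (by rw [← map_mul, mul_inv_cancel, map_one]; exact hS (by simp))
      rw [← map_mul, mul_inv_cancel, map_one, h1, hg] at h2
      rw [eq_inv_of_mul_eq_one_right h2]
      simp [evalEq]
    | mul x y hx hy => rw [map_mul]; exact hmul _ _ hx hy

/-- Every finite system of equations is equivalent to a triangular one. -/
lemma exists_triSat (hθ : Function.Injective θ) {E : Set (Coprod G (FreeGroup (Fin p)))}
    (hE : E.Finite) : ∃ (K D Z : Type) (_ : Finite K) (_ : Finite D) (_ : Finite Z)
      (a b c : K → Z) (zc : D → Z) (gc : D → H) (var : Fin p → Z), ∀ g : Fin p → G,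
        SolvesSystem E g ↔ ∃ f, TriSat a b c zc gc f ∧ ∀ i, f (var i) = θ (g i) := by
  classical
  choose S0 h1 h2 h3 using exists_determining (p := p) θ
  let S : Set (Coprod G (FreeGroup (Fin p))) :=
    (⋃ e ∈ E, S0 e) ∪ Set.range fun i => Coprod.inr (.of i)
  have hS : S.Finite := (hE.biUnion fun e _ => h1 e).union (Set.finite_range _)
  have hES : E ⊆ S := fun e he => .inl (Set.mem_biUnion he (h2 e))
  have := hS.to_subtype
  let K : Type := {t : S × S // (t.1 : Coprod G (FreeGroup (Fin p))) * t.2 ∈ S}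
  let D : Type := {u : S // ∃ γ : G, Coprod.inl γ = (u : Coprod G (FreeGroup (Fin p)))} ⊕
    {u : S // (u : Coprod G (FreeGroup (Fin p))) ∈ E}
  refine ⟨K, D, S, inferInstance, inferInstance, inferInstance, fun t => t.1.1, fun t => t.1.2,
    fun t => ⟨_, t.2⟩, Sum.elim (fun u => u.1) (fun u => u.1),
    Sum.elim (fun u => θ u.2.choose) (fun _ => 1), fun i => ⟨_, .inr ⟨i, rfl⟩⟩, fun g => ?_⟩
  constructor
  · intro hg
    refine ⟨fun u => θ (evalEq g u), ⟨fun t => ?_, ?_⟩, fun i => ?_⟩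
    · rw [← map_mul, ← map_mul]
    · rintro (u | u)
      · change θ (evalEq g u.1.1) = θ u.2.choose
        exact congrArg θ ((congrArg (evalEq g) u.2.choose_spec).symm.trans (by simp [evalEq]))
      · change θ (evalEq g u.1.1) = 1
        rw [evalEq, hg _ u.2, map_one]
    · simp [evalEq]
  · rintro ⟨f, ⟨h4, h5⟩, h6⟩ e he
    let F : Coprod G (FreeGroup (Fin p)) → H := fun u => if h : u ∈ S then f ⟨u, h⟩ else 1
    have hF : ∀ u (h : u ∈ S), F u = f ⟨u, h⟩ := fun u h => dif_pos h
    have hP : Partly θ S F := by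
      refine ⟨fun u hu v hv huv => ?_, fun γ hγ => ?_⟩
      · rw [hF u hu, hF v hv, hF _ huv]
        exact h4 ⟨(⟨u, hu⟩, ⟨v, hv⟩), huv⟩
      · rw [hF _ hγ]
        have hex : ∃ γ' : G, Coprod.inl γ' = (Coprod.inl γ : Coprod G (FreeGroup (Fin p))) :=
          ⟨γ, rfl⟩
        exact (h5 (.inl ⟨⟨_, hγ⟩, hex⟩)).trans
          (congrArg θ (Coprod.inl_injective hex.choose_spec))
    have h7 := h3 e S (fun u hu => .inl (Set.mem_biUnion he hu)) F hP g fun i => by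
      rw [hF _ (.inr ⟨i, rfl⟩)]; exact h6 i
    rw [hF e (hES he)] at h7
    have h8 : f ⟨e, hES he⟩ = 1 := h5 (.inr ⟨⟨e, hES he⟩, he⟩)
    rw [h8] at h7
    exact hθ (by rw [map_one]; exact h7.symm)

end Reduction

/-! ### Solution languages in subgroups of products of two free products -/

section Hash

variable {β : Type}

/-- The transducer turning block terminators into separators. -/
def hashStep : Bool → β ⊕ Unit → Option (Bool × List (β ⊕ Unit))
  | b, .inl x => some (false, (if b then [.inr ()] else []) ++ [.inl x])
  | b, .inr _ => some (true, if b then [.inr ()] else [])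

lemma prun_hashStep_map (u : List β) (v : List (β ⊕ Unit)) (b : Bool) :
    prun hashStep b (u.map .inl ++ (.inr () :: v)) = (prun hashStep true v).map fun y =>
      (y.1, (if b then [.inr ()] else []) ++ u.map .inl ++ y.2) := by
  induction u generalizing b with
  | nil => cases b <;> rcases h : prun hashStep true v with _ | ⟨q, w⟩ <;> simp [prun, hashStep, h]
  | cons x u ih =>
    rw [List.map_cons, List.cons_append, prun]
    simp only [hashStep, Option.bind_some, ih, Option.map_map]
    congr 1
    funext y
    simp

lemma prun_hashStep_true (us : List (List β)) :
    prun hashStep true (blocks us) =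
      some (true, us.flatMap fun u => .inr () :: u.map .inl) := by
  induction us with
  | nil => rfl
  | cons u us ih =>
    have hb : blocks (u :: us) = u.map .inl ++ (.inr () :: blocks us) := by simp [blocks]
    rw [hb, prun_hashStep_map, ih]
    simp

lemma intercalate_cons_eq {γ : Type} (sep u : List γ) (us : List (List γ)) :
    List.intercalate sep (u :: us) = u ++ us.flatMap fun v => sep ++ v := by
  induction us generalizing u with
  | nil => simp [List.intercalate]
  | cons v us ih =>
    have h := ih v
    simp only [List.intercalate] at h ⊢
    rw [List.intersperse_cons_cons, List.flatten_cons, List.flatten_cons, h]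
    simp

lemma prun_hashStep_blocks (us : List (List β)) :
    ∃ b, prun hashStep false (blocks us) =
      some (b, List.intercalate [.inr ()] (us.map (List.map .inl))) := by
  cases us with
  | nil => exact ⟨false, rfl⟩
  | cons u us =>
    have hb : blocks (u :: us) = u.map .inl ++ (.inr () :: blocks us) := by simp [blocks]
    refine ⟨true, ?_⟩
    rw [hb, prun_hashStep_map, prun_hashStep_true, List.map_cons, intercalate_cons_eq]
    simp [List.flatMap_map]

end Hash

section Pairs

variable {α β Q₁ Q₂ : Type}

open Classical in
/-- The transducer reading pairs of blocks. -/
noncomputable def pairStep (step₁ : Q₁ → α → Option (Q₁ × List β))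
    (step₂ : Q₂ → α → Option (Q₂ × List β)) (q₀ : Q₁) (conn : Q₁ → Q₂) (acc : Q₂ → Prop) :
    Q₁ ⊕ Q₂ → α ⊕ Unit → Option ((Q₁ ⊕ Q₂) × List (β ⊕ Unit))
  | .inl q, .inl a => (step₁ q a).map fun x => (.inl x.1, x.2.map .inl)
  | .inl q, .inr _ => some (.inr (conn q), [])
  | .inr q, .inl a => (step₂ q a).map fun x => (.inr x.1, x.2.map .inl)
  | .inr q, .inr _ => if acc q then some (.inl q₀, [.inr ()]) else none

variable {step₁ : Q₁ → α → Option (Q₁ × List β)} {step₂ : Q₂ → α → Option (Q₂ × List β)}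
  {q₀ : Q₁} {conn : Q₁ → Q₂} {acc : Q₂ → Prop}

lemma prun_pairStep_inl (q : Q₁) (u : List α) :
    prun (pairStep step₁ step₂ q₀ conn acc) (.inl q) (u.map .inl) =
      (prun step₁ q u).map fun x => (.inl x.1, x.2.map .inl) := by
  induction u generalizing q with
  | nil => rfl
  | cons a u ih =>
    rw [List.map_cons, prun, prun, pairStep]
    rcases step₁ q a with _ | ⟨q', w⟩
    · rfl
    · simp only [Option.map_some, Option.bind_some, ih, Option.map_map]
      congr 1
      funext y
      simp

lemma prun_pairStep_inr (q : Q₂) (u : List α) :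
    prun (pairStep step₁ step₂ q₀ conn acc) (.inr q) (u.map .inl) =
      (prun step₂ q u).map fun x => (.inr x.1, x.2.map .inl) := by
  induction u generalizing q with
  | nil => rfl
  | cons a u ih =>
    rw [List.map_cons, prun, prun, pairStep]
    rcases step₂ q a with _ | ⟨q', w⟩
    · rfl
    · simp only [Option.map_some, Option.bind_some, ih, Option.map_map]
      congr 1
      funext y
      simp

lemma prun_pairStep (u₁ u₂ : List α) (v : List (α ⊕ Unit)) (r : (Q₁ ⊕ Q₂) × List (β ⊕ Unit)) :
    prun (pairStep step₁ step₂ q₀ conn acc) (.inl q₀)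
        (u₁.map .inl ++ (.inr () :: (u₂.map .inl ++ (.inr () :: v)))) = some r ↔
      ∃ q₁ v₁ q₂ v₂ r', prun step₁ q₀ u₁ = some (q₁, v₁) ∧
        prun step₂ (conn q₁) u₂ = some (q₂, v₂) ∧ acc q₂ ∧
        prun (pairStep step₁ step₂ q₀ conn acc) (.inl q₀) v = some r' ∧
        r = (r'.1, (v₁ ++ v₂).map .inl ++ (.inr () :: r'.2)) := by
  rw [prun_append, prun_pairStep_inl]
  rcases h₁ : prun step₁ q₀ u₁ with _ | ⟨q₁, v₁⟩
  · simp
  · simp only [Option.map_some, Option.bind_some]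
    rw [prun, pairStep, Option.bind_some, prun_append, prun_pairStep_inr]
    rcases h₂ : prun step₂ (conn q₁) u₂ with _ | ⟨q₂, v₂⟩
    · simp only [Option.map_none, Option.bind_none]
      constructor
      · rintro h; cases h
      · rintro ⟨_, _, _, _, _, h, h', -⟩
        cases h
        rw [h₂] at h'
        cases h'
    · simp only [Option.map_some, Option.bind_some]
      rw [prun, pairStep]
      by_cases hacc : acc q₂
      · rw [if_pos hacc, Option.bind_some]
        rcases h₃ : prun (pairStep step₁ step₂ q₀ conn acc) (.inl q₀) v with _ | r'
        · simp
        · simp only [Option.map_some, Option.some.injEq]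
          constructor
          · rintro rfl
            exact ⟨_, _, _, _, _, rfl, h₂, hacc, rfl, by simp⟩
          · rintro ⟨_, _, _, _, _, h, h', -, h'', rfl⟩
            cases h
            rw [h₂] at h'
            cases h'
            cases h''
            simp
      · rw [if_neg hacc]
        simp only [Option.bind_none, Option.map_none]
        constructor
        · rintro h; cases h
        · rintro ⟨_, _, _, _, _, h, h', h'', -⟩
          cases h
          rw [h₂] at h'
          cases h'
          exact absurd h'' hacc

end Pairs

section Solutions

variable {I : Type} {M : I → Type} [∀ i, Group (M i)]

/-- A criterion for solution languages in a subgroup of a product of two free products of finite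
groups to be EDT0L. -/
theorem isEDT0L_solutionLanguage [Finite I] [∀ i, Finite (M i)] {G : Type} [Group G]
    (Ψ : G →* CoprodI M × CoprodI M) (hΨ : Function.Injective Ψ) {ι Q₁ Q₂ : Type} [Finite ι]
    [Finite Q₁] [Finite Q₂] (η : G → List (ι × Bool))
    (step₁ : Q₁ → (Σ i, M i) → Option (Q₁ × List (ι × Bool)))
    (step₂ : Q₂ → (Σ i, M i) → Option (Q₂ × List (ι × Bool)))
    (q₀ : Q₁) (conn : Q₁ → Q₂) (acc : Q₂ → Prop)
    (hη : ∀ g, ∃ q₁ v₁ q₂ v₂, prun step₁ q₀ (nf (Ψ g).1) = some (q₁, v₁) ∧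
      prun step₂ (conn q₁) (nf (Ψ g).2) = some (q₂, v₂) ∧ acc q₂ ∧ η g = v₁ ++ v₂)
    (hsound : ∀ x q₁ v₁ q₂ v₂, prun step₁ q₀ (nf x.1) = some (q₁, v₁) →
      prun step₂ (conn q₁) (nf x.2) = some (q₂, v₂) → acc q₂ → ∃ g, Ψ g = x)
    {p : ℕ} {E : Set (Coprod G (FreeGroup (Fin p)))} (hE : E.Finite) :
    IsEDT0L (solutionLanguage η E) := by
  obtain ⟨K, D, Z, _, _, _, a, b, c, zc, gc, var, hvar⟩ := exists_triSat Ψ hΨ hE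
  let T := pairStep step₁ step₂ q₀ conn acc
  have hcons : ∀ (x : CoprodI M × CoprodI M) xs,
      blocks ((x :: xs).flatMap fun x => [nf x.1, nf x.2]) = (nf x.1).map .inl ++
        (.inr () :: ((nf x.2).map .inl ++
          (.inr () :: blocks (xs.flatMap fun x => [nf x.1, nf x.2])))) := by
    intro x xs
    simp [blocks]
  have hcompl : ∀ gs : List G, prun T (.inl q₀)
      (blocks ((gs.map Ψ).flatMap fun x => [nf x.1, nf x.2])) =
        some (.inl q₀, blocks (gs.map η)) := by
    intro gs
    induction gs with
    | nil => rfl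
    | cons g gs ih =>
      obtain ⟨q₁, v₁, q₂, v₂, h₁, h₂, h₃, h₄⟩ := hη g
      rw [List.map_cons, hcons, prun_pairStep]
      exact ⟨_, _, _, _, _, h₁, h₂, h₃, ih, by simp [blocks, h₄]⟩
  have hsnd : ∀ (xs : List (CoprodI M × CoprodI M)) r, prun T (.inl q₀) (blocks (xs.flatMap fun x => [nf x.1, nf x.2])) =
      some r →
      ∀ x ∈ xs, ∃ g, Ψ g = x := by
    intro xs
    induction xs with
    | nil => simp
    | cons x xs ih =>
      intro r hr
      rw [hcons, prun_pairStep] at hr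
      obtain ⟨q₁, v₁, q₂, v₂, r', h₁, h₂, h₃, h₄, -⟩ := hr
      rintro y (_ | ⟨_, hy⟩)
      · exact hsound _ _ _ _ _ h₁ h₂ h₃
      · exact ih _ h₄ _ hy
  let sel : CoprodI M × CoprodI M → Bool → CoprodI M := fun x b => if b then x.1 else x.2
  have hL := isEDT0L_triSat (fun k : K × Bool => (a k.1, k.2)) (fun k => (b k.1, k.2))
    (fun k => (c k.1, k.2)) (fun d : D × Bool => (zc d.1, d.2)) (fun d => sel (gc d.1) d.2)
    ((List.finRange p).flatMap fun i => [(var i, true), (var i, false)])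
  refine ((hL.ptransduce T (.inl q₀) fun _ => True).ptransduce hashStep false
    fun _ => True).congr fun w => ?_
  have hblocks : ∀ f : Z × Bool → CoprodI M,
      ((List.finRange p).flatMap fun i => [(var i, true), (var i, false)]).map (nf ∘ f) =
        (List.ofFn fun i => (f (var i, true), f (var i, false))).flatMap
          fun x => [nf x.1, nf x.2] := by
    intro f
    rw [List.map_flatMap, List.ofFn_eq_map, List.flatMap_map]
    rfl
  have hhash : ∀ g : Fin p → G, ∃ b, prun hashStep false (blocks ((List.ofFn g).map η)) =
      some (b, hashWord fun i => η (g i)) := by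
    intro g
    obtain ⟨b, hb⟩ := prun_hashStep_blocks ((List.ofFn g).map η)
    refine ⟨b, hb.trans ?_⟩
    rw [hashWord, List.map_ofFn, List.map_ofFn]
    rfl
  constructor
  · rintro ⟨g, hg, -, rfl⟩
    obtain ⟨f, ⟨h₁, h₂⟩, h₃⟩ := (hvar g).1 hg
    obtain ⟨b, hb⟩ := hhash g
    refine ⟨_, ⟨_, ⟨fun z => sel (f z.1) z.2, ⟨?_, ?_⟩, rfl⟩, .inl q₀, trivial, ?_⟩, b, trivial, hb⟩
    · rintro ⟨k, _ | _⟩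
      · exact congrArg Prod.snd (h₁ k)
      · exact congrArg Prod.fst (h₁ k)
    · rintro ⟨d, b⟩
      exact congrArg (sel · b) (h₂ d)
    · rw [hblocks, ← hcompl, List.map_ofFn]
      congr 4
      funext i
      exact h₃ i
  · rintro ⟨_, ⟨_, ⟨f, ⟨h₁, h₂⟩, rfl⟩, q, -, hq⟩, q', -, hq'⟩
    rw [hblocks] at hq
    have h := hsnd _ _ hq
    have h' : ∀ i, ∃ g, Ψ g = (f (var i, true), f (var i, false)) := fun i =>
      h _ ((List.mem_ofFn' _ _).2 ⟨i, rfl⟩)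
    choose g hg using h'
    have hfg : (List.ofFn fun i => (f (var i, true), f (var i, false))) = (List.ofFn g).map Ψ := by
      rw [List.map_ofFn]
      congr 1
      funext i
      exact (hg i).symm
    rw [hfg, hcompl] at hq
    cases hq
    obtain ⟨b', hb⟩ := hhash g
    rw [hb] at hq'
    cases hq'
    refine ⟨g, (hvar g).2 ⟨fun z => (f (z, true), f (z, false)), ⟨fun k => ?_, fun d => ?_⟩,
      fun i => (hg i).symm⟩, fun _ => trivial, rfl⟩
    · exact Prod.ext (h₁ (k, true)) (h₁ (k, false))
    · exact Prod.ext (h₂ (d, true)) (h₂ (d, false))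

end Solutions

/-! ### Central extensions of subgroups of free products of finite groups -/

/-- A group with a central element `z` on which the homomorphism `χ` to the integers takes the value
`N`, with normal forms whose images under `π` are reduced words in a free product. -/
structure CentralData {I : Type} (M : I → Type) [∀ i, Group (M i)] (G : Type) [Group G] (N : ℕ)
    (Λ : Type) where
  e : Λ → G
  χ : G →* Multiplicative ℤ
  z : G
  π : G →* CoprodI M
  hd : Λ → Σ i, M i
  tl : Λ → Option (Σ i, M i)
  R : Λ → Λ → Prop
  fst : Σ i, M i
  snd : Σ i, M i
  z_central : ∀ g, Commute z g
  χ_z : χ z = Multiplicative.ofAdd (N : ℤ)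
  π_z : π z = 1
  exists_word : ∀ g, ∃ (w : List Λ) (k : ℤ), w.IsChain R ∧ g = (w.map e).prod * z ^ k
  hd_injective : Function.Injective hd
  lval_exp : ∀ l, lval (hd l :: (tl l).toList) = π (e l)
  red_exp : ∀ w : List Λ, w.IsChain R → Red (w.flatMap fun l => hd l :: (tl l).toList)
  fst_ne_snd : fst.1 ≠ snd.1
  fst_ne_one : fst.2 ≠ 1
  snd_ne_one : snd.2 ≠ 1
  fst_mul_self : fst.2 * fst.2 = 1
  snd_mul_self : snd.2 * snd.2 = 1

namespace CentralData

variable {I : Type} {M : I → Type} [∀ i, Group (M i)] {G : Type} [Group G] {N : ℕ} [NeZero N]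
  {Λ : Type} (d : CentralData M G N Λ)

/-- The integer value of `χ`. -/
def val (g : G) : ℤ := (d.χ g).toAdd

@[simp] lemma val_mul (g h : G) : d.val (g * h) = d.val g + d.val h := by simp [val]
@[simp] lemma val_one : d.val 1 = 0 := by simp [val]
@[simp] lemma val_zpow (k : ℤ) : d.val (d.z ^ k) = k * N := by simp [val, d.χ_z]

/-- The reduced word of a word over `Λ`. -/
def exp (w : List Λ) : List (Σ i, M i) := w.flatMap fun l => d.hd l :: (d.tl l).toList

@[simp] lemma exp_nil : d.exp [] = [] := rfl
@[simp] lemma exp_cons (l : Λ) (w : List Λ) :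
    d.exp (l :: w) = d.hd l :: ((d.tl l).toList ++ d.exp w) := rfl

lemma lval_exp_eq (w : List Λ) : lval (d.exp w) = d.π (w.map d.e).prod := by
  induction w with
  | nil => simp
  | cons l w ih =>
    rw [exp_cons, ← List.cons_append, lval_append, d.lval_exp, ih]
    simp

lemma exp_injective : Function.Injective d.exp := by
  intro u
  induction u with
  | nil => intro v h; cases v with
    | nil => rfl
    | cons => simp at h
  | cons a u ih =>
    intro v h
    cases v with
    | nil => simp at h
    | cons b v =>
      rw [exp_cons, exp_cons, List.cons.injEq] at h
      obtain rfl := d.hd_injective h.1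
      rw [ih (List.append_cancel_left h.2)]

/-- The word over `Λ` of a group element. -/
noncomputable def word (g : G) : List Λ := (d.exists_word g).choose

lemma word_chain (g : G) : (d.word g).IsChain d.R := (d.exists_word g).choose_spec.choose_spec.1

lemma word_spec (g : G) : ∃ k : ℤ, g = ((d.word g).map d.e).prod * d.z ^ k :=
  ⟨_, (d.exists_word g).choose_spec.choose_spec.2⟩

lemma nf_π_eq {w : List Λ} (hw : w.IsChain d.R) (k : ℤ) :
    nf (d.π ((w.map d.e).prod * d.z ^ k)) = d.exp w := by
  rw [map_mul, map_zpow, d.π_z, one_zpow, mul_one, ← lval_exp_eq, nf_lval (u := d.exp w) (d.red_exp w hw)]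

lemma nf_π (g : G) : nf (d.π g) = d.exp (d.word g) := by
  obtain ⟨k, hk⟩ := d.word_spec g
  conv_lhs => rw [hk]
  exact d.nf_π_eq (d.word_chain g) k

lemma word_eq {w : List Λ} (hw : w.IsChain d.R) (k : ℤ) :
    d.word ((w.map d.e).prod * d.z ^ k) = w :=
  d.exp_injective (by rw [← nf_π, d.nf_π_eq hw])

lemma eq_zpow_of_π {g : G} (hg : d.π g = 1) : ∃ k : ℤ, g = d.z ^ k := by
  obtain ⟨k, hk⟩ := d.word_spec g
  have h : d.word g = [] := by
    apply d.exp_injective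
    rw [← nf_π, hg, exp_nil, ← lval_nil, nf_lval ⟨by simp, by simp⟩]
  exact ⟨k, by simpa [h] using hk⟩

/-- The second coordinate, recording the value of `χ`. -/
noncomputable def ψ : G →* CoprodI M :=
  (zpowersHom _ (CoprodI.of d.fst.2 * CoprodI.of d.snd.2)).comp d.χ

lemma ψ_apply (g : G) : d.ψ g = (CoprodI.of d.fst.2 * CoprodI.of d.snd.2) ^ d.val g := rfl

/-- The letters of the words for powers of the product of the two involutions. -/
def invo (b : Bool) : Σ i, M i := if b then d.fst else d.snd

lemma invo_ne (b : Bool) : (d.invo b).1 ≠ (d.invo !b).1 := by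
  cases b
  · exact d.fst_ne_snd.symm
  · exact d.fst_ne_snd

lemma invo_ne_one (b : Bool) : (d.invo b).2 ≠ 1 := by
  cases b
  · exact d.snd_ne_one
  · exact d.fst_ne_one

/-- The words for powers of the product of the two involutions. -/
def pw (b : Bool) : ℕ → List (Σ i, M i)
  | 0 => []
  | n + 1 => d.invo b :: d.invo (!b) :: pw b n

/-- The sign of a boolean. -/
def sgn (b : Bool) : ℤ := if b then 1 else -1

lemma lval_pw (b : Bool) (n : ℕ) :
    lval (d.pw b n) = (CoprodI.of d.fst.2 * CoprodI.of d.snd.2) ^ (sgn b * n) := by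
  have hinv : (CoprodI.of d.fst.2 * CoprodI.of d.snd.2 : CoprodI M)⁻¹ =
      CoprodI.of d.snd.2 * CoprodI.of d.fst.2 := by
    rw [mul_inv_rev, ← map_inv, ← map_inv, inv_eq_of_mul_eq_one_left d.fst_mul_self,
      inv_eq_of_mul_eq_one_left d.snd_mul_self]
  induction n with
  | zero => simp [pw]
  | succ n ih =>
    rw [pw, lval_cons, lval_cons, ih, ← mul_assoc]
    have : sgn b * ((n + 1 : ℕ) : ℤ) = sgn b + sgn b * n := by push_cast; ring
    rw [this, zpow_add]
    congr 1
    cases b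
    · change CoprodI.of d.snd.2 * CoprodI.of d.fst.2 = _ ^ (-1 : ℤ)
      rw [zpow_neg_one, hinv]
    · exact (zpow_one _).symm

lemma red_pw (b : Bool) (n : ℕ) : Red (d.pw b n) := by
  suffices h : Red (d.pw b n) ∧ ∀ x ∈ (d.pw b n).head?, x = d.invo b from h.1
  induction n with
  | zero => exact ⟨⟨by simp [pw], by simp [pw]⟩, by simp [pw]⟩
  | succ n ih =>
    refine ⟨⟨?_, ?_⟩, by simp [pw]⟩
    · rw [pw]
      rintro x (_ | ⟨_, _ | ⟨_, hx⟩⟩)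
      · exact d.invo_ne_one b
      · exact d.invo_ne_one _
      · exact ih.1.1 x hx
    · rw [pw, List.isChain_cons_cons, List.isChain_cons]
      refine ⟨d.invo_ne b, fun x hx => ?_, ih.1.2⟩
      rw [ih.2 x hx]
      exact (d.invo_ne b).symm

lemma nf_ψ (g : G) :
    nf (d.ψ g) = d.pw (decide (0 ≤ d.val g)) (d.val g).natAbs := by
  rw [ψ_apply, ← nf_lval (d.red_pw _ _), lval_pw]
  congr 2
  by_cases h : 0 ≤ d.val g
  · simp [sgn, h, abs_of_nonneg h]
  · simp [sgn, h, abs_of_neg (not_le.1 h)]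

/-- The embedding into the product of two free products. -/
noncomputable def Ψ : G →* CoprodI M × CoprodI M := d.π.prod d.ψ

lemma Ψ_injective : Function.Injective d.Ψ := by
  rw [injective_iff_map_eq_one]
  intro g hg
  obtain ⟨h₁, h₂⟩ := Prod.ext_iff.1 hg
  obtain ⟨k, rfl⟩ := d.eq_zpow_of_π h₁
  have h₃ := d.nf_ψ (d.z ^ k)
  have h₄ : nf (d.ψ (d.z ^ k)) = [] := by
    rw [show d.ψ (d.z ^ k) = 1 from h₂, ← lval_nil, nf_lval ⟨by simp, by simp⟩]
  rw [h₄] at h₃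
  have h₅ : (d.val (d.z ^ k)).natAbs = 0 := by
    rcases h : (d.val (d.z ^ k)).natAbs with _ | n
    · rfl
    · rw [h, pw] at h₃; cases h₃
  rw [Int.natAbs_eq_zero, val_zpow] at h₅
  have h₆ : (N : ℤ) ≠ 0 := by exact_mod_cast NeZero.ne N
  rw [(mul_eq_zero.1 h₅).resolve_right h₆, zpow_zero]

/-! #### The normal form -/

variable (N Λ) in
/-- Indices of generators. -/
abbrev Idx : Type := (ZMod N × Λ) ⊕ Unit

/-- The generators. -/
def gen : Idx N Λ → G
  | .inl (q, l) => d.e l * d.z ^ (-((q.val + d.val (d.e l)) / N))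
  | .inr _ => d.z

variable (N Λ) in
/-- The word for a power of `z`. -/
def zrep (n : ℤ) : List (Idx N Λ × Bool) := List.replicate n.natAbs (.inr (), decide (0 ≤ n))

/-- The words over `Λ`, annotated with the values of `χ` on prefixes. -/
def annot : ZMod N → List Λ → List (Idx N Λ × Bool)
  | _, [] => []
  | q, l :: w => (.inl (q, l), true) :: annot (q + d.val (d.e l)) w

/-- The normal form. -/
noncomputable def η (g : G) : List (Idx N Λ × Bool) :=
  d.annot 0 (d.word g) ++ zrep N Λ (d.val g / N)

lemma zmod_div (q : ZMod N) (x : ℤ) : (q.val + x) / N * N + (q + x : ZMod N).val = q.val + x := by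
  have h : ((q + x : ZMod N).val : ℤ) = (q.val + x) % N := by
    rw [← ZMod.val_intCast]
    simp
  rw [h, Int.ediv_mul_add_emod]

lemma zmod_add_div (q : ZMod N) (x y : ℤ) :
    (q.val + (x + y)) / N = (q.val + x) / N + ((q + x : ZMod N).val + y) / N := by
  have h := zmod_div q x
  have hN : (N : ℤ) ≠ 0 := by exact_mod_cast NeZero.ne N
  have h' : (q.val + (x + y) : ℤ) = (q + x : ZMod N).val + y + (q.val + x) / N * N := by
    linarith
  rw [h', Int.add_mul_ediv_right _ _ hN, add_comm]

lemma evalWord_append {ι : Type} (f : ι → G) (u v : List (ι × Bool)) :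
    evalWord f (u ++ v) = evalWord f u * evalWord f v := by
  simp [evalWord]

lemma evalWord_annot (q : ZMod N) (w : List Λ) : evalWord d.gen (d.annot q w) =
    (w.map d.e).prod * d.z ^ (-((q.val + d.val (w.map d.e).prod) / N)) := by
  induction w generalizing q with
  | nil =>
    have : ((q.val : ℤ)) / N = 0 :=
      Int.ediv_eq_zero_of_lt (by positivity) (by exact_mod_cast ZMod.val_lt q)
    simp only [annot, evalWord, List.map_nil, List.prod_nil, val_one, add_zero, this, neg_zero,
      zpow_zero, mul_one]
  | cons l w ih =>
    have h : evalWord d.gen (d.annot q (l :: w)) =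
        d.gen (.inl (q, l)) * evalWord d.gen (d.annot (q + d.val (d.e l)) w) := by
      simp [evalWord, annot]
    rw [h, ih, gen, List.map_cons, List.prod_cons, val_mul, zmod_add_div, neg_add, zpow_add]
    simp only [mul_assoc]
    congr 1
    rw [← mul_assoc, ((d.z_central _).zpow_left _).eq, mul_assoc]

lemma zrep_sgn {b : Bool} {n : ℕ} (hn : n ≠ 0) :
    zrep N Λ (sgn b * n) = List.replicate n (.inr (), b) := by
  cases b
  · have h₁ : ¬ (0 : ℤ) ≤ -1 * n := by omega
    have h₂ : (-1 * (n : ℤ)).natAbs = n := by omega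
    change List.replicate (-1 * (n : ℤ)).natAbs (_, decide ((0 : ℤ) ≤ -1 * n)) = _
    rw [h₂, decide_eq_false h₁]
  · have h₁ : (0 : ℤ) ≤ 1 * n := by omega
    have h₂ : (1 * (n : ℤ)).natAbs = n := by omega
    change List.replicate (1 * (n : ℤ)).natAbs (_, decide ((0 : ℤ) ≤ 1 * n)) = _
    rw [h₂, decide_eq_true h₁]

lemma evalWord_zrep (n : ℤ) : evalWord d.gen (zrep N Λ n) = d.z ^ n := by
  rw [evalWord, zrep, List.map_replicate, List.prod_replicate]
  by_cases h : 0 ≤ n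
  · obtain ⟨k, rfl⟩ := Int.eq_ofNat_of_zero_le h
    simp [gen]
  · obtain ⟨k, rfl⟩ : ∃ k : ℕ, n = -k := ⟨n.natAbs, by omega⟩
    simp only [h, decide_false, Bool.false_eq_true, if_false]
    simp [gen]

lemma val_eq {g : G} {w : List Λ} {k : ℤ} (h : g = (w.map d.e).prod * d.z ^ k) :
    d.val g = d.val (w.map d.e).prod + k * N := by
  rw [h, val_mul, val_zpow]

lemma evalWord_η (g : G) : evalWord d.gen (d.η g) = g := by
  obtain ⟨k, hk⟩ := d.word_spec g
  have hN : (N : ℤ) ≠ 0 := by exact_mod_cast NeZero.ne N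
  rw [η, evalWord_append, evalWord_annot, evalWord_zrep, mul_assoc, ← zpow_add, d.val_eq hk,
    Int.add_mul_ediv_right _ _ hN]
  conv_rhs => rw [hk]
  simp

lemma closure_gen : Subgroup.closure (Set.range d.gen) = ⊤ := by
  rw [eq_top_iff]
  rintro g -
  rw [← d.evalWord_η g]
  refine Subgroup.list_prod_mem _ fun x hx => ?_
  obtain ⟨⟨i, b⟩, -, rfl⟩ := List.mem_map.1 hx
  have : d.gen i ∈ Subgroup.closure (Set.range d.gen) := Subgroup.subset_closure ⟨i, rfl⟩
  cases b
  · exact Subgroup.inv_mem _ this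
  · exact this

/-! #### Regularity -/

/-- The edges of the graph accepting the normal forms. -/
def edge : (ZMod N × Option Λ) ⊕ Bool → Idx N Λ × Bool → (ZMod N × Option Λ) ⊕ Bool → Prop
  | .inl (q, o), (.inl (q', l), true), n => q' = q ∧ (∀ l' ∈ o, d.R l' l) ∧
      n = .inl (q + d.val (d.e l), some l)
  | .inl _, (.inr _, b), n => n = .inr b
  | .inr b, (.inr _, b'), n => b' = b ∧ n = .inr b
  | _, _, _ => False

lemma graphPath_inr (b : Bool) (l : List (Idx N Λ × Bool)) :
    GraphPath d.edge (fun _ => True) (.inr b) l ↔ ∃ n, l = List.replicate n (.inr (), b) := by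
  induction l with
  | nil => exact ⟨fun _ => ⟨0, rfl⟩, fun _ => .nil trivial⟩
  | cons x l ih =>
    constructor
    · intro h
      cases h with
      | cons h₁ h₂ => ?_
      obtain ⟨⟨q, l⟩ | ⟨⟩, b'⟩ := x
      · exact h₁.elim
      · obtain ⟨rfl, rfl⟩ := h₁
        obtain ⟨n, rfl⟩ := ih.1 h₂
        exact ⟨n + 1, rfl⟩
    · rintro ⟨n, hn⟩
      rcases n with _ | n
      · cases hn
      · rw [List.replicate_succ, List.cons.injEq] at hn
        obtain ⟨rfl, hl⟩ := hn
        exact .cons (n' := .inr b) ⟨rfl, rfl⟩ (ih.2 ⟨n, hl⟩)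

lemma graphPath_inl (q : ZMod N) (o : Option Λ) (l : List (Idx N Λ × Bool)) :
    GraphPath d.edge (fun _ => True) (.inl (q, o)) l ↔
      ∃ w n, (o.toList ++ w).IsChain d.R ∧ l = d.annot q w ++ zrep N Λ n := by
  induction l generalizing q o with
  | nil =>
    refine ⟨fun _ => ⟨[], 0, ?_, rfl⟩, fun _ => .nil trivial⟩
    cases o <;> simp
  | cons x l ih =>
    constructor
    · intro h
      cases h with
      | cons h₁ h₂ => ?_
      obtain ⟨⟨q', l'⟩ | ⟨⟩, b⟩ := x
      · cases b
        · exact h₁.elim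
        · obtain ⟨rfl, ho, rfl⟩ := h₁
          obtain ⟨w, n, hw, rfl⟩ := (ih _ _).1 h₂
          refine ⟨l' :: w, n, ?_, rfl⟩
          cases o with
          | none => exact hw
          | some l'' => exact List.isChain_cons_cons.2 ⟨ho _ rfl, hw⟩
      · obtain rfl : _ = Sum.inr b := h₁
        obtain ⟨n, rfl⟩ := (d.graphPath_inr _ _).1 h₂
        refine ⟨[], sgn b * (n + 1 : ℕ), by cases o <;> simp, ?_⟩
        rw [annot, List.nil_append, zrep_sgn (Nat.succ_ne_zero n)]
        rfl
    · rintro ⟨w, n, hw, h⟩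
      cases w with
      | nil =>
        rw [annot, List.nil_append, zrep] at h
        rcases hn : n.natAbs with _ | k
        · rw [hn] at h; cases h
        · rw [hn, List.replicate_succ, List.cons.injEq] at h
          obtain ⟨rfl, rfl⟩ := h
          have h₁ : d.edge (.inl (q, o)) (.inr (), decide (0 ≤ n)) (.inr (decide (0 ≤ n))) := rfl
          exact .cons h₁ ((d.graphPath_inr _ _).2 ⟨k, rfl⟩)
      | cons l' w =>
        rw [annot, List.cons_append, List.cons.injEq] at h
        obtain ⟨rfl, rfl⟩ := h
        cases o with
        | none => exact .cons (n' := .inl (_, some l')) ⟨rfl, by simp, rfl⟩ ((ih _ _).2 ⟨w, n, hw, rfl⟩)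
        | some l'' =>
          obtain ⟨h₁, h₂⟩ := List.isChain_cons_cons.1 hw
          exact .cons (n' := .inl (_, some l')) ⟨rfl, by simpa using h₁, rfl⟩
            ((ih _ (some l')).2 ⟨w, n, h₂, rfl⟩)

lemma range_η : Set.range d.η =
    {l | ∃ w n, w.IsChain d.R ∧ l = d.annot 0 w ++ zrep N Λ n} := by
  ext l
  constructor
  · rintro ⟨g, rfl⟩
    exact ⟨_, _, d.word_chain g, rfl⟩
  · rintro ⟨w, n, hw, rfl⟩
    have hN : (N : ℤ) ≠ 0 := by exact_mod_cast NeZero.ne N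
    refine ⟨(w.map d.e).prod * d.z ^ (n - d.val (w.map d.e).prod / N), ?_⟩
    rw [η, d.word_eq hw, d.val_eq rfl, Int.add_mul_ediv_right _ _ hN, add_sub_cancel]

lemma isRegularNF_η [Finite Λ] : IsRegularNF d.η := by
  have h := isRegular_graphPath d.edge (fun _ => True) fun n => n = .inl (0, none)
  rw [IsRegularNF, range_η]
  have h' : ({l | ∃ n, n = .inl (0, none) ∧ GraphPath d.edge (fun _ => True) n l} :
      Language (Idx N Λ × Bool)) = {l | ∃ w n, w.IsChain d.R ∧ l = d.annot 0 w ++ zrep N Λ n} := by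
    ext l
    constructor
    · rintro ⟨_, rfl, h⟩
      exact (d.graphPath_inl _ _ _).1 h
    · intro h
      exact ⟨_, rfl, (d.graphPath_inl _ none _).2 h⟩
  exact h' ▸ h

/-! #### Quasigeodesicity -/

lemma exists_le_mul_length {ι : Type} [Finite ι] (f : ι → G) (F : G → ℕ) (h₁ : F 1 = 0)
    (h₂ : ∀ g h, F (g * h) ≤ F g + F h) : ∃ C, ∀ v, F (evalWord f v) ≤ C * v.length := by
  obtain ⟨C, hC⟩ := (Set.finite_range fun l : ι × Bool =>
    F (if l.2 then f l.1 else (f l.1)⁻¹)).bddAbove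
  refine ⟨C, fun v => ?_⟩
  induction v with
  | nil => simp [evalWord, h₁]
  | cons l v ih =>
    have h : evalWord f (l :: v) = (if l.2 then f l.1 else (f l.1)⁻¹) * evalWord f v := by
      simp [evalWord]
    have h₃ := hC ⟨l, rfl⟩
    have h₄ := h₂ (if l.2 then f l.1 else (f l.1)⁻¹) (evalWord f v)
    rw [h, List.length_cons, mul_add, mul_one]
    simp only at h₃
    omega

lemma length_annot (q : ZMod N) (w : List Λ) : (d.annot q w).length = w.length := by
  induction w generalizing q with
  | nil => rfl
  | cons l w ih => simp [annot, ih]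

lemma length_le_length_exp (w : List Λ) : w.length ≤ (d.exp w).length := by
  induction w with
  | nil => simp
  | cons l w ih => simp; omega

lemma isQuasigeodesicNF_η [Finite Λ] : IsQuasigeodesicNF d.gen d.η := by
  obtain ⟨C, hC⟩ := exists_le_mul_length d.gen (fun g => (nf (d.π g)).length + (d.val g).natAbs)
    (by
      have : nf (1 : CoprodI M) = [] := by rw [← lval_nil, nf_lval ⟨by simp, by simp⟩]
      simp [this])
    (fun g h => by
      have := length_nf_mul_le (d.π g) (d.π h)
      simp only [map_mul, val_mul]
      omega)
  refine ⟨C + 1, by positivity, fun g => ?_⟩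
  obtain ⟨v, hv, hl⟩ : wordLength d.gen g ∈
      {n | ∃ w : List (Idx N Λ × Bool), evalWord d.gen w = g ∧ w.length = n} :=
    Nat.sInf_mem ⟨_, d.η g, d.evalWord_η g, rfl⟩
  have h₁ := hC v
  rw [hv, hl] at h₁
  have h₂ := d.length_le_length_exp (d.word g)
  rw [← nf_π] at h₂
  have h₃ : (d.val g / N).natAbs ≤ (d.val g).natAbs :=
    Int.natAbs_ediv_le_natAbs _ _
  have h₄ : (d.η g).length ≤ C * wordLength d.gen g := by
    rw [η, List.length_append, length_annot, zrep, List.length_replicate]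
    omega
  have h₅ : ((d.η g).length : ℝ) ≤ C * wordLength d.gen g := by exact_mod_cast h₄
  have h₆ : (0 : ℝ) ≤ wordLength d.gen g := by positivity
  have h₇ : (0 : ℝ) ≤ C := by positivity
  linarith

end CentralData

namespace CentralData

variable {I : Type} {M : I → Type} [∀ i, Group (M i)] {G : Type} [Group G] {N : ℕ} [NeZero N]
  {Λ : Type} (d : CentralData M G N Λ)

/-! #### The transducers computing the normal form -/

open Classical in
/-- The transducer reading the first coordinate. -/
noncomputable def stepπ : ZMod N × Option (Σ i, M i) → (Σ i, M i) →
    Option ((ZMod N × Option (Σ i, M i)) × List (Idx N Λ × Bool))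
  | (q, none), a => if h : ∃ l, d.hd l = a then
      some ((q + d.val (d.e h.choose), d.tl h.choose), [(.inl (q, h.choose), true)]) else none
  | (q, some b), a => if a = b then some ((q, none), []) else none

lemma stepπ_hd (q : ZMod N) (l : Λ) :
    d.stepπ (q, none) (d.hd l) = some ((q + d.val (d.e l), d.tl l), [(.inl (q, l), true)]) := by
  have h : ∃ l', d.hd l' = d.hd l := ⟨l, rfl⟩
  have h' : h.choose = l := d.hd_injective h.choose_spec
  rw [stepπ, dif_pos h, h']

lemma prun_stepπ_exp (q : ZMod N) (w : List Λ) :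
    prun d.stepπ (q, none) (d.exp w) =
      some ((q + d.val (w.map d.e).prod, none), d.annot q w) := by
  induction w generalizing q with
  | nil => simp [prun, annot]
  | cons l w ih =>
    rw [exp_cons, prun, stepπ_hd, Option.bind_some]
    rcases h : d.tl l with _ | b
    · simp [ih, annot, add_assoc]
    · simp [prun, stepπ, ih, annot, add_assoc]

lemma exists_of_prun_stepπ (u : List (Σ i, M i)) (q q' : ZMod N) (o : Option (Σ i, M i))
    (v : List (Idx N Λ × Bool)) (h : prun d.stepπ (q, o) u = some ((q', none), v)) :
    ∃ w, u = o.toList ++ d.exp w ∧ q' = q + d.val (w.map d.e).prod := by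
  induction u generalizing q o v with
  | nil =>
    cases h
    exact ⟨[], rfl, by simp⟩
  | cons a u ih =>
    rw [prun] at h
    rcases o with _ | b
    · rw [stepπ] at h
      split_ifs at h with hl
      · rw [Option.bind_some, Option.map_eq_some_iff] at h
        obtain ⟨⟨x, v'⟩, h, hx⟩ := h
        cases hx
        obtain ⟨w, rfl, rfl⟩ := ih _ _ _ h
        refine ⟨hl.choose :: w, by simp [hl.choose_spec], by simp [add_assoc]⟩
      · cases h
    · rw [stepπ] at h
      split_ifs at h with hl
      · rw [Option.bind_some, Option.map_eq_some_iff] at h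
        obtain ⟨⟨x, v'⟩, h, hx⟩ := h
        cases hx
        obtain ⟨w, rfl, rfl⟩ := ih _ _ _ h
        exact ⟨w, by simp [hl], rfl⟩
      · cases h

open Classical in
/-- The transducer reading the second coordinate; the first part of the state is kept for the final
test. -/
noncomputable def stepψ {Q : Type} : Q × ZMod N × Option (Bool × Bool) → (Σ i, M i) →
    Option ((Q × ZMod N × Option (Bool × Bool)) × List (Idx N Λ × Bool))
  | (q, c, none), a => if a = d.invo true then some ((q, c, some (true, true)), []) else
      if a = d.invo false then some ((q, c, some (false, true)), []) else none
  | (q, c, some (b, false)), a =>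
      if a = d.invo b then some ((q, c, some (b, true)), []) else none
  | (q, c, some (b, true)), a => if a = d.invo (!b) then
      some ((q, c + sgn b, some (b, false)), zrep N Λ ((c.val + sgn b) / N)) else none

lemma zrep_sgn_mul_add (b : Bool) (m n : ℕ) :
    zrep N Λ (sgn b * m) ++ zrep N Λ (sgn b * n) = zrep N Λ (sgn b * (m + n : ℕ)) := by
  rcases eq_or_ne m 0 with rfl | hm
  · simp [zrep]
  rcases eq_or_ne n 0 with rfl | hn
  · simp [zrep]
  rw [zrep_sgn hm, zrep_sgn hn, zrep_sgn (by omega), List.replicate_append_replicate]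

lemma exists_div_eq (b : Bool) (c : ZMod N) (n : ℕ) :
    ∃ k : ℕ, (c.val + sgn b * n) / N = sgn b * k := by
  have hc : (c.val : ℤ) < N := by exact_mod_cast ZMod.val_lt c
  have hN : (0 : ℤ) < N := by exact_mod_cast Nat.pos_of_ne_zero (NeZero.ne N)
  cases b
  · change ∃ k : ℕ, (c.val + -1 * (n : ℤ)) / N = -1 * k
    have h : ((c.val : ℤ) + -1 * n) / N < 1 := Int.ediv_lt_of_lt_mul hN (by omega)
    exact ⟨((c.val + -1 * (n : ℤ)) / N).natAbs, by omega⟩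
  · change ∃ k : ℕ, (c.val + 1 * (n : ℤ)) / N = 1 * k
    have h : 0 ≤ ((c.val : ℤ) + 1 * n) / N := Int.ediv_nonneg (by omega) hN.le
    exact ⟨((c.val + 1 * (n : ℤ)) / N).natAbs, by omega⟩

lemma prun_stepψ_pw {Q : Type} (q : Q) (b : Bool) (c : ZMod N) (n : ℕ) :
    prun d.stepψ (q, c, some (b, false)) (d.pw b n) =
      some ((q, c + (sgn b * n : ℤ), some (b, false)),
        zrep N Λ ((c.val + sgn b * n) / N)) := by
  induction n generalizing c with
  | zero =>
    have : ((c.val : ℤ)) / N = 0 :=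
      Int.ediv_eq_zero_of_lt (by positivity) (by exact_mod_cast ZMod.val_lt c)
    simp only [pw, prun, Nat.cast_zero, mul_zero, add_zero, Int.cast_zero, this]
    rfl
  | succ n ih =>
    rw [pw, prun, stepψ, if_pos rfl, Option.bind_some, prun, stepψ, if_pos rfl, Option.bind_some,
      ih]
    obtain ⟨k₁, h₁⟩ := exists_div_eq b c 1
    obtain ⟨k₂, h₂⟩ := exists_div_eq b (c + (sgn b : ZMod N)) n
    have h₃ : sgn b * ((n + 1 : ℕ) : ℤ) = sgn b + sgn b * n := by push_cast; ring
    rw [Nat.cast_one, mul_one] at h₁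
    simp only [Option.map_some, List.nil_append]
    rw [h₃, zmod_add_div, h₁, h₂, zrep_sgn_mul_add, ← mul_add, ← Nat.cast_add]
    simp [add_assoc]

lemma prun_stepψ_none {Q : Type} (q : Q) (b : Bool) (c : ZMod N) (n : ℕ) :
    ∃ m, (∀ b', m ≠ some (b', true)) ∧ prun d.stepψ (q, c, none) (d.pw b n) =
      some ((q, c + (sgn b * n : ℤ), m), zrep N Λ ((c.val + sgn b * n) / N)) := by
  rcases n with _ | n
  · refine ⟨none, by simp, ?_⟩
    have h := d.prun_stepψ_pw q b c 0
    simp only [pw, prun, Option.some.injEq, Prod.mk.injEq, true_and, and_true] at h ⊢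
    exact h
  · refine ⟨some (b, false), by simp, ?_⟩
    rw [← d.prun_stepψ_pw q b c (n + 1), pw, prun, prun]
    congr 1
    have h : d.invo false ≠ d.invo true := fun h => d.invo_ne true (congrArg Sigma.fst h).symm
    cases b
    · rw [stepψ, stepψ, if_neg h, if_pos rfl]
    · rw [stepψ, stepψ, if_pos rfl, if_pos rfl]

lemma exists_of_prun_stepψ_some {Q : Type} (u : List (Σ i, M i)) (q q' : Q) (c c' : ZMod N)
    (b h : Bool) (m : Option (Bool × Bool)) (v : List (Idx N Λ × Bool))
    (hm : ∀ b', m ≠ some (b', true))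
    (hu : prun d.stepψ (q, c, some (b, h)) u = some ((q', c', m), v)) :
    ∃ n : ℕ, (if h then d.invo b :: u else u) = d.pw b n ∧ q' = q ∧
      c' = c + (sgn b * n : ℤ) := by
  induction u generalizing c h v with
  | nil =>
    cases hu
    cases h
    · exact ⟨0, rfl, rfl, by simp⟩
    · exact absurd rfl (hm b)
  | cons a u ih =>
    rw [prun] at hu
    cases h
    · rw [stepψ] at hu
      split_ifs at hu with ha
      · rw [Option.bind_some, Option.map_eq_some_iff] at hu
        obtain ⟨⟨x, v'⟩, hu, hx⟩ := hu
        cases hx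
        obtain ⟨n, h₁, h₂⟩ := ih _ _ _ hu
        exact ⟨n, by rw [ha]; exact h₁, h₂⟩
      · cases hu
    · rw [stepψ] at hu
      split_ifs at hu with ha
      · rw [Option.bind_some, Option.map_eq_some_iff] at hu
        obtain ⟨⟨x, v'⟩, hu, hx⟩ := hu
        cases hx
        obtain ⟨n, h₁, h₂, h₃⟩ := ih _ _ _ hu
        refine ⟨n + 1, ?_, h₂, ?_⟩
        · rw [ha, pw, ← h₁]; rfl
        · rw [h₃]; push_cast; ring
      · cases hu

lemma exists_of_prun_stepψ {Q : Type} (u : List (Σ i, M i)) (q q' : Q) (c c' : ZMod N)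
    (m : Option (Bool × Bool)) (v : List (Idx N Λ × Bool)) (hm : ∀ b', m ≠ some (b', true))
    (hu : prun d.stepψ (q, c, none) u = some ((q', c', m), v)) :
    ∃ (b : Bool) (n : ℕ), u = d.pw b n ∧ q' = q ∧ c' = c + (sgn b * n : ℤ) := by
  rcases u with _ | ⟨a, u⟩
  · cases hu
    exact ⟨true, 0, rfl, rfl, by simp⟩
  · rw [prun, stepψ] at hu
    split_ifs at hu with ha ha
    · rw [Option.bind_some, Option.map_eq_some_iff] at hu
      obtain ⟨⟨x, v'⟩, hu, hx⟩ := hu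
      cases hx
      exact ⟨true, by simpa [ha] using d.exists_of_prun_stepψ_some _ _ _ _ _ _ _ _ _ hm hu⟩
    · rw [Option.bind_some, Option.map_eq_some_iff] at hu
      obtain ⟨⟨x, v'⟩, hu, hx⟩ := hu
      cases hx
      exact ⟨false, by simpa [ha] using d.exists_of_prun_stepψ_some _ _ _ _ _ _ _ _ _ hm hu⟩
    · cases hu

lemma sgn_mul_natAbs (n : ℤ) : sgn (decide (0 ≤ n)) * (n.natAbs : ℤ) = n := by
  by_cases h : 0 ≤ n
  · rw [decide_eq_true h]
    change 1 * _ = _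
    omega
  · rw [decide_eq_false h]
    change -1 * _ = _
    omega

/-- Solution languages with respect to the normal form are EDT0L. -/
theorem isEDT0L_solutionLanguage_η [Finite I] [∀ i, Finite (M i)] [Finite Λ] {p : ℕ}
    {E : Set (Coprod G (FreeGroup (Fin p)))} (hE : E.Finite) :
    IsEDT0L (solutionLanguage d.η E) := by
  refine isEDT0L_solutionLanguage d.Ψ d.Ψ_injective d.η d.stepπ
    (d.stepψ (Q := ZMod N × Option (Σ i, M i))) (0, none) (fun q => (q, 0, none))
    (fun x => x.1.2 = none ∧ x.2.1 = x.1.1 ∧ ∀ b, x.2.2 ≠ some (b, true)) ?_ ?_ hE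
  · intro g
    obtain ⟨m, hm, h⟩ := d.prun_stepψ_none
      ((0 + d.val ((d.word g).map d.e).prod : ZMod N), (none : Option (Σ i, M i)))
      (decide (0 ≤ d.val g)) 0 (d.val g).natAbs
    rw [← nf_ψ] at h
    refine ⟨_, _, _, _, (congrArg _ (d.nf_π g)).trans (d.prun_stepπ_exp 0 _), h,
      ⟨rfl, ?_, hm⟩, ?_⟩
    · obtain ⟨k, hk⟩ := d.word_spec g
      rw [sgn_mul_natAbs, d.val_eq hk]
      simp
    · rw [sgn_mul_natAbs, ZMod.val_zero, Nat.cast_zero, zero_add]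
      rfl
  · rintro ⟨x, y⟩ ⟨q, o⟩ v₁ ⟨⟨q', o'⟩, c, m⟩ v₂ h₁ h₂ ⟨ho, hc, hm⟩
    obtain rfl : o' = none := ho
    obtain rfl : c = q' := hc
    obtain ⟨b, n, h₃, h₄, h₅⟩ := d.exists_of_prun_stepψ _ _ _ _ _ _ _ hm h₂
    cases h₄
    obtain ⟨w, h₆, h₇⟩ := d.exists_of_prun_stepπ _ _ _ _ _ h₁
    rw [h₇, zero_add, zero_add, ZMod.intCast_eq_intCast_iff, Int.modEq_iff_dvd] at h₅
    obtain ⟨k, hk⟩ := h₅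
    refine ⟨(w.map d.e).prod * d.z ^ k, Prod.ext ?_ ?_⟩
    · change d.π _ = x
      rw [map_mul, map_zpow, d.π_z, one_zpow, mul_one, ← lval_exp_eq, ← lval_nf x, h₆]
      rfl
    · change d.ψ _ = y
      rw [ψ_apply, val_mul, val_zpow, ← lval_nf y, h₃, lval_pw]
      congr 1
      linarith

/-- The group has a regular quasigeodesic normal form with EDT0L solution languages. -/
theorem exists_normalForm (d : CentralData M G N Λ) [Finite I] [∀ i, Finite (M i)] [Finite Λ] :
    ∃ (ι : Type) (_ : Fintype ι) (gen : ι → G) (η : G → List (ι × Bool)),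
      Subgroup.closure (Set.range gen) = ⊤ ∧ (∀ g : G, evalWord gen (η g) = g) ∧
      IsRegularNF η ∧ IsQuasigeodesicNF gen η ∧
      ∀ (p : ℕ) (E : Set (Coprod G (FreeGroup (Fin p)))), E.Finite →
        IsEDT0L (solutionLanguage η E) :=
  ⟨Idx N Λ, Fintype.ofFinite _, d.gen, d.η, d.closure_gen, d.evalWord_η, d.isRegularNF_η,
    d.isQuasigeodesicNF_η, fun _ _ hE => d.isEDT0L_solutionLanguage_η hE⟩

end CentralData

end

section

open Monoid

/-! ### Central extensions of free products of cyclic groups -/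

/-- The orders of the factors. -/
def facOrd (k : ℕ) : Option Bool → ℕ
  | none => k
  | some _ => 2

/-- The free factors: two groups of order `2` and a cyclic group of order `k`. -/
abbrev Fac (k : ℕ) (i : Option Bool) : Type := Multiplicative (ZMod (facOrd k i))

instance (k : ℕ) [NeZero k] (i : Option Bool) : NeZero (facOrd k i) := by
  cases i
  · assumption
  · exact ⟨two_ne_zero⟩

/-- The letters of order two. -/
def two (k : ℕ) (b : Bool) : Fac k (some b) := Multiplicative.ofAdd (1 : ZMod 2)

/-- The letters of the cyclic factor of order `k`. -/
def cyc (k : ℕ) (i : ZMod k) : Fac k none := Multiplicative.ofAdd i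

lemma two_ne_one (k : ℕ) (b : Bool) : two k b ≠ 1 := by
  change Multiplicative.ofAdd (1 : ZMod 2) ≠ 1
  decide

lemma two_mul_self (k : ℕ) (b : Bool) : two k b * two k b = 1 := by
  change Multiplicative.ofAdd (1 : ZMod 2) * Multiplicative.ofAdd (1 : ZMod 2) = 1
  decide

lemma cyc_ne_one {k : ℕ} {i : ZMod k} (hi : i ≠ 0) : cyc k i ≠ 1 := hi

lemma cyc_one_pow (k n : ℕ) : cyc k 1 ^ n = cyc k n := by
  change Multiplicative.ofAdd (1 : ZMod k) ^ n = Multiplicative.ofAdd (n : ZMod k)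
  rw [← ofAdd_nsmul, nsmul_one]

variable {k : ℕ} [NeZero k] {κ : Type}

/-- The letters of normal forms. -/
abbrev Lam (k : ℕ) (κ : Type) : Type := κ ⊕ {i : ZMod k // i ≠ 0}

/-- First letters. -/
def lamHd (h : κ → Bool) : Lam k κ → Σ i, Fac k i
  | .inl c => ⟨some (h c), two k _⟩
  | .inr i => ⟨none, cyc k i⟩

/-- Second letters. -/
def lamTl (h : κ → Bool) (τ : Bool) : Lam k κ → Option (Σ i, Fac k i)
  | .inl c => if τ then some ⟨some (!h c), two k _⟩ else none
  | .inr _ => none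

/-- Admissible pairs of consecutive letters. -/
def lamRel (inv : κ → κ) : Lam k κ → Lam k κ → Prop
  | .inl c, .inl c' => c' ≠ inv c
  | .inr _, .inr _ => False
  | _, _ => True

lemma red_lam (inv : κ → κ) (h : κ → Bool) (τ : Bool)
    (hτ : ∀ c c', c' ≠ inv c → (h c ^^ τ) ≠ h c') (w : List (Lam k κ))
    (hw : w.IsChain (lamRel inv)) :
    Red (w.flatMap fun l => lamHd h l :: (lamTl h τ l).toList) ∧
      ∀ x ∈ (w.flatMap fun l => lamHd h l :: (lamTl h τ l).toList).head?,
        ∃ l ∈ w.head?, x = lamHd h l := by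
  induction w with
  | nil => exact ⟨⟨by simp, by simp⟩, by simp⟩
  | cons l w ih =>
    rw [List.isChain_cons] at hw
    obtain ⟨ih₁, ih₂⟩ := ih hw.2
    refine ⟨?_, by simp⟩
    rw [List.flatMap_cons]
    refine Red.append ?_ ih₁ ?_
    · rcases l with c | i
      · refine ⟨?_, ?_⟩
        · cases τ <;> simp [lamHd, lamTl, two_ne_one]
        · cases τ <;> simp [lamHd, lamTl]
      · exact ⟨by simpa [lamHd, lamTl] using cyc_ne_one i.2, by simp [lamTl]⟩
    · intro x hx y hy
      obtain ⟨l', hl', rfl⟩ := ih₂ y hy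
      have hR := hw.1 l' hl'
      rcases l with c | i
      · have hx' : x.1 = some (h c ^^ τ) := by
          cases τ
          · obtain rfl : _ = x := by simpa [lamHd, lamTl] using hx
            simp
          · obtain rfl : _ = x := by simpa [lamHd, lamTl] using hx
            simp
        rw [hx']
        rcases l' with c' | i'
        · simpa [lamHd] using hτ _ _ hR
        · simp [lamHd]
      · obtain rfl : _ = x := by simpa [lamHd, lamTl] using hx
        rcases l' with c' | i'
        · simp [lamHd]
        · exact hR.elim

section

variable {G : Type} [Group G] (inv : κ → κ) (e : κ → G) (y z : G)

/-- The values of the letters. -/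
def lamVal : Lam k κ → G
  | .inl c => e c
  | .inr i => y ^ i.1.val

lemma isChain_concat {α : Type} {R : α → α → Prop} {w : List α} {l : α} (hw : w.IsChain R)
    (h : ∀ x ∈ w.getLast?, R x l) : (w ++ [l]).IsChain R :=
  List.isChain_append.2 ⟨hw, by simp, by simpa using h⟩

lemma exists_lam_word (hz : ∀ g, Commute z g) (hy : y ^ k = z) (hinv : ∀ c, inv (inv c) = c)
    (ε : ℤ) (he : ∀ c, e c * e (inv c) = z ^ ε)
    (hgen : Subgroup.closure (insert y (Set.range e)) = ⊤) (g : G) :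
    ∃ (w : List (Lam k κ)) (n : ℤ), w.IsChain (lamRel inv) ∧
      g = (w.map (lamVal e y)).prod * z ^ n := by
  classical
  have hzn : ∀ (n : ℤ) (g : G), z ^ n * g = g * z ^ n := fun n g => ((hz g).zpow_left n).eq
  let S : Set G := {g | ∃ (w : List (Lam k κ)) (n : ℤ), w.IsChain (lamRel inv) ∧
      g = (w.map (lamVal e y)).prod * z ^ n}
  have hSz : ∀ g ∈ S, ∀ n : ℤ, g * z ^ n ∈ S := by
    rintro _ ⟨w, n, hw, rfl⟩ n'
    exact ⟨w, n + n', hw, by rw [zpow_add, mul_assoc]⟩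
  have hSpow : ∀ w : List (Lam k κ), w.IsChain (lamRel inv) → (∀ i, .inr i ∉ w.getLast?) →
      ∀ j : ℕ, (w.map (lamVal e y)).prod * y ^ j ∈ S := by
    intro w hw hlast j
    have hj : y ^ j = y ^ (j : ZMod k).val * z ^ ((j / k : ℕ) : ℤ) := by
      rw [← hy, ZMod.val_natCast, zpow_natCast, ← pow_mul, ← pow_add, Nat.mod_add_div]
    by_cases h0 : (j : ZMod k) = 0
    · exact ⟨w, (j / k : ℕ), hw, by rw [hj, h0, ZMod.val_zero, pow_zero, one_mul]⟩
    · refine ⟨w ++ [.inr ⟨_, h0⟩], (j / k : ℕ), isChain_concat hw fun x hx => ?_, ?_⟩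
      · rcases x with c | i
        · trivial
        · exact absurd hx (hlast i)
      · rw [hj, List.map_append, List.prod_append, mul_assoc]
        simp [lamVal]
  have hSy : ∀ g ∈ S, g * y ∈ S := by
    rintro _ ⟨w, n, hw, rfl⟩
    rw [mul_assoc, hzn, ← mul_assoc]
    apply hSz
    by_cases h : ∃ i, .inr i ∈ w.getLast?
    · obtain ⟨i, hi⟩ := h
      obtain ⟨w', rfl⟩ := List.getLast?_eq_some_iff.1 hi
      obtain ⟨h₁, -, h₂⟩ := List.isChain_append.1 hw
      have h₃ := hSpow w' h₁ (fun i' hi' => h₂ _ hi' (.inr i) rfl) (i.1.val + 1)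
      simpa [lamVal, pow_succ, mul_assoc] using h₃
    · have h₃ := hSpow w hw (fun i hi => h ⟨i, hi⟩) 1
      rwa [pow_one] at h₃
  have hSe : ∀ g ∈ S, ∀ c, g * e c ∈ S := by
    rintro _ ⟨w, n, hw, rfl⟩ c
    rw [mul_assoc, hzn, ← mul_assoc]
    apply hSz
    by_cases h : .inl (inv c) ∈ w.getLast?
    · obtain ⟨w', rfl⟩ := List.getLast?_eq_some_iff.1 h
      refine ⟨w', ε, (List.isChain_append.1 hw).1, ?_⟩
      have := he (inv c)
      rw [hinv] at this
      simp [lamVal, mul_assoc, this]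
    · refine ⟨w ++ [.inl c], 0, isChain_concat hw fun x hx => ?_, by simp [lamVal]⟩
      rcases x with c' | i
      · rintro rfl
        rw [hinv] at h
        exact h hx
      · trivial
  have hSypow : ∀ g ∈ S, ∀ j : ℕ, g * y ^ j ∈ S := by
    intro g hg j
    induction j with
    | zero => simpa using hg
    | succ j ih => rw [pow_succ, ← mul_assoc]; exact hSy _ ih
  have hall : ∀ g ∈ Subgroup.closure (insert y (Set.range e)), g ∈ S := by
    intro g hg
    induction hg using Subgroup.closure_induction_right with
    | one => exact ⟨[], 0, by simp, by simp⟩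
    | mul_right g x hx hgx ih =>
      rcases hgx with rfl | ⟨c, rfl⟩
      · exact hSy _ ih
      · exact hSe _ ih c
    | mul_inv_cancel g x hx hgx ih =>
      rcases hgx with hx' | ⟨c, rfl⟩
      · have h : y⁻¹ = y ^ (k - 1) * z ^ (-1 : ℤ) := by
          rw [inv_eq_iff_mul_eq_one, ← mul_assoc, ← pow_succ',
            Nat.sub_add_cancel (Nat.pos_of_ne_zero (NeZero.ne k)), hy, zpow_neg_one,
            mul_inv_cancel]
        rw [hx', h, ← mul_assoc]
        exact hSz _ (hSypow _ ih _) _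
      · have h : (e c)⁻¹ = e (inv c) * z ^ (-ε) := by
          rw [inv_eq_iff_mul_eq_one, ← mul_assoc, he, zpow_neg, mul_inv_cancel]
        rw [h, ← mul_assoc]
        exact hSz _ (hSe _ ih _) _
  exact hall g (hgen ▸ Subgroup.mem_top g)

/-- The data for a central extension of a subgroup of a free product of cyclic groups. -/
def lamData {N : ℕ} (χ : G →* Multiplicative ℤ) (π : G →* CoprodI (Fac k)) (h : κ → Bool)
    (τ : Bool) (hτ : ∀ c c', c' ≠ inv c → (h c ^^ τ) ≠ h c') (hh : Function.Injective h)
    (hz : ∀ g, Commute z g) (hy : y ^ k = z) (hinv : ∀ c, inv (inv c) = c)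
    (ε : ℤ) (he : ∀ c, e c * e (inv c) = z ^ ε)
    (hgen : Subgroup.closure (insert y (Set.range e)) = ⊤)
    (hχ : χ z = Multiplicative.ofAdd (N : ℤ)) (hπy : π y = CoprodI.of (cyc k 1))
    (hπe : ∀ c, π (e c) = CoprodI.of (two k (h c)) *
      if τ then CoprodI.of (two k (!h c)) else 1) :
    CentralData (Fac k) G N (Lam k κ) where
  e := lamVal e y
  χ := χ
  z := z
  π := π
  hd := lamHd h
  tl := lamTl h τ
  R := lamRel inv
  fst := ⟨some true, two k _⟩
  snd := ⟨some false, two k _⟩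
  z_central := hz
  χ_z := hχ
  π_z := by
    rw [← hy, map_pow, hπy, ← map_pow, cyc_one_pow, ZMod.natCast_self]
    exact map_one _
  exists_word := exists_lam_word inv e y z hz hy hinv ε he hgen
  hd_injective := by
    rintro (c | i) (c' | i') hcc
    · have := congrArg Sigma.fst hcc
      simp only [lamHd, Option.some.injEq] at this
      rw [hh this]
    · cases congrArg Sigma.fst hcc
    · cases congrArg Sigma.fst hcc
    · simp only [lamHd, Sigma.mk.injEq, heq_eq_eq, true_and] at hcc
      rw [Subtype.ext (a1 := i) (a2 := i') hcc]
  lval_exp := by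
    rintro (c | i)
    · cases τ <;> simp [lamVal, hπe, lamHd, lamTl]
    · simp only [lamHd, lamTl, Option.toList_none, lval_cons, lval_nil, mul_one, lamVal, map_pow,
        hπy]
      rw [← map_pow, cyc_one_pow, ZMod.natCast_zmod_val]
  red_exp w hw := (red_lam inv h τ hτ w hw).1
  fst_ne_snd := by simp
  fst_ne_one := two_ne_one k _
  snd_ne_one := two_ne_one k _
  fst_mul_self := two_mul_self k _
  snd_mul_self := two_mul_self k _

end

end

section

open Monoid

/-! ### Dihedral Artin groups -/

section

variable {H : Type} [Group H]

lemma map_altProd_even (φ : FreeGroup (Fin 2) →* H) (x y : FreeGroup (Fin 2)) (n : ℕ) :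
    φ (altProd x y (2 * n)) = (φ x * φ y) ^ n := by
  induction n with
  | zero => simp [altProd]
  | succ n ih => rw [Nat.mul_succ, pow_succ', ← ih]; simp [altProd, mul_assoc]

lemma map_altProd_odd (φ : FreeGroup (Fin 2) →* H) (x y : FreeGroup (Fin 2)) (n : ℕ) :
    φ (altProd x y (2 * n + 1)) = φ x * (φ y * φ x) ^ n := by
  rw [altProd, map_mul, map_altProd_even]

/-- The standard generator `a`. -/
def artA (m : ℕ) : DihedralArtin m := PresentedGroup.of 0

/-- The standard generator `b`. -/
def artB (m : ℕ) : DihedralArtin m := PresentedGroup.of 1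

lemma art_closure (m : ℕ) (K : Subgroup (DihedralArtin m)) (ha : artA m ∈ K)
    (hb : artB m ∈ K) : K = ⊤ := by
  rw [eq_top_iff, ← PresentedGroup.closure_range_of, Subgroup.closure_le]
  rintro _ ⟨i, rfl⟩
  fin_cases i
  · exact ha
  · exact hb

lemma art_rel (m : ℕ) :
    PresentedGroup.mk (dihedralArtinRels m) (altProd (FreeGroup.of 0) (FreeGroup.of 1) m) =
      PresentedGroup.mk (dihedralArtinRels m) (altProd (FreeGroup.of 1) (FreeGroup.of 0) m) := by
  rw [← mul_inv_eq_one, ← map_inv, ← map_mul]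
  exact PresentedGroup.one_of_mem rfl

lemma art_even (k : ℕ) :
    (artA (2 * k) * artB (2 * k)) ^ k = (artB (2 * k) * artA (2 * k)) ^ k := by
  have h := art_rel (2 * k)
  rwa [map_altProd_even, map_altProd_even] at h

lemma art_odd (n : ℕ) :
    artA (2 * n + 1) * (artB (2 * n + 1) * artA (2 * n + 1)) ^ n =
      artB (2 * n + 1) * (artA (2 * n + 1) * artB (2 * n + 1)) ^ n := by
  have h := art_rel (2 * n + 1)
  rwa [map_altProd_odd, map_altProd_odd] at h

/-- Elements commuting with the generators are central. -/
lemma art_central {m : ℕ} {z : DihedralArtin m} (ha : Commute z (artA m))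
    (hb : Commute z (artB m)) (g : DihedralArtin m) : Commute z g := by
  have h := art_closure m (Subgroup.centralizer {z})
    (Subgroup.mem_centralizer_singleton_iff.2 ha.eq.symm)
    (Subgroup.mem_centralizer_singleton_iff.2 hb.eq.symm)
  have hg : g ∈ Subgroup.centralizer {z} := h ▸ Subgroup.mem_top g
  exact (Subgroup.mem_centralizer_singleton_iff.1 hg).symm

lemma exists_hom_even (k : ℕ) (u v : H) (h : (u * v) ^ k = (v * u) ^ k) :
    ∃ φ : DihedralArtin (2 * k) →* H, φ (artA _) = u ∧ φ (artB _) = v := by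
  have hr : ∀ r ∈ dihedralArtinRels (2 * k), FreeGroup.lift ![u, v] r = 1 := by
    rintro _ rfl
    rw [map_mul, map_inv, map_altProd_even, map_altProd_even, mul_inv_eq_one]
    simpa using h
  exact ⟨PresentedGroup.toGroup hr, PresentedGroup.toGroup.of hr, PresentedGroup.toGroup.of hr⟩

lemma exists_hom_odd (n : ℕ) (u v : H) (h : u * (v * u) ^ n = v * (u * v) ^ n) :
    ∃ φ : DihedralArtin (2 * n + 1) →* H, φ (artA _) = u ∧ φ (artB _) = v := by
  have hr : ∀ r ∈ dihedralArtinRels (2 * n + 1), FreeGroup.lift ![u, v] r = 1 := by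
    rintro _ rfl
    rw [map_mul, map_inv, map_altProd_odd, map_altProd_odd, mul_inv_eq_one]
    simpa using h
  exact ⟨PresentedGroup.toGroup hr, PresentedGroup.toGroup.of hr, PresentedGroup.toGroup.of hr⟩

lemma mul_pow_mul_comm (u v : H) (n : ℕ) : u * (v * u) ^ n = (u * v) ^ n * u :=
  ((SemiconjBy.pow_right (by simp [SemiconjBy, mul_assoc] : SemiconjBy u (v * u) (u * v)) n)).eq

end

lemma exists_centralData_even (k : ℕ) [NeZero k] :
    Nonempty (CentralData (Fac k) (DihedralArtin (2 * k)) k (Lam k Bool)) := by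
  let a := artA (2 * k)
  let b := artB (2 * k)
  have hr : (a * b) ^ k = (b * a) ^ k := art_even k
  have hza : Commute ((a * b) ^ k) a := by
    change _ = _
    rw [← mul_pow_mul_comm, hr]
  have hzb : Commute ((a * b) ^ k) b := by
    change _ = _
    rw [mul_pow_mul_comm, hr]
  obtain ⟨χ, hχa, hχb⟩ := exists_hom_even k (1 : Multiplicative ℤ) (Multiplicative.ofAdd 1)
    (by simp)
  let s : CoprodI (Fac k) := CoprodI.of (two k true)
  let t : CoprodI (Fac k) := CoprodI.of (two k false)
  let Y : CoprodI (Fac k) := CoprodI.of (cyc k 1)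
  have hs : s * s = 1 := by rw [← map_mul, two_mul_self, map_one]
  have ht : t * t = 1 := by rw [← map_mul, two_mul_self, map_one]
  have hY : Y ^ k = 1 := by
    rw [← map_pow, cyc_one_pow, ZMod.natCast_self]
    exact map_one _
  obtain ⟨π, hπa, hπb⟩ := exists_hom_even k (s * t) ((s * t)⁻¹ * Y) (by
    have h := mul_pow_mul_comm (s * t) ((s * t)⁻¹ * Y) k
    rw [mul_inv_cancel_left, hY, one_mul, mul_eq_left] at h
    rw [mul_inv_cancel_left, hY, h])
  have hst : (s * t)⁻¹ = t * s := by
    rw [mul_inv_rev, inv_eq_of_mul_eq_one_left hs, inv_eq_of_mul_eq_one_left ht]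
  refine ⟨lamData (κ := Bool) not (fun c => if c then a else a⁻¹) (a * b) ((a * b) ^ k) χ π id true
    (by decide) Function.injective_id (art_central hza hzb) rfl (by simp) 0 ?_ ?_ ?_ ?_ ?_⟩
  · rintro (_ | _) <;> simp
  · have ha : a ∈ Subgroup.closure
        (insert (a * b) (Set.range fun c : Bool => if c then a else a⁻¹)) :=
      Subgroup.subset_closure (Or.inr ⟨true, rfl⟩)
    refine art_closure _ _ ha ?_
    rw [← Subgroup.mul_mem_cancel_left _ ha]
    exact Subgroup.subset_closure (Or.inl rfl)
  · rw [map_pow, map_mul, hχa, hχb, one_mul, ← ofAdd_nsmul, nsmul_one]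
  · rw [map_mul, hπa, hπb, mul_inv_cancel_left]
  · rintro (_ | _)
    · change π a⁻¹ = t * s
      rw [map_inv, hπa, hst]
    · exact hπa

lemma exists_centralData_odd (n : ℕ) :
    Nonempty (CentralData (Fac (2 * n + 1)) (DihedralArtin (2 * n + 1)) (2 * (2 * n + 1))
      (Lam (2 * n + 1) Unit)) := by
  let a := artA (2 * n + 1)
  let b := artB (2 * n + 1)
  let x := a * (b * a) ^ n
  have hr : x = b * (a * b) ^ n := art_odd n
  have hx : x = (a * b) ^ n * a := mul_pow_mul_comm a b n
  have hxx : x * x = (a * b) ^ (2 * n + 1) := by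
    nth_rewrite 1 [hx]
    rw [hr, ← mul_assoc, mul_assoc _ a b, ← pow_succ, ← pow_add]
    congr 1
    ring
  have hzx : Commute ((a * b) ^ (2 * n + 1)) x := hxx ▸ (Commute.refl x).mul_left (Commute.refl x)
  have hzy : Commute ((a * b) ^ (2 * n + 1)) (a * b) := (Commute.refl _).pow_left _
  have ha : a = ((a * b) ^ n)⁻¹ * x := by rw [hx, inv_mul_cancel_left]
  have hb : b = a⁻¹ * (a * b) := by rw [inv_mul_cancel_left]
  have hza : Commute ((a * b) ^ (2 * n + 1)) a := by
    have := (hzy.pow_right n).inv_right.mul_right hzx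
    rwa [← ha] at this
  have hzb : Commute ((a * b) ^ (2 * n + 1)) b := by
    have := hza.inv_right.mul_right hzy
    rwa [inv_mul_cancel_left] at this
  obtain ⟨χ, hχa, hχb⟩ := exists_hom_odd n (Multiplicative.ofAdd (1 : ℤ)) (Multiplicative.ofAdd 1)
    rfl
  let s : CoprodI (Fac (2 * n + 1)) := CoprodI.of (two _ true)
  let Y : CoprodI (Fac (2 * n + 1)) := CoprodI.of (cyc _ 1)
  have hs : s * s = 1 := by rw [← map_mul, two_mul_self, map_one]
  have hY : Y ^ (2 * n + 1) = 1 := by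
    rw [← map_pow, cyc_one_pow, ZMod.natCast_self]
    exact map_one _
  have hY' : Y ^ (n + 1) * Y ^ n = 1 := by
    rw [← pow_add, ← hY]
    congr 1
    ring
  have huv : (Y ^ n)⁻¹ * s * (s * Y ^ (n + 1)) = Y := by
    rw [mul_assoc, ← mul_assoc s, hs, one_mul, pow_succ, inv_mul_cancel_left]
  obtain ⟨π, hπa, hπb⟩ := exists_hom_odd n ((Y ^ n)⁻¹ * s) (s * Y ^ (n + 1)) (by
    rw [mul_pow_mul_comm, huv, mul_inv_cancel_left, mul_assoc, hY', mul_one])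
  refine ⟨lamData (κ := Unit) id (fun _ => x) (a * b) ((a * b) ^ (2 * n + 1)) χ π
    (fun _ => true) false (by simp) (Function.injective_of_subsingleton _)
    (art_central hza hzb) rfl (by simp) 1 ?_ ?_ ?_ ?_ ?_⟩
  · intro
    rw [hxx, zpow_one]
  · have hy : a * b ∈ Subgroup.closure (insert (a * b) (Set.range fun _ : Unit => x)) :=
      Subgroup.subset_closure (Or.inl rfl)
    have ha' : a ∈ Subgroup.closure (insert (a * b) (Set.range fun _ : Unit => x)) := by
      rw [← Subgroup.mul_mem_cancel_left _ (Subgroup.pow_mem _ hy n), ← hx]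
      exact Subgroup.subset_closure (Or.inr ⟨(), rfl⟩)
    refine art_closure _ _ ha' ?_
    rwa [← Subgroup.mul_mem_cancel_left _ ha']
  · rw [map_pow, map_mul, hχa, hχb, ← ofAdd_add, ← ofAdd_nsmul]
    simp [mul_comm]
  · rw [map_mul, hπa, hπb, huv]
  · intro
    change π x = s * 1
    rw [hx, map_mul, map_pow, map_mul, hπa, hπb, huv, mul_inv_cancel_left, mul_one]

end

/-- For every `m ≥ 2`, the dihedral Artin group `DA_m` admits a finite
generating set and a regular quasigeodesic normal form `η` such that the solution
language, w.r.t. `η`, of every finite system of equations in `DA_m` is EDT0L. -/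
theorem edt0l_dihedral_artin (m : ℕ) (hm : 2 ≤ m) :
    ∃ (ι : Type) (_ : Fintype ι) (gen : ι → DihedralArtin m)
      (η : DihedralArtin m → List (ι × Bool)),
      Subgroup.closure (Set.range gen) = ⊤ ∧
      (∀ g : DihedralArtin m, evalWord gen (η g) = g) ∧
      IsRegularNF η ∧ IsQuasigeodesicNF gen η ∧
      ∀ (p : ℕ) (E : Set (Monoid.Coprod (DihedralArtin m) (FreeGroup (Fin p)))),
        E.Finite → IsEDT0L (solutionLanguage η E) := by
  obtain ⟨k, rfl | rfl⟩ := Nat.even_or_odd' m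
  · have : NeZero k := ⟨by omega⟩
    obtain ⟨d⟩ := exists_centralData_even k
    exact d.exists_normalForm
  · obtain ⟨d⟩ := exists_centralData_odd k
    have : NeZero (2 * (2 * k + 1)) := ⟨by omega⟩
    exact d.exists_normalForm

end Paper
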